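/- There exist a constant ε > 0 (with ε ≈ 10^{-5}) and flip parameters p_1 = 1, p_2, …, p_6 ∈ (0,1), p_j = 0 for j ≥ 7, such that the following holds: for all integers q and Δ there is a constant K = K(q,Δ) such that for every list-coloring instance (G, L) with n vertices, maximum degree at most Δ, lists L(v) ⊆ [q], and |L(v)| ≥ (11/6 − ε)·Δ for all v ∈ V, the flip dynamics with these parameters admits a C-amortized convergent coupling with respect to Hamming distance on colorings, with C ≤ K·n. -/

import Mathlib

open Finset

attribute [local instance] Classical.propDecidable

/-- `μ` is a probability distribution on the finite type `Ω`. -/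
def IsProbDist {Ω : Type*} [Fintype Ω] (μ : Ω → ℝ) : Prop :=
  (∀ x, 0 ≤ μ x) ∧ ∑ x, μ x = 1

/-- `P` is a row-stochastic transition matrix whose dynamics is supported on `Ω₀`
(transitions out of `Ω₀` are impossible, and off `Ω₀` the matrix is extended as the identity,
so that `P` together with its powers faithfully represents a Markov chain on state space `Ω₀`). -/
def IsTransOn {Ω : Type*} [Fintype Ω] [DecidableEq Ω] (P : Matrix Ω Ω ℝ) (Ω₀ : Set Ω) : Prop :=
  (∀ x y, 0 ≤ P x y) ∧ (∀ x, ∑ y, P x y = 1) ∧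
    (∀ x ∈ Ω₀, ∀ y, P x y ≠ 0 → y ∈ Ω₀) ∧
    (∀ x, x ∉ Ω₀ → ∀ y, P x y = if x = y then 1 else 0)

/-- `P` is reversible with respect to `π`. -/
def ReversibleWrt {Ω : Type*} (P : Matrix Ω Ω ℝ) (π : Ω → ℝ) : Prop :=
  ∀ x y, π x * P x y = π y * P y x

/-- `π` is stationary for `P`. -/
def StationaryWrt {Ω : Type*} [Fintype Ω] (P : Matrix Ω Ω ℝ) (π : Ω → ℝ) : Prop :=
  ∀ y, ∑ x, π x * P x y = π y

/-- `P` is irreducible on the state space `Ω₀`. -/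
def IrreducibleOn {Ω : Type*} [Fintype Ω] [DecidableEq Ω] (P : Matrix Ω Ω ℝ) (Ω₀ : Set Ω) : Prop :=
  ∀ x ∈ Ω₀, ∀ y ∈ Ω₀, ∃ t : ℕ, 0 < (P ^ t) x y

/-- `P` is aperiodic on the state space `Ω₀`: for every state, the gcd of the return
times is `1` (every common divisor of the return times equals `1`). -/
def AperiodicOn {Ω : Type*} [Fintype Ω] [DecidableEq Ω] (P : Matrix Ω Ω ℝ) (Ω₀ : Set Ω) : Prop :=
  ∀ x ∈ Ω₀, ∀ d : ℕ, 0 < d → (∀ t : ℕ, 0 < t → 0 < (P ^ t) x x → d ∣ t) → d = 1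

/-- A coupling of two faithful copies of the chain `P`, recorded through its time-`t` joint
distributions: `coup x y t a b` is the probability that `(X t, Y t) = (a, b)` given the starting
states `X 0 = x` and `Y 0 = y`; marginally each copy evolves according to `P`. -/
def IsCoupling {Ω : Type*} [Fintype Ω] [DecidableEq Ω] (P : Matrix Ω Ω ℝ)
    (coup : Ω → Ω → ℕ → Ω → Ω → ℝ) : Prop :=
  (∀ x y t a b, 0 ≤ coup x y t a b) ∧
    (∀ x y t a, ∑ b, coup x y t a b = (P ^ t) x a) ∧
    (∀ x y t b, ∑ a, coup x y t a b = (P ^ t) y b)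

/-- Hamming distance between two finite sets: the size of their symmetric difference. -/
def hamm {U : Type*} [DecidableEq U] (S T : Finset U) : ℕ := ((S \ T) ∪ (T \ S)).card

/-- `margOf μ j = Pr_{S ∼ μ}[j ∈ S]`. -/
def margOf {U : Type*} [Fintype U] [DecidableEq U] (μ : Finset U → ℝ) (j : U) : ℝ :=
  ∑ S : Finset U, if j ∈ S then μ S else 0

/-- `μ` conditioned on the event `{S : A ⊆ S}`. -/
noncomputable def condOn {U : Type*} [Fintype U] [DecidableEq U] (μ : Finset U → ℝ)
    (A : Finset U) : Finset U → ℝ := fun S =>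
  if A ⊆ S then μ S / ∑ T : Finset U, (if A ⊆ T then μ T else 0) else 0

section ListColoring

variable {V : Type*} [Fintype V] [DecidableEq V] {q : ℕ}

/-- `σ` is a proper list-coloring of the instance `(G, L)`. -/
def IsProperListColoring (G : SimpleGraph V) (L : V → Finset (Fin q)) (σ : V → Fin q) : Prop :=
  (∀ v, σ v ∈ L v) ∧ ∀ u v, G.Adj u v → σ u ≠ σ v

/-- One step of an alternating path inside the active vertex set `Vs`, using only the two
colors `a` and `b`. -/
def kempeStep (G : SimpleGraph V) (Vs : Finset V) (σ : V → Fin q) (a b : Fin q)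
    (w w' : V) : Prop :=
  w ∈ Vs ∧ w' ∈ Vs ∧ G.Adj w w' ∧ (σ w = a ∨ σ w = b) ∧ (σ w' = a ∨ σ w' = b) ∧ σ w ≠ σ w'

/-- The Kempe component `S_σ(u,c)` (within the active vertex set `Vs`): all vertices reachable
from `u` along an alternating path using the colors `σ u` and `c`. -/
noncomputable def kempeComp (G : SimpleGraph V) (Vs : Finset V) (σ : V → Fin q)
    (u : V) (c : Fin q) : Finset V :=
  Finset.univ.filter fun v => Relation.ReflTransGen (kempeStep G Vs σ (σ u) c) u v

/-- The coloring obtained from `σ` by interchanging the colors `a` and `b` on `S`. -/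
def flipConf (σ : V → Fin q) (a b : Fin q) (S : Finset V) : V → Fin q := fun v =>
  if v ∈ S then (if σ v = a then b else if σ v = b then a else σ v) else σ v

/-- The flip dynamics with flip parameters `p`: pick a uniformly random active vertex
`v ∈ Vs` and a uniformly random color `c` from the pick-list `Lpick v`; if the Kempe
component `S = S_σ(v,c)` (within `Vs`) is flippable (i.e. the flipped coloring is a proper
list-coloring for `(G, L)`), flip it with probability `p |S| / |S|`, otherwise stay. -/
noncomputable def flipMatrix (G : SimpleGraph V) (Vs : Finset V)
    (Lpick L : V → Finset (Fin q)) (p : ℕ → ℝ) :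
    Matrix (V → Fin q) (V → Fin q) ℝ := fun σ τ =>
  (Vs.card : ℝ)⁻¹ * ∑ v ∈ Vs, ((Lpick v).card : ℝ)⁻¹ * ∑ c ∈ Lpick v,
    ((if IsProperListColoring G L (flipConf σ (σ v) c (kempeComp G Vs σ v c)) ∧
          τ = flipConf σ (σ v) c (kempeComp G Vs σ v c)
        then p (kempeComp G Vs σ v c).card / ((kempeComp G Vs σ v c).card : ℝ) else 0) +
      (if τ = σ then
          1 - (if IsProperListColoring G L (flipConf σ (σ v) c (kempeComp G Vs σ v c))
              then p (kempeComp G Vs σ v c).card / ((kempeComp G Vs σ v c).card : ℝ) else 0)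
        else 0))

end ListColoring

/-- Hamming distance between two colorings. -/
def hammCol {V : Type*} [Fintype V] {q : ℕ} (σ τ : V → Fin q) : ℕ :=
  (Finset.univ.filter fun v => σ v ≠ τ v).card

set_option linter.unusedSectionVars false

/-- Finite Kantorovich–Rubinstein duality: a bound on all `1`-Lipschitz test functions yields a
coupling of the same transport cost. -/
theorem exists_coupling_of_lipschitz_le {Ω : Type*} [Fintype Ω] (D : Ω → Ω → ℝ)
    (hself : ∀ x, D x x = 0)
    (htri : ∀ x y z, D x z ≤ D x y + D y z) (μ ν : Ω → ℝ)
    (hμ : IsProbDist μ) (hν : IsProbDist ν) (K : ℝ)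
    (hK : ∀ f : Ω → ℝ, (∀ x y, f x - f y ≤ D x y) → ∑ x, μ x * f x - ∑ x, ν x * f x ≤ K) :
    ∃ π : Ω → Ω → ℝ, (∀ x y, 0 ≤ π x y) ∧ (∀ x, ∑ y, π x y = μ x) ∧ (∀ y, ∑ x, π x y = ν y) ∧
      ∑ x, ∑ y, π x y * D x y ≤ K := by
  classical
  have hne : Nonempty Ω := by
    by_contra h
    rw [not_nonempty_iff] at h
    have := hμ.2
    simp at this
  let Θ : (Ω × Ω → ℝ) →ₗ[ℝ] (Ω → ℝ) × (Ω → ℝ) × ℝ :=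
    { toFun := fun π => (fun x => ∑ y, π (x, y), fun y => ∑ x, π (x, y),
        ∑ x, ∑ y, π (x, y) * D x y)
      map_add' := by
        intro π π'
        ext <;> simp [Finset.sum_add_distrib, add_mul]
      map_smul' := by
        intro c π
        ext <;> simp [Finset.mul_sum, mul_assoc] }
  have hΘc : Continuous Θ := Θ.continuous_of_finiteDimensional
  let s : Set ((Ω → ℝ) × (Ω → ℝ) × ℝ) := Θ '' stdSimplex ℝ (Ω × Ω)
  let t : Set ((Ω → ℝ) × (Ω → ℝ) × ℝ) := {μ} ×ˢ ({ν} ×ˢ Set.Iic K)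
  by_cases hdisj : Disjoint s t
  · exfalso
    obtain ⟨F, u, v, hs, huv, ht⟩ := geometric_hahn_banach_compact_closed
      ((convex_stdSimplex ℝ (Ω × Ω)).linear_image Θ)
      ((isCompact_stdSimplex ℝ (Ω × Ω)).image hΘc)
      ((convex_singleton μ).prod ((convex_singleton ν).prod (convex_Iic K)))
      (isClosed_singleton.prod (isClosed_singleton.prod isClosed_Iic)) hdisj
    let φ : Ω → ℝ := fun x => F (Pi.single x 1, 0, 0)
    let ψ : Ω → ℝ := fun y => F (0, Pi.single y 1, 0)
    let l : ℝ := F (0, 0, 1)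
    have hF : ∀ (a b : Ω → ℝ) (r : ℝ), F (a, b, r) = ∑ x, a x * φ x + ∑ y, b y * ψ y + r * l := by
      intro a b r
      have e : ((a, b, r) : (Ω → ℝ) × (Ω → ℝ) × ℝ) =
          ∑ x, a x • ((Pi.single x 1, 0, 0) : (Ω → ℝ) × (Ω → ℝ) × ℝ) +
          ∑ y, b y • ((0, Pi.single y 1, 0) : (Ω → ℝ) × (Ω → ℝ) × ℝ) + r • (0, 0, 1) := by
        ext x
        · simp [Prod.fst_sum, Finset.sum_apply, Pi.single_apply]
        · simp [Prod.fst_sum, Prod.snd_sum, Finset.sum_apply, Pi.single_apply]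
        · simp [Prod.snd_sum]
      rw [e, map_add, map_add, map_sum, map_sum]
      simp only [map_smul, smul_eq_mul, φ, ψ, l]
    have hpt : ∀ x y, φ x + ψ y + D x y * l < u := by
      intro x y
      have := hs (Θ (Pi.single (x, y) 1)) ⟨_, single_mem_stdSimplex ℝ (x, y), rfl⟩
      have e : Θ (Pi.single (x, y) 1) = (Pi.single x 1, Pi.single y 1, D x y) := by
        ext z
        · by_cases h : z = x
          · subst h
            simp only [Θ, LinearMap.coe_mk, AddHom.coe_mk, Pi.single_apply, Prod.mk.injEq]
            rw [Finset.sum_eq_single y] <;> simp +contextual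
          · simp [Θ, Pi.single_apply, h]
        · by_cases h : z = y
          · subst h
            simp only [Θ, LinearMap.coe_mk, AddHom.coe_mk, Pi.single_apply, Prod.mk.injEq]
            rw [Finset.sum_eq_single x] <;> simp +contextual
          · simp [Θ, Pi.single_apply, h]
        · simp only [Θ, LinearMap.coe_mk, AddHom.coe_mk, Pi.single_apply, Prod.mk.injEq, ite_mul,
            one_mul, zero_mul]
          rw [Finset.sum_eq_single x, Finset.sum_eq_single y] <;> simp +contextual
      rw [e, hF] at this
      simpa [Pi.single_apply] using this
    have htt : ∀ r ≤ K, v < ∑ x, μ x * φ x + ∑ y, ν y * ψ y + r * l := by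
      intro r hr
      rw [← hF]
      exact ht _ ⟨rfl, rfl, hr⟩
    have hl : l ≤ 0 := by
      by_contra! hl
      set S := ∑ x, μ x * φ x + ∑ y, ν y * ψ y
      have h1 := htt (min K ((v - S) / l)) (min_le_left _ _)
      have h2 : min K ((v - S) / l) * l ≤ (v - S) / l * l :=
        mul_le_mul_of_nonneg_right (min_le_right _ _) hl.le
      rw [div_mul_cancel₀ _ hl.ne'] at h2
      linarith
    have hmin : ∀ y, ∃ x0, ∀ x, u - l * D x0 y - φ x0 ≤ u - l * D x y - φ x := by
      intro y
      obtain ⟨x0, -, h⟩ := Finset.exists_min_image (univ : Finset Ω)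
        (fun x => u - l * D x y - φ x) univ_nonempty
      exact ⟨x0, fun x => h x (mem_univ x)⟩
    choose x0 hx0 using hmin
    let g : Ω → ℝ := fun y => u - l * D (x0 y) y - φ (x0 y)
    have hg1 : ∀ y, ψ y ≤ g y := by
      intro y
      have := hpt (x0 y) y
      simp only [g]; nlinarith
    have hg2 : ∀ x, φ x ≤ u - g x := by
      intro x
      have := hx0 x x
      rw [hself] at this
      simp only [g]; linarith
    have hglip : ∀ x y, g y - g x ≤ -l * D x y := by
      intro x y
      have h1 := hx0 y (x0 x)
      have h2 := htri (x0 x) x y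
      simp only [g]; nlinarith
    have hmain : ∑ x, ν x * g x - ∑ x, μ x * g x ≤ -l * K := by
      rcases hl.lt_or_eq with hl | hl
      · have hl' : 0 < -l := by linarith
        have := hK (fun x => - g x / (-l)) (by
          intro x y
          rw [← sub_div, div_le_iff₀ hl']
          have := hglip x y
          linarith)
        have e : ∀ m : Ω → ℝ, ∑ x, m x * (- g x / (-l)) = - (∑ x, m x * g x) / (-l) := by
          intro m
          rw [← Finset.sum_neg_distrib, Finset.sum_div]
          exact Finset.sum_congr rfl fun x _ => by ring
        rw [e, e, ← sub_div, div_le_iff₀ hl'] at this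
        linarith
      · have hc : ∀ x y, g x = g y := by
          intro x y
          have h1 := hglip x y
          have h2 := hglip y x
          rw [hl] at h1 h2
          linarith
        obtain ⟨z⟩ := hne
        have e : ∀ m : Ω → ℝ, ∑ x, m x * g x = (∑ x, m x) * g z := by
          intro m
          rw [Finset.sum_mul]
          exact Finset.sum_congr rfl fun x _ => by rw [hc x z]
        rw [e, e, hμ.2, hν.2, hl]
        simp
    have h1 : ∑ x, μ x * φ x ≤ u - ∑ x, μ x * g x := by
      calc ∑ x, μ x * φ x ≤ ∑ x, μ x * (u - g x) :=
            Finset.sum_le_sum fun x _ => mul_le_mul_of_nonneg_left (hg2 x) (hμ.1 x)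
        _ = u - ∑ x, μ x * g x := by
            simp only [mul_sub, Finset.sum_sub_distrib, ← Finset.sum_mul, hμ.2, one_mul]
    have h2 : ∑ x, ν x * ψ x ≤ ∑ x, ν x * g x :=
      Finset.sum_le_sum fun x _ => mul_le_mul_of_nonneg_left (hg1 x) (hν.1 x)
    have h3 := htt K le_rfl
    nlinarith
  · rw [Set.not_disjoint_iff] at hdisj
    obtain ⟨p, ⟨π, hπ, rfl⟩, hp⟩ := hdisj
    simp only [Θ, t, LinearMap.coe_mk, AddHom.coe_mk, Set.mem_prod, Set.mem_singleton_iff,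
      Set.mem_Iic] at hp
    exact ⟨fun x y => π (x, y), fun x y => hπ.1 _, fun x => congrFun hp.1 x,
      fun y => congrFun hp.2.1 y, hp.2.2⟩

/-- The flip parameters used in the analysis. -/
noncomputable def flipParam : ℕ → ℝ
  | 1 => 1
  | 2 => 3 / 10
  | 3 => 1 / 6
  | 4 => 1 / 10
  | 5 => 1 / 18
  | 6 => 1 / 40
  | _ => 0

lemma flipParam_nonneg (j : ℕ) : 0 ≤ flipParam j := by
  unfold flipParam; split <;> norm_num

lemma flipParam_le_one (j : ℕ) : flipParam j ≤ 1 := by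
  unfold flipParam; split <;> norm_num

lemma flipParam_of_seven_le {j : ℕ} (hj : 7 ≤ j) : flipParam j = 0 := by
  unfold flipParam; split <;> first | omega | rfl

lemma flipParam_div_mem (j : ℕ) : 0 ≤ flipParam j / j ∧ flipParam j / j ≤ 1 := by
  refine ⟨div_nonneg (flipParam_nonneg j) (Nat.cast_nonneg j), ?_⟩
  rcases Nat.eq_zero_or_pos j with rfl | h
  · simp
  · have : (1 : ℝ) ≤ j := by exact_mod_cast h
    rw [div_le_one (by linarith)]
    exact (flipParam_le_one j).trans this

lemma flipParam_div_le {j : ℕ} (hj : 2 ≤ j) : flipParam j / j ≤ 3 / 20 := by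
  rcases lt_or_ge j 7 with h | h
  · interval_cases j <;> norm_num [flipParam]
  · rw [flipParam_of_seven_le h]; norm_num


section Kempe

variable {V : Type*} [Fintype V] [DecidableEq V] {q : ℕ} (G : SimpleGraph V)

/-- All colors are taken from the lists (the coloring may be improper). -/
def ListRespecting (L : V → Finset (Fin q)) (σ : V → Fin q) : Prop := ∀ v, σ v ∈ L v

/-- The coloring obtained by flipping the Kempe component of `z` with color `c`. -/
noncomputable def kempeFlip (σ : V → Fin q) (z : V) (c : Fin q) : V → Fin q :=
  flipConf σ (σ z) c (kempeComp G univ σ z c)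

variable {G}

lemma flipConf_eq_swap (σ : V → Fin q) (a b : Fin q) (S : Finset V) (v : V) :
    flipConf σ a b S v = if v ∈ S then Equiv.swap a b (σ v) else σ v := by
  simp only [flipConf, Equiv.swap_apply_def]

lemma flipConf_comm (σ : V → Fin q) (a b : Fin q) (S : Finset V) :
    flipConf σ a b S = flipConf σ b a S := by
  ext v; rw [flipConf_eq_swap, flipConf_eq_swap, Equiv.swap_comm]

lemma kempeStep_symm {σ : V → Fin q} {a b : Fin q} {w w' : V}
    (h : kempeStep G univ σ a b w w') : kempeStep G univ σ a b w' w :=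
  ⟨h.2.1, h.1, h.2.2.1.symm, h.2.2.2.2.1, h.2.2.2.1, h.2.2.2.2.2.symm⟩

lemma kempeStep_comm (σ : V → Fin q) (a b : Fin q) :
    kempeStep G univ σ a b = kempeStep G univ σ b a := by
  ext w w'; simp only [kempeStep]; tauto

lemma kempeReach_symm {σ : V → Fin q} {a b : Fin q} {w w' : V}
    (h : Relation.ReflTransGen (kempeStep G univ σ a b) w w') :
    Relation.ReflTransGen (kempeStep G univ σ a b) w' w := by
  induction h with
  | refl => exact .refl
  | tail _ h ih => exact .head (kempeStep_symm h) ih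

lemma mem_kempeComp {σ : V → Fin q} {z w : V} {c : Fin q} :
    w ∈ kempeComp G univ σ z c ↔
      Relation.ReflTransGen (kempeStep G univ σ (σ z) c) z w := by
  simp [kempeComp]

lemma self_mem_kempeComp (σ : V → Fin q) (z : V) (c : Fin q) : z ∈ kempeComp G univ σ z c :=
  mem_kempeComp.2 .refl

lemma card_kempeComp_pos (σ : V → Fin q) (z : V) (c : Fin q) :
    0 < (kempeComp G univ σ z c).card := card_pos.2 ⟨z, self_mem_kempeComp σ z c⟩

lemma color_of_mem_kempeComp {σ : V → Fin q} {z w : V} {c : Fin q}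
    (h : w ∈ kempeComp G univ σ z c) : σ w = σ z ∨ σ w = c := by
  rw [mem_kempeComp] at h
  rcases h.cases_tail with h | ⟨_, _, h⟩
  · exact .inl (by rw [h])
  · exact h.2.2.2.2.1

/-- The other color of the pair `{x, c}`. -/
def otherColor (x c y : Fin q) : Fin q := if y = x then c else x

lemma pair_otherColor {x c y : Fin q} (h : y = x ∨ y = c) :
    (y = x ∧ otherColor x c y = c) ∨ (y = c ∧ otherColor x c y = x) := by
  unfold otherColor
  rcases h with h | h
  · exact .inl ⟨h, if_pos h⟩
  · by_cases h' : y = x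
    · exact .inl ⟨h', if_pos h'⟩
    · exact .inr ⟨h, if_neg h'⟩

lemma kempeComp_eq_of_mem {σ : V → Fin q} {z w : V} {c : Fin q}
    (h : w ∈ kempeComp G univ σ z c) :
    kempeComp G univ σ w (otherColor (σ z) c (σ w)) = kempeComp G univ σ z c := by
  have hs : kempeStep G univ σ (σ w) (otherColor (σ z) c (σ w)) = kempeStep G univ σ (σ z) c := by
    rcases pair_otherColor (color_of_mem_kempeComp h) with ⟨h1, h2⟩ | ⟨h1, h2⟩
    · rw [h2, h1]
    · rw [h2, h1, kempeStep_comm]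
  rw [mem_kempeComp] at h
  ext u
  rw [mem_kempeComp, mem_kempeComp, hs]
  exact ⟨fun h' => h.trans h', fun h' => (kempeReach_symm h).trans h'⟩

lemma kempeFlip_eq_of_mem {σ : V → Fin q} {z w : V} {c : Fin q}
    (h : w ∈ kempeComp G univ σ z c) :
    kempeFlip G σ w (otherColor (σ z) c (σ w)) = kempeFlip G σ z c := by
  unfold kempeFlip
  rw [kempeComp_eq_of_mem h]
  rcases pair_otherColor (color_of_mem_kempeComp h) with ⟨h1, h2⟩ | ⟨h1, h2⟩
  · rw [h2, h1]
  · rw [h2, h1, flipConf_comm]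

lemma kempeFlip_of_notMem {σ : V → Fin q} {z w : V} {c : Fin q}
    (h : w ∉ kempeComp G univ σ z c) : kempeFlip G σ z c w = σ w := by
  simp [kempeFlip, flipConf, h]

lemma kempeFlip_of_mem {σ : V → Fin q} {z w : V} {c : Fin q}
    (h : w ∈ kempeComp G univ σ z c) :
    kempeFlip G σ z c w = otherColor (σ z) c (σ w) := by
  simp only [kempeFlip, flipConf, h, if_true, otherColor]
  rcases color_of_mem_kempeComp h with h | h
  · simp [h]
  · by_cases h' : σ w = σ z
    · simp [h']
    · simp [h]

lemma kempeFlip_self (σ : V → Fin q) (z : V) (c : Fin q) : kempeFlip G σ z c z = c := by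
  rw [kempeFlip_of_mem (self_mem_kempeComp σ z c)]; simp [otherColor]

lemma kempeComp_own (σ : V → Fin q) (z : V) : kempeComp G univ σ z (σ z) = {z} := by
  ext w
  rw [mem_kempeComp, mem_singleton]
  constructor
  · intro h
    rcases h.cases_head with h | ⟨y, h, _⟩
    · exact h.symm
    · obtain ⟨-, -, -, h1, h2, h3⟩ := h
      rw [or_self] at h1 h2
      exact absurd (h1.trans h2.symm) h3
  · rintro rfl; exact .refl

lemma kempeFlip_own (σ : V → Fin q) (z : V) : kempeFlip G σ z (σ z) = σ := by
  ext w
  by_cases h : w ∈ kempeComp G univ σ z (σ z)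
  · rw [kempeFlip_of_mem h]
    rcases color_of_mem_kempeComp h with h | h <;> simp [otherColor, h]
  · rw [kempeFlip_of_notMem h]

lemma isProper_kempeFlip_iff {L : V → Finset (Fin q)} {σ : V → Fin q}
    (hσ : IsProperListColoring G L σ) (z : V) (c : Fin q) :
    IsProperListColoring G L (kempeFlip G σ z c) ↔ ListRespecting L (kempeFlip G σ z c) := by
  refine ⟨fun h => h.1, fun h => ⟨h, ?_⟩⟩
  have key : ∀ u w, G.Adj u w → u ∈ kempeComp G univ σ z c → w ∉ kempeComp G univ σ z c →
      kempeFlip G σ z c u ≠ kempeFlip G σ z c w := by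
    intro u w huw hu hw
    rw [kempeFlip_of_notMem hw, kempeFlip_of_mem hu]
    intro he
    have hw' : σ w = σ z ∨ σ w = c := by
      rw [← he]; unfold otherColor; split_ifs <;> simp
    exact hw (mem_kempeComp.2 ((mem_kempeComp.1 hu).tail ⟨mem_univ _, mem_univ _, huw,
      color_of_mem_kempeComp hu, hw', hσ.2 u w huw⟩))
  intro u w huw
  by_cases hu : u ∈ kempeComp G univ σ z c <;> by_cases hw : w ∈ kempeComp G univ σ z c
  · simp only [kempeFlip, flipConf_eq_swap, hu, hw, if_true]
    exact fun h => hσ.2 u w huw ((Equiv.swap _ _).injective h)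
  · exact key u w huw hu hw
  · exact (key w u huw.symm hw hu).symm
  · rw [kempeFlip_of_notMem hu, kempeFlip_of_notMem hw]
    exact hσ.2 u w huw

variable (G)

/-- The probability of performing the move `(z, c)` once it has been picked. -/
noncomputable def moveRate (L : V → Finset (Fin q)) (σ : V → Fin q) (z : V) (c : Fin q) : ℝ :=
  if c ≠ σ z ∧ ListRespecting L (kempeFlip G σ z c) then
    flipParam (kempeComp G univ σ z c).card / (kempeComp G univ σ z c).card else 0

/-- The action of the flip dynamics on functions, extended to improper colorings. -/
noncomputable def flipOp (L : V → Finset (Fin q)) (f : (V → Fin q) → ℝ) (σ : V → Fin q) : ℝ :=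
  f σ + (Fintype.card V : ℝ)⁻¹ * ∑ z, ((L z).card : ℝ)⁻¹ *
    ∑ c, moveRate G L σ z c * (f (kempeFlip G σ z c) - f σ)

variable {G}

lemma moveRate_nonneg (L : V → Finset (Fin q)) (σ : V → Fin q) (z : V) (c : Fin q) :
    0 ≤ moveRate G L σ z c := by
  unfold moveRate; split_ifs
  · exact (flipParam_div_mem _).1
  · exact le_rfl

lemma moveRate_le_one (L : V → Finset (Fin q)) (σ : V → Fin q) (z : V) (c : Fin q) :
    moveRate G L σ z c ≤ 1 := by
  unfold moveRate; split_ifs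
  · exact (flipParam_div_mem _).2
  · exact zero_le_one

lemma moveRate_of_notMem {L : V → Finset (Fin q)} (σ : V → Fin q) {z : V} {c : Fin q}
    (h : c ∉ L z) : moveRate G L σ z c = 0 := by
  unfold moveRate
  rw [if_neg]
  rintro ⟨-, h'⟩
  exact h (by simpa [kempeFlip_self] using h' z)

lemma moveRate_own {L : V → Finset (Fin q)} (σ : V → Fin q) {z : V} {c : Fin q}
    (h : c = σ z) : moveRate G L σ z c = 0 := by
  unfold moveRate
  rw [if_neg]
  rintro ⟨h', -⟩
  exact h' h

end Kempe

section Reduction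

variable {V : Type*} [Fintype V] [DecidableEq V] {q : ℕ} {G : SimpleGraph V}

/-- Two list-respecting colorings that differ at exactly one vertex. -/
def ListAdjacent (L : V → Finset (Fin q)) (σ τ : V → Fin q) : Prop :=
  ListRespecting L σ ∧ ListRespecting L τ ∧ ∃ v, σ v ≠ τ v ∧ ∀ u, u ≠ v → σ u = τ u

lemma hammCol_self (σ : V → Fin q) : hammCol σ σ = 0 := by simp [hammCol]

lemma hammCol_triangle (σ τ ρ : V → Fin q) : hammCol σ ρ ≤ hammCol σ τ + hammCol τ ρ := by
  unfold hammCol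
  refine (card_le_card ?_).trans (card_union_le _ _)
  intro v
  simp only [mem_filter, mem_univ, true_and, mem_union]
  intro h
  by_contra! hne
  exact h (hne.1.trans hne.2)

/-- A bound on differences across single-vertex changes extends along Hamming paths. -/
lemma sub_le_hammCol_of_adjacent {L : V → Finset (Fin q)} {f : (V → Fin q) → ℝ} {l : ℝ}
    (hf : ∀ σ τ, ListAdjacent L σ τ → f σ - f τ ≤ l) {σ τ : V → Fin q}
    (hσ : ListRespecting L σ) (hτ : ListRespecting L τ) : f σ - f τ ≤ l * hammCol σ τ := by
  induction hn : hammCol σ τ generalizing σ with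
  | zero =>
    have : σ = τ := by
      ext v
      by_contra h
      have : v ∈ univ.filter fun v => σ v ≠ τ v := by
        simp only [mem_filter, mem_univ, true_and]
        exact fun h' => h (by rw [h'])
      rw [hammCol, card_eq_zero] at hn
      simp [hn] at this
    simp [this]
  | succ n ih =>
    have hne : (univ.filter fun v => σ v ≠ τ v).Nonempty := by
      rw [← card_pos]; unfold hammCol at hn; omega
    obtain ⟨v, hv⟩ := hne
    have hv' : σ v ≠ τ v := by simpa using hv
    have hr : ListRespecting L (Function.update σ v (τ v)) := by
      intro u
      by_cases h : u = v
      · subst h; simpa using hτ u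
      · simpa [h] using hσ u
    have h1 : hammCol (Function.update σ v (τ v)) τ = n := by
      have : (univ.filter fun u => Function.update σ v (τ v) u ≠ τ u) =
          (univ.filter fun v => σ v ≠ τ v).erase v := by
        ext u
        by_cases h : u = v
        · subst h; simp
        · simp [h]
      unfold hammCol at hn ⊢
      rw [this, card_erase_of_mem hv, hn]; rfl
    have h2 := ih hr h1
    have h3 := hf σ (Function.update σ v (τ v))
      ⟨hσ, hr, v, by simpa using hv', fun u hu => by simp [hu]⟩
    push_cast
    linarith

/-- `f` varies by at most `l * Φ` across single-vertex changes. -/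
def AdjLipschitz (L : V → Finset (Fin q)) (Φ : (V → Fin q) → (V → Fin q) → ℝ) (l : ℝ)
    (f : (V → Fin q) → ℝ) : Prop :=
  ∀ σ τ, ListAdjacent L σ τ → f σ - f τ ≤ l * Φ σ τ

lemma flipMatrix_nonneg (L : V → Finset (Fin q)) (σ τ : V → Fin q) :
    0 ≤ flipMatrix G univ L L flipParam σ τ := by
  unfold flipMatrix
  refine mul_nonneg (by positivity) (sum_nonneg fun v _ => mul_nonneg (by positivity)
    (sum_nonneg fun c _ => ?_))
  have h := flipParam_div_mem (kempeComp G univ σ v c).card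
  split_ifs <;> linarith [h.1, h.2]

lemma flipMatrix_sum_mul (L : V → Finset (Fin q)) (σ : V → Fin q) (f : (V → Fin q) → ℝ) :
    ∑ τ, flipMatrix G univ L L flipParam σ τ * f τ = (Fintype.card V : ℝ)⁻¹ * ∑ v,
      ((L v).card : ℝ)⁻¹ * ∑ c ∈ L v, ((if IsProperListColoring G L (kempeFlip G σ v c) then
        flipParam (kempeComp G univ σ v c).card / ((kempeComp G univ σ v c).card : ℝ) else 0) *
        (f (kempeFlip G σ v c) - f σ) + f σ) := by
  unfold flipMatrix
  simp only [mul_assoc, ← mul_sum, sum_mul]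
  rw [sum_comm]
  simp only [← mul_sum, Finset.card_univ]
  congr 1
  refine sum_congr rfl fun v _ => ?_
  congr 1
  rw [sum_comm]
  refine sum_congr rfl fun c _ => ?_
  change ∑ τ, ((if IsProperListColoring G L (kempeFlip G σ v c) ∧ τ = kempeFlip G σ v c then _
    else 0) + (if τ = σ then 1 - (if IsProperListColoring G L (kempeFlip G σ v c) then _ else 0)
      else 0)) * f τ = _
  generalize flipParam (kempeComp G univ σ v c).card / ((kempeComp G univ σ v c).card : ℝ) = x
  by_cases h : IsProperListColoring G L (kempeFlip G σ v c)
  · simp only [h, true_and, if_true, add_mul, ite_mul, zero_mul, sum_add_distrib]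
    rw [sum_eq_single (kempeFlip G σ v c), sum_eq_single σ]
    · simp; ring
    all_goals simp +contextual
  · simp only [h, false_and, if_false, sub_zero, zero_add, ite_mul, one_mul, zero_mul]
    rw [sum_eq_single σ]
    · simp
    all_goals simp +contextual

lemma flipMatrix_sum (L : V → Finset (Fin q)) (σ : V → Fin q) :
    ∑ τ, flipMatrix G univ L L flipParam σ τ =
      (Fintype.card V : ℝ)⁻¹ * ∑ v, ((L v).card : ℝ)⁻¹ * (L v).card := by
  have := flipMatrix_sum_mul (G := G) L σ (fun _ => 1)
  simpa using this

lemma flipMatrix_sum_mul_of_proper [Nonempty V] {L : V → Finset (Fin q)} {σ : V → Fin q}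
    (hσ : IsProperListColoring G L σ) (f : (V → Fin q) → ℝ) :
    ∑ τ, flipMatrix G univ L L flipParam σ τ * f τ = flipOp G L f σ := by
  rw [flipMatrix_sum_mul]
  have hV : (Fintype.card V : ℝ) ≠ 0 := by exact_mod_cast Fintype.card_ne_zero
  have key : ∀ v, ((L v).card : ℝ)⁻¹ * ∑ c ∈ L v,
      ((if IsProperListColoring G L (kempeFlip G σ v c) then
        flipParam (kempeComp G univ σ v c).card / ((kempeComp G univ σ v c).card : ℝ) else 0) *
        (f (kempeFlip G σ v c) - f σ) + f σ) = ((L v).card : ℝ)⁻¹ *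
      ∑ c, moveRate G L σ v c * (f (kempeFlip G σ v c) - f σ) + f σ := by
    intro v
    have hL : ((L v).card : ℝ) ≠ 0 := by
      exact_mod_cast (card_pos.2 ⟨σ v, hσ.1 v⟩).ne'
    rw [sum_add_distrib, sum_const, nsmul_eq_mul, mul_add, inv_mul_cancel_left₀ hL]
    congr 2
    rw [← sum_subset (subset_univ (L v)) fun c _ hc => by rw [moveRate_of_notMem σ hc, zero_mul]]
    refine sum_congr rfl fun c _ => ?_
    rw [isProper_kempeFlip_iff hσ]
    by_cases hc : c = σ v
    · rw [hc, kempeFlip_own]; simp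
    · simp only [moveRate, ne_eq, hc, not_false_eq_true, true_and]
  rw [sum_congr rfl fun v _ => key v, sum_add_distrib, mul_add, sum_const, card_univ,
    nsmul_eq_mul, inv_mul_cancel_left₀ hV, flipOp, add_comm]

lemma flipMatrix_pow_sum_mul [Nonempty V] {L : V → Finset (Fin q)} {σ : V → Fin q}
    (hσ : IsProperListColoring G L σ) (f : (V → Fin q) → ℝ) (t : ℕ) :
    ∑ τ, (flipMatrix G univ L L flipParam ^ t) σ τ * f τ = (flipOp G L)^[t] f σ := by
  induction t generalizing f with
  | zero => simp [Matrix.one_apply]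
  | succ t ih =>
    have hsupp : ∀ (t : ℕ) (τ : V → Fin q), ¬ IsProperListColoring G L τ →
        (flipMatrix G univ L L flipParam ^ t) σ τ = 0 := by
      intro t
      induction t with
      | zero =>
        intro τ hτ
        rw [pow_zero, Matrix.one_apply_ne]
        rintro rfl
        exact hτ hσ
      | succ t ih =>
        intro τ hτ
        rw [pow_succ, Matrix.mul_apply]
        refine sum_eq_zero fun ρ _ => ?_
        by_cases hρ : IsProperListColoring G L ρ
        · rw [mul_eq_zero]; right
          unfold flipMatrix
          refine mul_eq_zero_of_right _ (sum_eq_zero fun v _ =>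
            mul_eq_zero_of_right _ (sum_eq_zero fun c _ => ?_))
          rw [if_neg, if_neg, add_zero]
          · rintro rfl; exact hτ hρ
          · rintro ⟨h, rfl⟩; exact hτ h
        · rw [ih ρ hρ, zero_mul]
    rw [Function.iterate_succ_apply, ← ih (flipOp G L f)]
    simp only [pow_succ, Matrix.mul_apply, sum_mul]
    rw [sum_comm]
    refine sum_congr rfl fun ρ _ => ?_
    simp only [mul_assoc, ← mul_sum]
    by_cases hρ : IsProperListColoring G L ρ
    · rw [flipMatrix_sum_mul_of_proper hρ]
    · rw [hsupp t ρ hρ, zero_mul, zero_mul]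

lemma pow_nonneg_entries {Ω : Type*} [Fintype Ω] [DecidableEq Ω] {P : Matrix Ω Ω ℝ}
    (hP : ∀ x y, 0 ≤ P x y) (t : ℕ) (x y : Ω) : 0 ≤ (P ^ t) x y := by
  induction t generalizing y with
  | zero => rw [pow_zero, Matrix.one_apply]; split_ifs <;> norm_num
  | succ t ih =>
    rw [pow_succ, Matrix.mul_apply]
    exact sum_nonneg fun z _ => mul_nonneg (ih z) (hP z y)

lemma pow_row_sum {Ω : Type*} [Fintype Ω] [DecidableEq Ω] {P : Matrix Ω Ω ℝ} {r : ℝ}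
    (hP : ∀ x, ∑ y, P x y = r) (t : ℕ) (x : Ω) : ∑ y, (P ^ t) x y = r ^ t := by
  induction t with
  | zero => simp [Matrix.one_apply]
  | succ t ih =>
    simp only [pow_succ, Matrix.mul_apply]
    rw [sum_comm]
    simp only [← mul_sum, hP, ← sum_mul, ih]

/-- If one step contracts a metric `Φ` comparable to the Hamming metric, then the flip dynamics
admits an `O(n)`-amortized convergent coupling. -/
theorem exists_amortized_coupling_of_contraction {L : V → Finset (Fin q)} {c : ℝ}
    (hc : 0 < c) (hc1 : c < 1) (Φ : (V → Fin q) → (V → Fin q) → ℝ)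
    (hΦ : ∀ σ τ, 1 / 2 ≤ Φ σ τ ∧ Φ σ τ ≤ 1)
    (hcontr : ∀ [Nonempty V] (l : ℝ) (f : (V → Fin q) → ℝ), 0 < l → AdjLipschitz L Φ l f →
      AdjLipschitz L Φ (l * (1 - c / Fintype.card V)) (flipOp G L f)) :
    ∃ coup : (V → Fin q) → (V → Fin q) → ℕ → (V → Fin q) → (V → Fin q) → ℝ,
      IsCoupling (flipMatrix G univ L L flipParam) coup ∧
        ∀ σ τ : V → Fin q, IsProperListColoring G L σ → IsProperListColoring G L τ →
          (∑' t : ℕ, ENNReal.ofReal (∑ a : V → Fin q, ∑ b : V → Fin q,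
              coup σ τ t a b * (hammCol a b : ℝ)))
            ≤ ENNReal.ofReal (2 / c * (Fintype.card V : ℝ) * (hammCol σ τ : ℝ)) := by
  set P := flipMatrix G univ L L flipParam with hPdef
  set n : ℝ := (Fintype.card V : ℝ) with hn
  set r : ℝ := n⁻¹ * ∑ v, ((L v).card : ℝ)⁻¹ * (L v).card
  have hP0 : ∀ t x y, 0 ≤ (P ^ t) x y := fun t x y => pow_nonneg_entries (flipMatrix_nonneg L) t x y
  have hPr : ∀ t x, ∑ y, (P ^ t) x y = r ^ t := pow_row_sum fun x => flipMatrix_sum L x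
  have hex : ∀ (σ τ : V → Fin q) (t : ℕ), ∃ π : (V → Fin q) → (V → Fin q) → ℝ,
      (∀ a b, 0 ≤ π a b) ∧ (∀ a, ∑ b, π a b = (P ^ t) σ a) ∧ (∀ b, ∑ a, π a b = (P ^ t) τ b) ∧
      (IsProperListColoring G L σ → IsProperListColoring G L τ →
        ∑ a, ∑ b, π a b * (hammCol a b : ℝ) ≤ 2 * (1 - c / n) ^ t * hammCol σ τ) := by
    intro σ τ t
    by_cases hcase : Nonempty V ∧ IsProperListColoring G L σ ∧ IsProperListColoring G L τ
    · obtain ⟨hV, hσ, hτ⟩ := hcase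
      have hn1 : 1 ≤ n := by
        have : 1 ≤ Fintype.card V := Fintype.card_pos
        rw [hn]; exact_mod_cast this
      have hρ : 0 < 1 - c / n := by
        have : c / n ≤ c := div_le_self hc.le hn1
        linarith
      have hone : ∀ x, IsProperListColoring G L x → IsProbDist fun a => (P ^ t) x a := by
        intro x hx
        refine ⟨fun a => hP0 t x a, ?_⟩
        have := flipMatrix_pow_sum_mul hx (fun _ => (1 : ℝ)) t
        simp only [mul_one] at this
        rw [hPdef, this]
        have hfix : flipOp G L (fun _ => (1 : ℝ)) = fun _ => 1 := by
          ext ρ; simp [flipOp]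
        rw [Function.iterate_fixed hfix]
      obtain ⟨π, h1, h2, h3, h4⟩ := exists_coupling_of_lipschitz_le
        (fun a b : V → Fin q => (hammCol a b : ℝ)) (fun x => by simp [hammCol_self])
        (fun x y z => by exact_mod_cast hammCol_triangle x y z) _ _ (hone σ hσ) (hone τ hτ)
        (2 * (1 - c / n) ^ t * hammCol σ τ) (by
          intro f hf
          rw [flipMatrix_pow_sum_mul hσ, flipMatrix_pow_sum_mul hτ]
          have hlip : ∀ s : ℕ, AdjLipschitz L Φ (2 * (1 - c / n) ^ s) ((flipOp G L)^[s] f) := by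
            intro s
            induction s with
            | zero =>
              rintro x y ⟨-, -, v, hv, hu⟩
              have h := hf x y
              have : hammCol x y = 1 := by
                unfold hammCol
                rw [card_eq_one]
                refine ⟨v, ?_⟩
                ext u
                simp only [mem_filter, mem_univ, true_and, mem_singleton]
                exact ⟨fun h => by_contra fun h' => h (hu u h'), by rintro rfl; exact hv⟩
              rw [this] at h
              have := (hΦ x y).1
              simp only [Function.iterate_zero, id, pow_zero]
              push_cast at h
              linarith
            | succ s ih =>
              rw [Function.iterate_succ_apply', pow_succ, ← mul_assoc]
              exact hcontr _ _ (by positivity) ih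
          refine sub_le_hammCol_of_adjacent (fun x y hxy => (hlip t x y hxy).trans ?_) hσ.1 hτ.1
          exact mul_le_of_le_one_right (by positivity) (hΦ x y).2)
      exact ⟨π, h1, h2, h3, fun _ _ => h4⟩
    · refine ⟨fun a b => (P ^ t) σ a * (P ^ t) τ b / r ^ t, fun a b => div_nonneg
        (mul_nonneg (hP0 _ _ _) (hP0 _ _ _))
        ((sum_nonneg fun y _ => hP0 t σ y).trans_eq (hPr t σ)), ?_, ?_, ?_⟩
      · intro a
        rw [← sum_div, ← mul_sum, hPr]
        by_cases h : r ^ t = 0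
        · have : (P ^ t) σ a = 0 :=
            (sum_eq_zero_iff_of_nonneg fun y _ => hP0 t σ y).1 ((hPr t σ).trans h) a (mem_univ a)
          simp [this]
        · field_simp
      · intro b
        rw [← sum_div, ← sum_mul, hPr]
        by_cases h : r ^ t = 0
        · have : (P ^ t) τ b = 0 :=
            (sum_eq_zero_iff_of_nonneg fun y _ => hP0 t τ y).1 ((hPr t τ).trans h) b (mem_univ b)
          simp [this]
        · field_simp
      · intro hσ hτ
        have hV : IsEmpty V := by
          rw [← not_nonempty_iff]; exact fun h => hcase ⟨h, hσ, hτ⟩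
        have : ∀ a b : V → Fin q, hammCol a b = 0 := fun a b => by simp [hammCol]
        simp [this]
  choose coup h1 h2 h3 h4 using hex
  refine ⟨coup, ⟨fun x y t a b => h1 x y t a b, fun x y t a => h2 x y t a,
    fun x y t b => h3 x y t b⟩, fun σ τ hσ hτ => ?_⟩
  rcases isEmpty_or_nonempty V with hV | hV
  · have : ∀ a b : V → Fin q, hammCol a b = 0 := fun a b => by simp [hammCol]
    simp [this]
  have hn1 : 1 ≤ n := by
    have : 1 ≤ Fintype.card V := Fintype.card_pos
    rw [hn]; exact_mod_cast this
  have hρ : 0 < 1 - c / n := by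
    have : c / n ≤ c := div_le_self hc.le hn1
    linarith
  have hρ1 : 1 - c / n < 1 := by
    have : 0 < c / n := by positivity
    linarith
  have hsum := hasSum_geometric_of_lt_one hρ.le hρ1
  have hsum2 := (hsum.mul_left 2).mul_right (hammCol σ τ : ℝ)
  calc _ ≤ ∑' t : ℕ, ENNReal.ofReal (2 * (1 - c / n) ^ t * hammCol σ τ) :=
        ENNReal.tsum_le_tsum fun t => ENNReal.ofReal_le_ofReal (h4 σ τ t hσ hτ)
    _ = ENNReal.ofReal (∑' t : ℕ, 2 * (1 - c / n) ^ t * hammCol σ τ) :=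
        (ENNReal.ofReal_tsum_of_nonneg (fun t => by positivity) hsum2.summable).symm
    _ ≤ _ := by
        rw [hsum2.tsum_eq]
        refine ENNReal.ofReal_le_ofReal (le_of_eq ?_)
        have : n ≠ 0 := by linarith
        rw [sub_sub_cancel]
        field_simp

end Reduction

section Numeric

lemma affine_nonpos_of_endpoints {c d x : ℝ} (hx : 0 ≤ x ∧ x ≤ 1) (h0 : c ≤ 0) (h1 : c + d ≤ 0) :
    c + d * x ≤ 0 := by
  nlinarith [mul_nonneg hx.1 (neg_nonneg.2 h1), mul_nonneg (sub_nonneg.2 hx.2) (neg_nonneg.2 h0)]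

lemma affine_nonpos_of_vertices {c d₁ d₂ d₃ x y z : ℝ} (hx : 0 ≤ x ∧ x ≤ 1) (hy : 0 ≤ y ∧ y ≤ 1)
    (hz : 0 ≤ z ∧ z ≤ 1) (h₀ : c ≤ 0) (h₁ : c + d₁ ≤ 0) (h₂ : c + d₂ ≤ 0) (h₃ : c + d₃ ≤ 0)
    (h₁₂ : c + d₁ + d₂ ≤ 0) (h₁₃ : c + d₁ + d₃ ≤ 0) (h₂₃ : c + d₂ + d₃ ≤ 0)
    (h₁₂₃ : c + d₁ + d₂ + d₃ ≤ 0) : c + d₁ * x + d₂ * y + d₃ * z ≤ 0 := by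
  refine affine_nonpos_of_endpoints hz (affine_nonpos_of_endpoints hy
    (affine_nonpos_of_endpoints hx h₀ h₁) ?_) ?_
  · have := affine_nonpos_of_endpoints hx h₂ (by linarith : c + d₂ + d₁ ≤ 0)
    linarith
  · have := affine_nonpos_of_endpoints hy
      (affine_nonpos_of_endpoints hx h₃ (by linarith : c + d₃ + d₁ ≤ 0)) (by
        have := affine_nonpos_of_endpoints hx h₂₃ (by linarith : c + d₂ + d₃ + d₁ ≤ 0)
        linarith : c + d₃ + d₁ * x + d₂ ≤ 0)
    linarith

/-- The contribution of a single component, without coupling to the large component. -/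
lemma single_component_bound {a : ℕ} {W s l θ : ℝ} (hW : 0 ≤ W ∧ W ≤ 1) (hs : s ≤ a - l)
    (hl : 0 ≤ l ∧ l ≤ 1) (hθ : θ = 2 / 3 ∨ θ = 5 / 6 ∧ a = 1) :
    flipParam a * W * s - θ * (1 / 2 - l) ≤ 2 / 3 ∧
    (θ = 5 / 6 → flipParam a * W * s - θ * (1 / 2 - l) ≤ 7 / 12) ∧
    (W = 0 ∨ a = 0 ∨ 7 ≤ a → flipParam a * W * s - θ * (1 / 2 - l) ≤ θ / 2) := by
  have h1 : flipParam a * W * s ≤ flipParam a * W * (a - l) :=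
    mul_le_mul_of_nonneg_left hs (mul_nonneg (flipParam_nonneg a) hW.1)
  have hθ0 : 0 ≤ θ := by rcases hθ with h | h <;> [rw [h]; rw [h.1]] <;> norm_num
  have h0 : W = 0 ∨ a = 0 ∨ 7 ≤ a → flipParam a * W = 0 := by
    rintro (h | h | h)
    · rw [h, mul_zero]
    · rw [h]; norm_num [flipParam]
    · rw [flipParam_of_seven_le h, zero_mul]
  have h2 : flipParam a * W * (a - l) ≤ flipParam a * (a - l) ∨ a = 0 := by
    rcases Nat.eq_zero_or_pos a with h | h
    · exact .inr h
    · left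
      have : (1 : ℝ) ≤ a := by exact_mod_cast h
      have h3 : 0 ≤ flipParam a * (a - l) := mul_nonneg (flipParam_nonneg a) (by linarith [hl.2])
      nlinarith [hW.2]
  refine ⟨?_, fun h => ?_, fun h => ?_⟩
  · rcases hθ with rfl | ⟨rfl, rfl⟩
    · rcases h2 with h2 | rfl
      · rcases lt_or_ge a 7 with h | h
        · interval_cases a <;> norm_num [flipParam] at h1 h2 ⊢ <;> linarith [hl.1, hl.2]
        · rw [flipParam_of_seven_le h]; linarith [hl.2]
      · norm_num [flipParam]; linarith [hl.2]
    · norm_num [flipParam] at h1 h2 ⊢; linarith [hl.1, hl.2]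
  · rcases hθ with h' | ⟨-, rfl⟩
    · norm_num [h'] at h
    · subst h; norm_num [flipParam] at h1 h2 ⊢; linarith [hl.1, hl.2]
  · rw [h0 h, zero_mul]; nlinarith [hl.2]

lemma flipParam_mul_pred_le (m : ℕ) : flipParam (1 + m) * m ≤ 1 / 3 ∧
    (4 ≤ m → flipParam (1 + m) * m ≤ 2 / 9) := by
  rcases lt_or_ge m 6 with h | h
  · interval_cases m <;> norm_num [flipParam]
  · rw [flipParam_of_seven_le (by omega)]; norm_num

lemma flipParam_mul_le (m : ℕ) : flipParam m * m ≤ 1 := by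
  rcases lt_or_ge m 7 with h | h
  · interval_cases m <;> norm_num [flipParam]
  · rw [flipParam_of_seven_le (by omega)]; norm_num

/-- The data of one side of the comparison of the flips affected by a single disagreement: a large
component with excess weight `xA` and payoff `α`, which splits into pieces of size `a i`, average
weight `W i` and payoff `s i`. -/
structure FlipSide {ι : Type*} (I : Finset ι) (w : ℝ) (avail F : Prop) (a : ι → ℕ) (W : ι → ℝ)
    (xA α : ℝ) (s : ι → ℝ) : Prop where
  weight_mem : ∀ i ∈ I, 0 ≤ W i ∧ W i ≤ 1
  large_le : α ≤ (∑ i ∈ I, a i : ℕ)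
  small_le : ∀ i ∈ I, s i ≤ a i
  add_le : ∀ i ∈ I, α + s i ≤ (∑ i ∈ I, a i : ℕ) - a i
  weight_large : F → avail ∧ xA = flipParam (1 + ∑ i ∈ I, a i) / (1 + ∑ i ∈ I, a i : ℕ) *
    (w + ∑ i ∈ I, a i * W i)
  weight_large' : ¬ F → xA = 0 ∧ (avail → ∃ i ∈ I, W i = 0 ∧ 1 ≤ a i)

section
variable {ι : Type*} {I : Finset ι} {w xA α : ℝ} {avail F : Prop} {a : ι → ℕ} {W s : ι → ℝ}

lemma FlipSide.weight_large_mem (h : FlipSide I w avail F a W xA α s) (hw : 0 ≤ w ∧ w ≤ 1) :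
    0 ≤ xA ∧ xA ≤ flipParam (1 + ∑ i ∈ I, a i) := by
  by_cases hF : F
  · rw [(h.weight_large hF).2]
    have hA : (0 : ℝ) < (1 + ∑ i ∈ I, a i : ℕ) := by positivity
    have h1 : 0 ≤ ∑ i ∈ I, a i * W i :=
      sum_nonneg fun i hi => mul_nonneg (Nat.cast_nonneg _) (h.weight_mem i hi).1
    have h2 : ∑ i ∈ I, a i * W i ≤ ∑ i ∈ I, (a i : ℝ) :=
      sum_le_sum fun i hi => mul_le_of_le_one_right (Nat.cast_nonneg _) (h.weight_mem i hi).2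
    have hp := flipParam_nonneg (1 + ∑ i ∈ I, a i)
    refine ⟨mul_nonneg (div_nonneg hp hA.le) (by linarith [hw.1]), ?_⟩
    rw [div_mul_eq_mul_div, div_le_iff₀ hA]
    refine mul_le_mul_of_nonneg_left ?_ hp
    push_cast; linarith [hw.2]
  · rw [(h.weight_large' hF).1]
    exact ⟨le_rfl, flipParam_nonneg _⟩

lemma FlipSide.large_mul_le (h : FlipSide I w avail F a W xA α s) (hw : 0 ≤ w ∧ w ≤ 1) :
    xA * α ≤ flipParam (1 + ∑ i ∈ I, a i) * (∑ i ∈ I, a i : ℕ) := by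
  have h1 := h.weight_large_mem hw
  calc xA * α ≤ xA * (∑ i ∈ I, a i : ℕ) := mul_le_mul_of_nonneg_left h.large_le h1.1
    _ ≤ _ := mul_le_mul_of_nonneg_right h1.2 (Nat.cast_nonneg _)

set_option maxHeartbeats 4000000 in
lemma two_pieces_bound {a₁ a₂ : ℕ} {w W₁ W₂ α s₁ s₂ l₁ l₂ θ₁ θ₂ : ℝ} (hw : 0 ≤ w ∧ w ≤ 1)
    (hW₁ : 0 ≤ W₁ ∧ W₁ ≤ 1) (hW₂ : 0 ≤ W₂ ∧ W₂ ≤ 1) (ha₁ : 1 ≤ a₁) (ha₂ : 1 ≤ a₂)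
    (ha : a₁ + a₂ ≤ 5) (hα : α ≤ a₁ + a₂) (hs₁ : s₁ ≤ a₁ - l₁) (hs₂ : s₂ ≤ a₂ - l₂)
    (hαs₁ : α + s₁ ≤ a₂) (hαs₂ : α + s₂ ≤ a₁) (hl₁ : 0 ≤ l₁ ∧ l₁ ≤ 1) (hl₂ : 0 ≤ l₂ ∧ l₂ ≤ 1)
    (hθ₁ : θ₁ = 2 / 3 ∨ θ₁ = 5 / 6 ∧ a₁ = 1) (hθ₂ : θ₂ = 2 / 3 ∨ θ₂ = 5 / 6 ∧ a₂ = 1) :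
    flipParam (1 + (a₁ + a₂)) / (1 + (a₁ + a₂)) * (w + (a₁ * W₁ + a₂ * W₂)) * α +
      flipParam a₁ * W₁ * s₁ + flipParam a₂ * W₂ * s₂ + w / 2 ≤
    11 / 6 + θ₁ * (1 / 2 - l₁) + θ₂ * (1 / 2 - l₂) -
      (if θ₁ = 5 / 6 ∨ θ₂ = 5 / 6 then 1 / 100 else 0) := by
  obtain ⟨l1, l2⟩ := hl₁
  obtain ⟨l3, l4⟩ := hl₂
  rw [← sub_nonpos]
  have key := affine_nonpos_of_vertices (c := -(11 / 6 + θ₁ * (1 / 2 - l₁) + θ₂ * (1 / 2 - l₂) -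
      (if θ₁ = 5 / 6 ∨ θ₂ = 5 / 6 then 1 / 100 else 0)))
    (d₁ := flipParam (1 + (a₁ + a₂)) / (1 + (a₁ + a₂)) * α + 1 / 2)
    (d₂ := flipParam (1 + (a₁ + a₂)) / (1 + (a₁ + a₂)) * a₁ * α + flipParam a₁ * s₁)
    (d₃ := flipParam (1 + (a₁ + a₂)) / (1 + (a₁ + a₂)) * a₂ * α + flipParam a₂ * s₂) hw hW₁ hW₂
  refine le_trans (le_of_eq (by ring)) (key ?_ ?_ ?_ ?_ ?_ ?_ ?_ ?_)
  all_goals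
    clear key hw hW₁ hW₂
    have hb₁ : a₁ ≤ 4 := by omega
    have hb₂ : a₂ ≤ 4 := by omega
    rcases hθ₁ with rfl | ⟨rfl, rfl⟩ <;> rcases hθ₂ with rfl | ⟨rfl, rfl⟩ <;>
    (try interval_cases a₁) <;> (try interval_cases a₂) <;> (try omega) <;>
    norm_num [flipParam] at hα hs₁ hs₂ hαs₁ hαs₂ ⊢ <;> linarith

end
end Numeric

section NumericSide
variable {ι : Type*} {I : Finset ι} {w xA α : ℝ} {avail F : Prop} {a : ι → ℕ} {W s : ι → ℝ}

lemma sum_le_card_mul_sub {I : Finset ι} {e : ι → ℝ} {M r : ℝ} (he : ∀ i ∈ I, e i ≤ M)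
    (hr : ∃ i ∈ I, e i ≤ M - r) : ∑ i ∈ I, e i ≤ #I * M - r := by
  obtain ⟨i, hi, h⟩ := hr
  have h1 : ∑ j ∈ I.erase i, e j ≤ #(I.erase i) • M :=
    sum_le_card_nsmul _ _ _ fun j hj => he j (mem_of_mem_erase hj)
  rw [← add_sum_erase I e hi]
  rw [card_erase_of_mem hi, nsmul_eq_mul, Nat.cast_pred (card_pos.2 ⟨i, hi⟩)] at h1
  linarith

lemma sum_le_card_mul {I : Finset ι} {e : ι → ℝ} {M : ℝ} (he : ∀ i ∈ I, e i ≤ M) :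
    ∑ i ∈ I, e i ≤ #I * M := by
  simpa using sum_le_card_nsmul _ _ _ he

lemma FlipSide.ite_avail_le (hw : 0 ≤ w ∧ w ≤ 1) :
    (if avail then w / 2 else 0) ≤ 1 / 2 := by
  split <;> linarith [hw.2]

lemma FlipSide.total_le_of_three (h : FlipSide I w avail F a W xA α s) (hw : 0 ≤ w ∧ w ≤ 1)
    {lam θ : ι → ℝ} (hl : ∀ i ∈ I, 0 ≤ lam i ∧ lam i ≤ 1) (hs : ∀ i ∈ I, s i ≤ a i - lam i)
    (hθ : ∀ i ∈ I, θ i = 2 / 3 ∨ θ i = 5 / 6 ∧ a i = 1) (hI : 3 ≤ #I) :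
    xA * α + ∑ i ∈ I, (flipParam (a i) * W i * s i - θ i * (1 / 2 - lam i)) +
      (if avail then w / 2 else 0) ≤
    11 / 12 * #I - (if ∃ i ∈ I, θ i = 5 / 6 ∨ 7 ≤ a i then (#I : ℝ) / 200 else 0) := by
  have hx := h.weight_large_mem hw
  have hlarge := h.large_mul_le hw
  have hp := flipParam_mul_pred_le (∑ i ∈ I, a i)
  have hav := FlipSide.ite_avail_le (avail := avail) hw
  have he := fun i hi => single_component_bound (h.weight_mem i hi) (hs i hi) (hl i hi) (hθ i hi)
  have hsl : (if ∃ i ∈ I, θ i = 5 / 6 ∨ 7 ≤ a i then (#I : ℝ) / 200 else 0) ≤ (#I : ℝ) / 200 := by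
    split
    · exact le_rfl
    · positivity
  have hI' : (3 : ℝ) ≤ #I := by exact_mod_cast hI
  rcases hI.lt_or_eq with hI4 | hI3
  · have hI' : (4 : ℝ) ≤ #I := by exact_mod_cast hI4
    have := sum_le_card_mul fun i hi => (he i hi).1
    linarith [hp.1]
  have hI3' : (#I : ℝ) = 3 := by exact_mod_cast hI3.symm
  rw [hI3'] at hsl ⊢
  by_cases h0 : ∃ i ∈ I, a i = 0 ∨ 7 ≤ a i
  · obtain ⟨i, hi, h0⟩ := h0
    have h1 := (he i hi).2.2 (.inr h0)
    have h2 : θ i ≤ 5 / 6 := by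
      obtain h | h := hθ i hi
      · norm_num [h]
      · norm_num [h.1]
    have := sum_le_card_mul_sub (r := 1 / 4) (fun i hi => (he i hi).1) ⟨i, hi, by linarith⟩
    rw [hI3'] at this
    linarith [hp.1]
  push Not at h0
  have h1 : ∀ i ∈ I, 1 ≤ a i := fun i hi => Nat.one_le_iff_ne_zero.2 (h0 i hi).1
  have hm : 3 ≤ ∑ i ∈ I, a i := by
    have := card_nsmul_le_sum I a 1 h1
    simpa [← hI3] using this
  rcases hm.lt_or_eq with hm | hm
  · have := sum_le_card_mul fun i hi => (he i hi).1
    rw [hI3'] at this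
    linarith [hp.2 hm]
  have ha1 : ∀ i ∈ I, a i = 1 := by
    intro i hi
    have h2 : #(I.erase i) • 1 ≤ ∑ j ∈ I.erase i, a j :=
      card_nsmul_le_sum (I.erase i) a 1 fun j hj => h1 j (mem_of_mem_erase hj)
    rw [card_erase_of_mem hi, ← hI3] at h2
    have h3 := add_sum_erase I a hi
    have := h1 i hi
    have h4 : 2 ≤ ∑ j ∈ I.erase i, a j := by simpa using h2
    omega
  rw [← hm] at hlarge hx
  norm_num [flipParam] at hlarge hx
  by_cases hsp : ∃ i ∈ I, θ i = 5 / 6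
  · obtain ⟨i, hi, h2⟩ := hsp
    have := sum_le_card_mul_sub (r := 1 / 12) (fun i hi => (he i hi).1)
      ⟨i, hi, by linarith [(he i hi).2.1 h2]⟩
    rw [hI3'] at this
    linarith
  have hns : ¬ ∃ i ∈ I, θ i = 5 / 6 ∨ 7 ≤ a i := by
    rintro ⟨i, hi, h2 | h2⟩
    · exact hsp ⟨i, hi, h2⟩
    · have := ha1 i hi; omega
  rw [if_neg hns]
  obtain ⟨i, hi⟩ : I.Nonempty := card_pos.1 (by omega)
  have hθi : θ i = 2 / 3 := (hθ i hi).resolve_right fun h2 => hsp ⟨i, hi, h2.1⟩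
  have hli := hl i hi
  have hsi := hs i hi
  have hWi := h.weight_mem i hi
  have hadd := h.add_le i hi
  rw [ha1 i hi] at hsi hadd
  rw [← hm] at hadd
  have hflip : flipParam 1 = 1 := rfl
  rcases le_total (W i) (9 / 10) with hW | hW
  · have : flipParam (a i) * W i * s i - θ i * (1 / 2 - lam i) ≤ 2 / 3 - 1 / 10 := by
      rw [ha1 i hi, hθi, hflip]
      push_cast at hsi
      nlinarith [mul_le_mul_of_nonneg_left hsi hWi.1, mul_nonneg (sub_nonneg.2 hW)
        (sub_nonneg.2 hli.2)]
    have := sum_le_card_mul_sub (r := 1 / 10) (fun i hi => (he i hi).1) ⟨i, hi, this⟩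
    rw [hI3'] at this
    linarith
  · have h3 : xA * α + (flipParam (a i) * W i * s i - θ i * (1 / 2 - lam i)) ≤ 23 / 30 := by
      rw [ha1 i hi, hθi, hflip]
      push_cast at hsi hadd
      have h4 := mul_le_mul_of_nonneg_left hadd hx.1
      have h5 := mul_le_mul_of_nonneg_left hsi (by linarith : 0 ≤ W i - xA)
      nlinarith [mul_nonneg (by linarith : 0 ≤ 1 - (W i - xA)) (sub_nonneg.2 hli.2)]
    have h4 := sum_le_card_mul (I := I.erase i) fun j hj => (he j (mem_of_mem_erase hj)).1
    rw [card_erase_of_mem hi, ← hI3] at h4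
    rw [← add_sum_erase I _ hi]
    norm_num at h4 ⊢
    linarith

lemma FlipSide.total_le_of_two (h : FlipSide I w avail F a W xA α s) (hw : 0 ≤ w ∧ w ≤ 1)
    {lam θ : ι → ℝ} (hl : ∀ i ∈ I, 0 ≤ lam i ∧ lam i ≤ 1) (hs : ∀ i ∈ I, s i ≤ a i - lam i)
    (hθ : ∀ i ∈ I, θ i = 2 / 3 ∨ θ i = 5 / 6 ∧ a i = 1) (hI : #I = 2) :
    xA * α + ∑ i ∈ I, (flipParam (a i) * W i * s i - θ i * (1 / 2 - lam i)) +
      (if avail then w / 2 else 0) ≤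
    11 / 12 * #I - (if ∃ i ∈ I, θ i = 5 / 6 ∨ 7 ≤ a i then (#I : ℝ) / 200 else 0) := by
  have hlarge := h.large_mul_le hw
  have hp := flipParam_mul_pred_le (∑ i ∈ I, a i)
  have hav := FlipSide.ite_avail_le (avail := avail) hw
  have he := fun i hi => single_component_bound (h.weight_mem i hi) (hs i hi) (hl i hi) (hθ i hi)
  have hθle : ∀ i ∈ I, θ i ≤ 5 / 6 := fun i hi => by
    obtain h | h := hθ i hi
    · norm_num [h]
    · norm_num [h.1]
  have hI2 : (#I : ℝ) = 2 := by exact_mod_cast hI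
  have hsl : (if ∃ i ∈ I, θ i = 5 / 6 ∨ 7 ≤ a i then (#I : ℝ) / 200 else 0) ≤ 1 / 100 := by
    rw [hI2]; split <;> norm_num
  rw [hI2] at hsl ⊢
  have small : ∀ i ∈ I, W i = 0 ∨ a i = 0 ∨ 7 ≤ a i → xA * α ≤ 0 →
      xA * α + ∑ i ∈ I, (flipParam (a i) * W i * s i - θ i * (1 / 2 - lam i)) +
      (if avail then w / 2 else 0) ≤ 11 / 12 * 2 - 1 / 100 := by
    intro i hi h1 h2
    have := sum_le_card_mul_sub (r := 1 / 4) (fun i hi => (he i hi).1)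
      ⟨i, hi, by linarith [(he i hi).2.2 h1, hθle i hi]⟩
    rw [hI2] at this
    linarith
  by_cases h7 : ∃ i ∈ I, 7 ≤ a i
  · obtain ⟨i, hi, h7⟩ := h7
    have h1 : a i ≤ ∑ i ∈ I, a i := single_le_sum (fun _ _ => Nat.zero_le _) hi
    rw [flipParam_of_seven_le (by omega : 7 ≤ 1 + ∑ i ∈ I, a i), zero_mul] at hlarge
    linarith [small i hi (.inr (.inr h7)) hlarge]
  have hspecial : (∃ i ∈ I, θ i = 5 / 6 ∨ 7 ≤ a i) → ∃ i ∈ I, θ i = 5 / 6 := by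
    rintro ⟨i, hi, h1 | h1⟩
    · exact ⟨i, hi, h1⟩
    · exact absurd ⟨i, hi, h1⟩ h7
  by_cases hF : F
  swap
  · obtain ⟨hx0, h1⟩ := h.weight_large' hF
    by_cases ha : avail
    · obtain ⟨i, hi, h2, -⟩ := h1 ha
      linarith [small i hi (.inl h2) (by rw [hx0, zero_mul])]
    · have := sum_le_card_mul fun i hi => (he i hi).1
      rw [hI2] at this
      rw [if_neg ha, hx0, zero_mul]
      linarith
  by_cases h0 : ∃ i ∈ I, a i = 0
  · obtain ⟨i, hi, h0⟩ := h0
    have hθi : θ i = 2 / 3 := (hθ i hi).resolve_right fun h2 => by omega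
    have hei := (he i hi).2.2 (.inr (.inl h0))
    by_cases hsp : ∃ i ∈ I, θ i = 5 / 6 ∨ 7 ≤ a i <;> [rw [if_pos hsp]; rw [if_neg hsp]]
    · obtain ⟨j, hj, hθj⟩ := hspecial hsp
      have hij : i ≠ j := by rintro rfl; rw [hθi] at hθj; norm_num at hθj
      have hI' : I = {i, j} := by
        symm
        exact eq_of_subset_of_card_le (by simp [insert_subset_iff, hi, hj])
          (by rw [hI, card_pair hij])
      have hej := (he j hj).2.1 hθj
      rw [hI', sum_pair hij] at *
      linarith [hp.1]
    · have := sum_le_card_mul_sub (r := 1 / 3) (fun i hi => (he i hi).1) ⟨i, hi, by linarith⟩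
      rw [hI2] at this
      linarith [hp.1]
  by_cases hbig : 6 ≤ ∑ i ∈ I, a i
  · rw [flipParam_of_seven_le (by omega : 7 ≤ 1 + ∑ i ∈ I, a i), zero_mul] at hlarge
    by_cases hsp : ∃ i ∈ I, θ i = 5 / 6 ∨ 7 ≤ a i <;> [rw [if_pos hsp]; rw [if_neg hsp]]
    · obtain ⟨j, hj, hθj⟩ := hspecial hsp
      have := sum_le_card_mul_sub (r := 1 / 12) (fun i hi => (he i hi).1)
        ⟨j, hj, by linarith [(he j hj).2.1 hθj]⟩
      rw [hI2] at this
      linarith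
    · have := sum_le_card_mul fun i hi => (he i hi).1
      rw [hI2] at this
      linarith
  obtain ⟨hav', hxA⟩ := h.weight_large hF
  obtain ⟨i, j, hij, rfl⟩ := card_eq_two.1 hI
  have hi : i ∈ ({i, j} : Finset ι) := by simp
  have hj : j ∈ ({i, j} : Finset ι) := by simp
  have hli := h.large_le
  have hai := h.add_le i hi
  have haj := h.add_le j hj
  push Not at h0
  rw [sum_pair hij] at *
  push_cast at *
  have := two_pieces_bound hw (h.weight_mem i hi) (h.weight_mem j hj)
    (Nat.one_le_iff_ne_zero.2 (h0 i hi)) (Nat.one_le_iff_ne_zero.2 (h0 j hj)) (by omega)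
    hli (hs i hi) (hs j hj) (by linarith) (by linarith) (hl i hi) (hl j hj) (hθ i hi) (hθ j hj)
  rw [sum_pair hij] at hxA
  rw [← hxA] at this
  rw [if_pos hav']
  have h8 : (if ∃ k ∈ ({i, j} : Finset ι), θ k = 5 / 6 ∨ 7 ≤ a k then (2 : ℝ) / 200 else 0) ≤
      if θ i = 5 / 6 ∨ θ j = 5 / 6 then 1 / 100 else 0 := by
    by_cases hsp : ∃ k ∈ ({i, j} : Finset ι), θ k = 5 / 6 ∨ 7 ≤ a k
    · rw [if_pos hsp]
      obtain ⟨k, hk, hθk⟩ := hspecial hsp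
      rw [mem_insert, mem_singleton] at hk
      rw [if_pos (by rcases hk with rfl | rfl <;> tauto)]
      norm_num
    · rw [if_neg hsp]; split <;> norm_num
  linarith

lemma FlipSide.total_le (h : FlipSide I w avail F a W xA α s) (hw : 0 ≤ w ∧ w ≤ 1)
    {lam θ : ι → ℝ} (hl : ∀ i ∈ I, 0 ≤ lam i ∧ lam i ≤ 1) (hs : ∀ i ∈ I, s i ≤ a i - lam i)
    (hθ : ∀ i ∈ I, θ i = 2 / 3 ∨ θ i = 5 / 6 ∧ a i = 1) (hI : 2 ≤ #I) :
    xA * α + ∑ i ∈ I, (flipParam (a i) * W i * s i - θ i * (1 / 2 - lam i)) +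
      (if avail then w / 2 else 0) ≤
    11 / 12 * #I - (if ∃ i ∈ I, θ i = 5 / 6 ∨ 7 ≤ a i then (#I : ℝ) / 200 else 0) := by
  rcases hI.lt_or_eq with hI | hI
  · exact h.total_le_of_three hw hl hs hθ hI
  · exact h.total_le_of_two hw hl hs hθ hI.symm

end NumericSide

section NumericSingle

/-- A `FlipSide` with a single piece. -/
structure SinglePiece (w : ℝ) (avail F : Prop) (a : ℕ) (W xA α s : ℝ) : Prop where
  weight_mem : 0 ≤ W ∧ W ≤ 1
  large_le : α ≤ a
  small_le : s ≤ a
  add_le : α + s ≤ 0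
  weight_large : F → avail ∧ xA = flipParam (1 + a) / (1 + a) * (w + a * W)
  weight_large' : ¬ F → xA = 0 ∧ (avail → W = 0)

lemma FlipSide.singlePiece {ι : Type*} {i : ι} {w xA α : ℝ} {avail F : Prop} {a : ι → ℕ}
    {W s : ι → ℝ} (h : FlipSide {i} w avail F a W xA α s) :
    SinglePiece w avail F (a i) (W i) xA α (s i) := by
  obtain ⟨h1, h2, h3, h4, h5, h6⟩ := h
  simp only [mem_singleton, forall_eq, sum_singleton, exists_eq_left] at *
  exact ⟨h1, h2, h3, by linarith, fun hF => ⟨(h5 hF).1, by rw [(h5 hF).2]; push_cast; rfl⟩,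
    fun hF => ⟨(h6 hF).1, fun ha => ((h6 hF).2 ha).1⟩⟩

variable {w W W' xA xB α β s t : ℝ} {avail F F' : Prop} {a b : ℕ}

set_option maxHeartbeats 1000000 in
lemma SinglePiece.one_sided (h : SinglePiece w avail F a W xA α s) (hw : 0 ≤ w ∧ w ≤ 1)
    (ha : 2 ≤ a) {l : ℝ} (hl : 0 ≤ l ∧ l ≤ 1) (hs : s ≤ a - l) :
    xA * α + flipParam a * W * s + (if avail then w / 2 else 0) ≤
      11 / 12 + 17 / 30 * (1 / 2 - l) - (if 7 ≤ a then 1 / 8 else 0) := by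
  obtain ⟨hW, hα, hs', hadd, hF, hF'⟩ := h
  rcases lt_or_ge a 7 with ha7 | ha7
  swap
  · have : xA * α = 0 := by
      by_cases hf : F
      · rw [(hF hf).2, flipParam_of_seven_le (by omega)]; ring
      · rw [(hF' hf).1, zero_mul]
    rw [this, flipParam_of_seven_le ha7, if_pos ha7]
    split <;> linarith [hl.2, hw.2]
  rw [if_neg (by omega : ¬ 7 ≤ a)]
  by_cases hf : F
  · obtain ⟨hav, hx⟩ := hF hf
    rw [if_pos hav, hx, ← sub_nonpos]
    refine le_trans (le_of_eq ?_) (affine_nonpos_of_vertices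
      (c := -(11 / 12 + 17 / 30 * (1 / 2 - l)))
      (d₁ := flipParam (1 + a) / (1 + a) * α + 1 / 2)
      (d₂ := flipParam (1 + a) / (1 + a) * a * α + flipParam a * s) (d₃ := 0) hw hW hw
      ?_ ?_ ?_ ?_ ?_ ?_ ?_ ?_)
    · ring
    all_goals
      obtain ⟨l1, l2⟩ := hl
      clear hw hW hF hF' hx
      interval_cases a <;> norm_num [flipParam] at * <;> linarith
  · obtain ⟨hx, hW0⟩ := hF' hf
    rw [hx]
    by_cases hav : avail
    · rw [if_pos hav, hW0 hav]; linarith [hl.2, hw.2]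
    · rw [if_neg hav]
      have h1 : W * s ≤ a - l := by
        have : (2 : ℝ) ≤ a := by exact_mod_cast ha
        nlinarith [mul_le_mul_of_nonneg_left hs hW.1, hl.2]
      have h2 := mul_le_mul_of_nonneg_left h1 (flipParam_nonneg a)
      rw [← mul_assoc] at h2
      have : flipParam a * (a - l) ≤ 11 / 12 + 17 / 30 * (1 / 2 - l) := by
        interval_cases a <;> norm_num [flipParam] <;> linarith [hl.1, hl.2]
      linarith

lemma mul_add_mul_le_one {W W' s t : ℝ} (hW : 0 ≤ W ∧ W ≤ 1) (hW' : 0 ≤ W' ∧ W' ≤ 1) (hs : s ≤ 1)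
    (ht : t ≤ 1) (hst : s + t ≤ 1) : W * s + W' * t ≤ 1 := by
  have h1 : W * s ≤ max s 0 := by
    rcases le_total 0 s with h | h
    · rw [max_eq_left h]; nlinarith
    · rw [max_eq_right h]; nlinarith
  have h2 : W' * t ≤ max t 0 := by
    rcases le_total 0 t with h | h
    · rw [max_eq_left h]; nlinarith
    · rw [max_eq_right h]; nlinarith
  rcases max_cases s 0 with h | h <;> rcases max_cases t 0 with h' | h' <;> linarith

lemma SinglePiece.alone_le (h : SinglePiece w avail F a W xA α s) (hw : 0 ≤ w ∧ w ≤ 1)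
    (ha : 1 ≤ a) (hav : avail) : xA * α + flipParam a * W * s + w ≤ 17 / 10 := by
  rcases ha.lt_or_eq with ha | rfl
  · have h1 := h.one_sided hw ha (l := 0) (by norm_num) (by linarith [h.small_le])
    rw [if_pos hav] at h1
    have : (0 : ℝ) ≤ if 7 ≤ a then 1 / 8 else 0 := by split <;> norm_num
    linarith [hw.2]
  · obtain ⟨hW, hα, hs', hadd, hF, hF'⟩ := h
    by_cases hf : F
    · rw [(hF hf).2, ← sub_nonpos]
      refine le_trans (le_of_eq ?_) (affine_nonpos_of_vertices
        (c := -(17 / 10)) (d₁ := 3 / 20 * α + 1)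
        (d₂ := 3 / 20 * α + s) (d₃ := 0) hw hW hw ?_ ?_ ?_ ?_ ?_ ?_ ?_ ?_)
      · norm_num [flipParam]; ring
      all_goals norm_num at * <;> linarith
    · rw [(hF' hf).1, (hF' hf).2 hav]; linarith [hw.2]

set_option maxHeartbeats 2000000 in
lemma SinglePiece.one_two_le (h : SinglePiece w avail F 1 W xA α s)
    (h' : SinglePiece w avail F' b W' xB β t) (hw : 0 ≤ w ∧ w ≤ 1) (hb : 2 ≤ b)
    (hst : s + t ≤ b) :
    xA * α + flipParam 1 * W * s + (xB * β + flipParam b * W' * t) + (if avail then w else 0) ≤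
      11 / 6 - (if 7 ≤ b then 1 / 200 else 0) := by
  have hite : (if 7 ≤ b then (1 : ℝ) / 200 else 0) ≤ 1 / 200 := by split <;> norm_num
  by_cases hav : avail
  swap
  · have hf : ¬ F := fun hf => hav (h.weight_large hf).1
    have hf' : ¬ F' := fun hf => hav (h'.weight_large hf).1
    rw [if_neg hav, (h.weight_large' hf).1, (h'.weight_large' hf').1]
    have h1 : flipParam 1 * W * s ≤ 1 := by
      have := h.small_le
      have := h.weight_mem
      norm_num [flipParam] at *
      nlinarith
    have h2 := h'.one_sided hw hb (l := 0) (by norm_num) (by linarith [h'.small_le])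
    rw [(h'.weight_large' hf').1, if_neg hav] at h2
    have h3 : flipParam b * W' * t ≤ 6 / 10 := by
      have h3 : W' * t ≤ b := by nlinarith [h'.weight_mem, h'.small_le]
      have h4 := mul_le_mul_of_nonneg_left h3 (flipParam_nonneg b)
      rw [← mul_assoc] at h4
      refine h4.trans ?_
      rcases lt_or_ge b 7 with h | h
      · interval_cases b <;> norm_num [flipParam]
      · rw [flipParam_of_seven_le h]; norm_num
    linarith
  rw [if_pos hav]
  by_cases hf' : F'
  swap
  · rw [(h'.weight_large' hf').1, (h'.weight_large' hf').2 hav]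
    linarith [h.alone_le hw le_rfl hav]
  by_cases hf : F
  swap
  · rw [(h.weight_large' hf).1, (h.weight_large' hf).2 hav]
    linarith [h'.alone_le hw (by omega) hav]
  rcases lt_or_ge b 7 with hb7 | hb7
  swap
  · rw [(h'.weight_large hf').2, flipParam_of_seven_le (by omega : 7 ≤ 1 + b),
      flipParam_of_seven_le hb7, zero_div, zero_mul, zero_mul, zero_mul, zero_mul]
    linarith [h.alone_le hw le_rfl hav]
  rw [if_neg (by omega : ¬ 7 ≤ b), (h'.weight_large hf').2, (h.weight_large hf).2, ← sub_nonpos]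
  refine le_trans (le_of_eq ?_) (affine_nonpos_of_vertices
    (c := -(11 / 6)) (d₁ := 3 / 20 * α + flipParam (1 + b) / (1 + b) * β + 1)
    (d₂ := 3 / 20 * α + s) (d₃ := flipParam (1 + b) / (1 + b) * b * β + flipParam b * t)
    hw h.weight_mem h'.weight_mem ?_ ?_ ?_ ?_ ?_ ?_ ?_ ?_)
  · norm_num [flipParam]; ring
  all_goals
    obtain ⟨-, h1, h2, h3, -, -⟩ := h
    obtain ⟨-, h4, h5, h6, -, -⟩ := h'
    interval_cases b <;> norm_num [flipParam] at * <;> linarith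

lemma SinglePiece.one_one_le (h : SinglePiece w avail F 1 W xA α s)
    (h' : SinglePiece w avail F' 1 W' xB β t) (hw : 0 ≤ w ∧ w ≤ 1)
    (hst : s + t ≤ 1) (hWW : F → F' → W = W') :
    xA * α + flipParam 1 * W * s + (xB * β + flipParam 1 * W' * t) + (if avail then w else 0) ≤
      17 / 10 := by
  by_cases hav : avail
  swap
  · have hf : ¬ F := fun hf => hav (h.weight_large hf).1
    have hf' : ¬ F' := fun hf => hav (h'.weight_large hf).1
    rw [if_neg hav, (h.weight_large' hf).1, (h'.weight_large' hf').1]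
    have := mul_add_mul_le_one h.weight_mem h'.weight_mem (by simpa using h.small_le)
      (by simpa using h'.small_le) hst
    norm_num [flipParam]
    linarith
  rw [if_pos hav]
  by_cases hf' : F'
  swap
  · rw [(h'.weight_large' hf').1, (h'.weight_large' hf').2 hav]
    linarith [h.alone_le hw le_rfl hav]
  by_cases hf : F
  swap
  · rw [(h.weight_large' hf).1, (h.weight_large' hf).2 hav]
    linarith [h'.alone_le hw (by omega) hav]
  rw [(h'.weight_large hf').2, (h.weight_large hf).2, ← hWW hf hf', ← sub_nonpos]
  refine le_trans (le_of_eq ?_) (affine_nonpos_of_vertices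
    (c := -(17 / 10)) (d₁ := 3 / 20 * (α + β) + 1) (d₂ := 3 / 20 * (α + β) + (s + t)) (d₃ := 0)
    hw h.weight_mem hw ?_ ?_ ?_ ?_ ?_ ?_ ?_ ?_)
  · norm_num [flipParam]; ring
  all_goals
    obtain ⟨-, h1, h2, h3, -, -⟩ := h
    obtain ⟨-, h4, h5, h6, -, -⟩ := h'
    norm_num at * <;> linarith

lemma SinglePiece.pair_le (h : SinglePiece w avail F a W xA α s)
    (h' : SinglePiece w avail F' b W' xB β t) (hw : 0 ≤ w ∧ w ≤ 1) (ha : 1 ≤ a) (hb : 1 ≤ b)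
    (hst : s + t ≤ a + b - 1) (hWW : F → F' → a = 1 → b = 1 → W = W') :
    xA * α + flipParam a * W * s + (xB * β + flipParam b * W' * t) + (if avail then w else 0) ≤
      11 / 6 - (if (a = 1 ∧ b = 1) ∨ 7 ≤ a ∨ 7 ≤ b then 1 / 200 else 0) := by
  rcases ha.lt_or_eq with ha | rfl <;> rcases hb.lt_or_eq with hb | rfl
  · have h0 := h.small_le
    have h0' := h'.small_le
    have h1 := h.one_sided hw ha (l := min 1 (a - s)) ⟨le_min zero_le_one (by linarith),
      min_le_left _ _⟩ (by linarith [min_le_right 1 (a - s)])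
    have h2 := h'.one_sided hw hb (l := min 1 (b - t)) ⟨le_min zero_le_one (by linarith),
      min_le_left _ _⟩ (by linarith [min_le_right 1 (b - t)])
    have h3 : 1 ≤ min 1 (a - s) + min 1 (b - t) := by
      rcases min_cases 1 (a - s) with h | h <;> rcases min_cases 1 (b - t) with h' | h' <;> linarith
    have h4 : (if (a = 1 ∧ b = 1) ∨ 7 ≤ a ∨ 7 ≤ b then (1 : ℝ) / 200 else 0) ≤
        (if 7 ≤ a then 1 / 8 else 0) + (if 7 ≤ b then 1 / 8 else 0) := by
      split_ifs <;> first | omega | norm_num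
    have h5 : (if avail then w else 0) =
        (if avail then w / 2 else 0) + (if avail then w / 2 else 0) := by split <;> ring
    linarith
  · have := h'.one_two_le h hw ha (by push_cast at hst; linarith)
    have h4 : (if (a = 1 ∧ 1 = 1) ∨ 7 ≤ a ∨ 7 ≤ 1 then (1 : ℝ) / 200 else 0) =
        (if 7 ≤ a then 1 / 200 else 0) := by congr 1; simp; omega
    linarith
  · have := h.one_two_le h' hw hb (by push_cast at hst; linarith)
    have h4 : (if (1 = 1 ∧ b = 1) ∨ 7 ≤ 1 ∨ 7 ≤ b then (1 : ℝ) / 200 else 0) =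
        (if 7 ≤ b then 1 / 200 else 0) := by congr 1; simp; omega
    linarith
  · have := h.one_one_le h' hw (by push_cast at hst; linarith) fun hf hf' => hWW hf hf' rfl rfl
    rw [if_pos (by simp : (1 = 1 ∧ 1 = 1) ∨ 7 ≤ 1 ∨ 7 ≤ 1)]
    linarith

end NumericSingle

section NumericGroup
variable {ι : Type*} {I : Finset ι} {w xA xB α β : ℝ} {avail F F' : Prop} {a b : ι → ℕ}
  {W W' s t : ι → ℝ}

/-- The comparison for a color class in the neighborhood of the disagreement. -/
theorem FlipSide.pair_total_le (h : FlipSide I w avail F a W xA α s)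
    (h' : FlipSide I w avail F' b W' xB β t) (hw : 0 ≤ w ∧ w ≤ 1)
    (hst : ∀ i ∈ I, s i + t i ≤ a i + b i - 1)
    (hWW : F → F' → ∀ i ∈ I, a i = 1 → b i = 1 → W i = W' i)
    (h1 : #I = 1 → ∀ i ∈ I, 1 ≤ a i ∧ 1 ≤ b i) (hI : I.Nonempty) :
    xA * α + ∑ i ∈ I, flipParam (a i) * W i * s i +
      (xB * β + ∑ i ∈ I, flipParam (b i) * W' i * t i) + (if avail then w else 0) ≤
    11 / 6 * #I -
      (if ∃ i ∈ I, (a i = 1 ∧ b i = 1) ∨ 7 ≤ a i ∨ 7 ≤ b i then (#I : ℝ) / 200 else 0) := by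
  have hcard := card_pos.2 hI
  rcases (show 1 ≤ #I from hcard).lt_or_eq with hI2 | hI1
  swap
  · obtain ⟨i, rfl⟩ := card_eq_one.1 hI1.symm
    have hi := h1 hI1.symm i (by simp)
    have := h.singlePiece.pair_le h'.singlePiece hw hi.1 hi.2 (hst i (by simp))
      fun hf hf' => hWW hf hf' i (by simp)
    simpa using this
  set θ : ι → ℝ := fun i => if a i = 1 ∧ b i = 1 then 5 / 6 else 2 / 3 with hθ
  have hmin : ∀ {x y : ℝ}, y ≤ x → 0 ≤ min 1 (x - y) ∧ min 1 (x - y) ≤ 1 := fun hxy =>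
    ⟨le_min zero_le_one (by linarith), min_le_left _ _⟩
  have e1 := h.total_le (lam := fun i => min 1 (a i - s i)) (θ := θ) hw
    (fun i hi => hmin (h.small_le i hi)) (fun i hi => by linarith [min_le_right 1 (a i - s i)])
    (fun i hi => by simp only [hθ]; split_ifs <;> simp_all) hI2
  have e2 := h'.total_le (lam := fun i => min 1 (b i - t i)) (θ := θ) hw
    (fun i hi => hmin (h'.small_le i hi)) (fun i hi => by linarith [min_le_right 1 (b i - t i)])
    (fun i hi => by simp only [hθ]; split_ifs <;> simp_all) hI2
  have e3 : (if ∃ i ∈ I, (a i = 1 ∧ b i = 1) ∨ 7 ≤ a i ∨ 7 ≤ b i then (#I : ℝ) / 200 else 0) ≤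
      (if ∃ i ∈ I, θ i = 5 / 6 ∨ 7 ≤ a i then (#I : ℝ) / 200 else 0) +
      (if ∃ i ∈ I, θ i = 5 / 6 ∨ 7 ≤ b i then (#I : ℝ) / 200 else 0) := by
    have hp : (0 : ℝ) ≤ (#I : ℝ) / 200 := by positivity
    by_cases hex : ∃ i ∈ I, (a i = 1 ∧ b i = 1) ∨ 7 ≤ a i ∨ 7 ≤ b i
    · rw [if_pos hex]
      obtain ⟨i, hi, hab | ha | hb⟩ := hex
      · rw [if_pos ⟨i, hi, .inl (if_pos hab)⟩]
        split <;> linarith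
      · rw [if_pos ⟨i, hi, .inr ha⟩]
        split <;> linarith
      · rw [if_pos (⟨i, hi, .inr hb⟩ : ∃ i ∈ I, θ i = 5 / 6 ∨ 7 ≤ b i)]
        split <;> linarith
    · rw [if_neg hex]
      split_ifs <;> linarith
  have e4 : ∑ i ∈ I, θ i * (1 / 2 - min 1 (a i - s i)) +
      ∑ i ∈ I, θ i * (1 / 2 - min 1 (b i - t i)) ≤ 0 := by
    rw [← sum_add_distrib]
    refine sum_nonpos fun i hi => ?_
    have h0 := h.small_le i hi
    have h0' := h'.small_le i hi
    have h0'' := hst i hi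
    have : 1 ≤ min 1 (a i - s i) + min 1 (b i - t i) := by
      rcases min_cases 1 (a i - s i) with h | h <;>
      rcases min_cases 1 (b i - t i) with h' | h' <;> linarith
    have hθ0 : 0 ≤ θ i := by simp only [hθ]; split <;> norm_num
    nlinarith
  have e5 : (if avail then w else 0) =
      (if avail then w / 2 else 0) + (if avail then w / 2 else 0) := by split <;> ring
  rw [sum_sub_distrib] at e1 e2
  linarith

lemma flipParam_mul_pred_sub_le (m : ℕ) : flipParam (1 + m) * (m - 1) ≤ 1 / 5 := by
  rcases lt_or_ge m 6 with h | h
  · interval_cases m <;> norm_num [flipParam]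
  · rw [flipParam_of_seven_le (by omega)]; norm_num

/-- The comparison for the color class of the color of the disagreement in the other coloring. -/
theorem opposite_color_le (hW : ∀ i ∈ I, 0 ≤ W i ∧ W i ≤ 1) (hw : 0 ≤ w ∧ w ≤ 1)
    (hα : α ≤ (∑ i ∈ I, a i : ℕ) - 1) (hs : ∀ i ∈ I, s i ≤ a i)
    (hadd : ∀ i ∈ I, α + s i ≤ (∑ i ∈ I, a i : ℕ) - 1 - a i)
    (hx : 0 ≤ xA ∧ xA ≤ flipParam (1 + ∑ i ∈ I, a i))
    (hcase : (∀ i ∈ I, flipParam (1 + ∑ i ∈ I, a i) / (1 + ∑ i ∈ I, a i : ℕ) * (a i * W i) ≤ xA) ∨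
      ∃ i ∈ I, W i = 0 ∧ 1 ≤ a i) (hI : I.Nonempty) :
    xA * α + ∑ i ∈ I, flipParam (a i) * W i * s i + w ≤ 11 / 6 * #I - (#I : ℝ) / 200 := by
  have he : ∀ i ∈ I, flipParam (a i) * W i * s i ≤ flipParam (a i) * a i := fun i hi => by
    rw [mul_assoc]
    refine mul_le_mul_of_nonneg_left ?_ (flipParam_nonneg _)
    have := hW i hi
    have := hs i hi
    have : (0 : ℝ) ≤ a i := Nat.cast_nonneg _
    nlinarith
  have he' : ∀ i ∈ I, flipParam (a i) * W i * s i ≤ 1 := fun i hi =>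
    (he i hi).trans (flipParam_mul_le _)
  have hcard := card_pos.2 hI
  rcases (show 1 ≤ #I from hcard).lt_or_eq with hI2 | hI1
  · have h2 : (2 : ℝ) ≤ #I := by exact_mod_cast hI2
    have h1 := sum_le_card_mul he'
    have h3 : xA * α ≤ 1 / 3 := by
      refine le_trans ?_ (flipParam_mul_pred_le (∑ i ∈ I, a i)).1
      calc xA * α ≤ xA * (∑ i ∈ I, a i : ℕ) := mul_le_mul_of_nonneg_left (by linarith) hx.1
        _ ≤ _ := mul_le_mul_of_nonneg_right hx.2 (Nat.cast_nonneg _)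
    linarith [hw.2]
  obtain ⟨i, rfl⟩ := card_eq_one.1 hI1.symm
  simp only [mem_singleton, forall_eq, sum_singleton, exists_eq_left, card_singleton] at *
  have hpred := flipParam_mul_pred_sub_le (a i)
  have hxα : 1 ≤ a i → xA * α ≤ flipParam (1 + a i) * (a i - 1) := fun h => by
    have : (1 : ℝ) ≤ a i := by exact_mod_cast h
    calc xA * α ≤ xA * (a i - 1) := mul_le_mul_of_nonneg_left hα hx.1
      _ ≤ _ := mul_le_mul_of_nonneg_right hx.2 (by linarith)
  rcases lt_trichotomy (a i) 1 with ha | ha | ha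
  · have ha0 : a i = 0 := by omega
    have h0 : flipParam 0 = 0 := rfl
    rw [ha0] at hα
    rw [ha0, h0, zero_mul, zero_mul]
    push_cast at hα ⊢
    nlinarith [hx.1, hw.2]
  · rcases hcase with hc | hc
    · have h1 : flipParam 1 = 1 := rfl
      have h2 : flipParam 2 = 3 / 10 := rfl
      rw [ha] at hc hadd hα hs ⊢
      norm_num [h2] at hc hadd hα hs
      rw [h1]
      have h3 : xA * α ≤ 3 / 20 * W i * α := mul_le_mul_of_nonpos_right hc hα
      have h4 : W i * (3 / 20 * α + s i) ≤ W i * (7 / 10) :=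
        mul_le_mul_of_nonneg_left (by linarith) hW.1
      norm_num
      linarith [hw.2]
    · rw [hc.1]
      linarith [hxα ha.ge, hw.2]
  · have h3 : flipParam (a i) * a i ≤ 3 / 5 := by
      generalize a i = m at ha
      rcases lt_or_ge m 7 with h | h
      · interval_cases m <;> norm_num [flipParam]
      · rw [flipParam_of_seven_le h]; norm_num
    have := hxα ha.le
    norm_num
    linarith [hw.2]

end NumericGroup

section Reindex

variable {V : Type*} [Fintype V] [DecidableEq V] {q : ℕ} {G : SimpleGraph V}

lemma mem_kempeComp_comm {σ : V → Fin q} {w z : V} {c e : Fin q} (h : σ z = σ w ∧ c = e ∨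
    σ z = e ∧ c = σ w) : w ∈ kempeComp G univ σ z c ↔ z ∈ kempeComp G univ σ w e := by
  rw [mem_kempeComp, mem_kempeComp]
  have : kempeStep G univ σ (σ z) c = kempeStep G univ σ (σ w) e := by
    rcases h with ⟨h, rfl⟩ | ⟨h, rfl⟩
    · rw [h]
    · rw [h, kempeStep_comm]
  rw [this]
  exact ⟨kempeReach_symm, kempeReach_symm⟩

lemma sum_mem_kempeComp (σ : V → Fin q) (w : V) (H : V → Fin q → ℝ) :
    ∑ z, ∑ c, (if w ∈ kempeComp G univ σ z c then H z c else 0) =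
      ∑ e, ∑ z ∈ kempeComp G univ σ w e, H z (otherColor (σ w) e (σ z)) := by
  have : ∀ e, ∑ z ∈ kempeComp G univ σ w e, H z (otherColor (σ w) e (σ z)) =
      ∑ z, if z ∈ kempeComp G univ σ w e then H z (otherColor (σ w) e (σ z)) else 0 := by
    intro e; rw [← sum_filter]; congr 1; ext; simp
  simp_rw [this]
  refine Eq.trans (sum_congr rfl fun z _ => ?_) sum_comm
  by_cases hz : σ z = σ w
  · refine sum_congr rfl fun c _ => ?_
    simp only [mem_kempeComp_comm (.inl ⟨hz, rfl⟩), otherColor, if_pos hz]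
  · rw [sum_eq_single (σ w), sum_eq_single (σ z)]
    · simp only [mem_kempeComp_comm (.inr ⟨rfl, rfl⟩), otherColor, if_neg hz]
    · intro e _ he
      rw [if_neg]
      intro h
      rcases color_of_mem_kempeComp h with h | h
      · exact hz h
      · exact he h.symm
    · simp
    · intro c _ hc
      rw [if_neg]
      intro h
      rcases color_of_mem_kempeComp h with h | h
      · exact hz h.symm
      · exact hc h.symm
    · simp

lemma moveRate_eq_of_mem {L : V → Finset (Fin q)} {σ : V → Fin q} {w z : V} {e : Fin q}
    (h : z ∈ kempeComp G univ σ w e) :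
    moveRate G L σ z (otherColor (σ w) e (σ z)) = moveRate G L σ w e := by
  unfold moveRate
  rw [kempeFlip_eq_of_mem h, kempeComp_eq_of_mem h]
  congr 2
  rcases pair_otherColor (color_of_mem_kempeComp h) with ⟨h1, h2⟩ | ⟨h1, h2⟩
  · rw [h1] at h2 ⊢; rw [h2]
  · rw [h1] at h2 ⊢; rw [h2]; exact propext ⟨Ne.symm, Ne.symm⟩

lemma sum_weight_mul_moveRate_le {L : V → Finset (Fin q)} {σ : V → Fin q} {w : V} {e : Fin q}
    {ω : V → ℝ} (hω : ∀ z, 0 ≤ ω z ∧ ω z ≤ 1) :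
    (∑ z ∈ kempeComp G univ σ w e, ω z) * moveRate G L σ w e ≤
      flipParam (kempeComp G univ σ w e).card := by
  have h1 : ∑ z ∈ kempeComp G univ σ w e, ω z ≤ (kempeComp G univ σ w e).card := by
    simpa using sum_le_card_mul (M := 1) fun z (_ : z ∈ kempeComp G univ σ w e) => (hω z).2
  have hpos : (0 : ℝ) < (kempeComp G univ σ w e).card := by
    exact_mod_cast card_kempeComp_pos σ w e
  have h2 : moveRate G L σ w e ≤
      flipParam (kempeComp G univ σ w e).card / (kempeComp G univ σ w e).card := by
    unfold moveRate; split_ifs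
    · exact le_rfl
    · exact (flipParam_div_mem _).1
  calc _ ≤ (kempeComp G univ σ w e).card * (flipParam (kempeComp G univ σ w e).card /
        (kempeComp G univ σ w e).card) := mul_le_mul h1 h2 (moveRate_nonneg _ _ _ _) hpos.le
    _ = flipParam (kempeComp G univ σ w e).card := by field_simp

/-- The rate of the moves that recolor a given vertex with a given color is at most one. -/
lemma sum_recolor_rate_le {L : V → Finset (Fin q)} {σ : V → Fin q} {w : V} {e : Fin q}
    {ω : V → ℝ} (hω : ∀ z, 0 ≤ ω z ∧ ω z ≤ 1) :
    ∑ z, ∑ c, (if w ∈ kempeComp G univ σ z c ∧ kempeFlip G σ z c w = e then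
      ω z * moveRate G L σ z c else 0) ≤ 1 := by
  have h := sum_mem_kempeComp (G := G) σ w
    fun z c => if kempeFlip G σ z c w = e then ω z * moveRate G L σ z c else 0
  simp_rw [ite_and]
  rw [h, sum_eq_single e]
  · refine le_of_eq_of_le ?_ ((sum_weight_mul_moveRate_le (G := G) (L := L) (σ := σ) (w := w)
      (e := e) hω).trans (flipParam_le_one _))
    rw [sum_mul]
    refine sum_congr rfl fun z hz => ?_
    rw [kempeFlip_eq_of_mem hz, kempeFlip_self, if_pos rfl, moveRate_eq_of_mem hz]
  · intro c _ hc
    refine sum_eq_zero fun z hz => ?_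
    rw [kempeFlip_eq_of_mem hz, kempeFlip_self, if_neg hc]
  · simp

end Reindex

section Branches

variable {V : Type*} [Fintype V] [DecidableEq V] {q : ℕ} (G : SimpleGraph V)

/-- The neighbors of `v` that have color `e`. -/
noncomputable def colorNbrs (σ : V → Fin q) (v : V) (e : Fin q) : Finset V :=
  univ.filter fun u => G.Adj v u ∧ σ u = e

/-- The bichromatic component of `u` with second color `σ v`, in the graph without `v`. -/
noncomputable def branch (σ : V → Fin q) (v u : V) : Finset V :=
  kempeComp G (univ.erase v) σ u (σ v)

variable {G}

lemma mem_colorNbrs {σ : V → Fin q} {v u : V} {e : Fin q} :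
    u ∈ colorNbrs G σ v e ↔ G.Adj v u ∧ σ u = e := by simp [colorNbrs]

lemma mem_branch {σ : V → Fin q} {v u x : V} :
    x ∈ branch G σ v u ↔
      Relation.ReflTransGen (kempeStep G (univ.erase v) σ (σ u) (σ v)) u x := by
  simp [branch, kempeComp]

lemma self_mem_branch (σ : V → Fin q) (v u : V) : u ∈ branch G σ v u := mem_branch.2 .refl

lemma ne_of_mem_branch {σ : V → Fin q} {v u x : V} (hu : u ≠ v) (hx : x ∈ branch G σ v u) :
    x ≠ v := by
  rcases (mem_branch.1 hx).cases_tail with h | ⟨_, _, h⟩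
  · rwa [h]
  · exact ne_of_mem_erase h.2.1

lemma color_of_mem_branch {σ : V → Fin q} {v u x : V} (hx : x ∈ branch G σ v u) :
    σ x = σ u ∨ σ x = σ v := by
  rcases (mem_branch.1 hx).cases_tail with h | ⟨_, _, h⟩
  · rw [h]; exact .inl rfl
  · exact h.2.2.2.2.1

lemma branch_eq_of_mem {σ : V → Fin q} {v u u' x : V} (huu' : σ u = σ u')
    (hx : x ∈ branch G σ v u) (hx' : x ∈ branch G σ v u') :
    branch G σ v u = branch G σ v u' := by
  have hsym : ∀ {w w' : V},
      Relation.ReflTransGen (kempeStep G (univ.erase v) σ (σ u) (σ v)) w w' →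
      Relation.ReflTransGen (kempeStep G (univ.erase v) σ (σ u) (σ v)) w' w := by
    intro w w' h
    induction h with
    | refl => exact .refl
    | tail _ h ih =>
      exact .head ⟨h.2.1, h.1, h.2.2.1.symm, h.2.2.2.2.1, h.2.2.2.1, h.2.2.2.2.2.symm⟩ ih
  rw [mem_branch] at hx hx'
  rw [← huu'] at hx'
  ext y
  rw [mem_branch, mem_branch, ← huu']
  exact ⟨fun h => (hx'.trans (hsym hx)).trans h, fun h => (hx.trans (hsym hx')).trans h⟩

lemma kempeComp_eq_insert_biUnion {σ : V → Fin q} {v : V} {e : Fin q} (he : e ≠ σ v) :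
    kempeComp G univ σ v e = insert v ((colorNbrs G σ v e).biUnion (branch G σ v)) := by
  ext x
  rw [mem_insert, mem_biUnion]
  constructor
  · intro h
    rw [mem_kempeComp] at h
    induction h with
    | refl => exact .inl rfl
    | @tail x y _ h ih =>
      by_cases hy : y = v
      · exact .inl hy
      refine .inr ?_
      rcases ih with rfl | ⟨u, hu, hx⟩
      · refine ⟨y, mem_colorNbrs.2 ⟨h.2.2.1, ?_⟩, self_mem_branch _ _ _⟩
        rcases h.2.2.2.2.1 with h' | h'
        · exact absurd h'.symm h.2.2.2.2.2
        · exact h'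
      · have hux := mem_colorNbrs.1 hu
        refine ⟨u, hu, mem_branch.2 ((mem_branch.1 hx).tail ?_)⟩
        rw [hux.2]
        exact ⟨mem_erase.2 ⟨ne_of_mem_branch hux.1.ne' hx, mem_univ _⟩,
          mem_erase.2 ⟨hy, mem_univ _⟩, h.2.2.1, h.2.2.2.1.symm, h.2.2.2.2.1.symm,
          h.2.2.2.2.2⟩
  · rintro (rfl | ⟨u, hu, hx⟩)
    · exact self_mem_kempeComp _ _ _
    · have hux := mem_colorNbrs.1 hu
      rw [mem_branch, hux.2] at hx
      rw [mem_kempeComp]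
      refine Relation.ReflTransGen.head ⟨mem_univ _, mem_univ _, hux.1, .inl rfl, .inr hux.2,
        by rw [hux.2]; exact he.symm⟩ (Relation.ReflTransGen.mono (fun w w' h =>
          ⟨mem_univ _, mem_univ _, h.2.2.1, h.2.2.2.1.symm, h.2.2.2.2.1.symm, h.2.2.2.2.2⟩)
          _ _ hx)

lemma exists_branchReps (σ : V → Fin q) (v : V) (e : Fin q) :
    ∃ R ⊆ colorNbrs G σ v e, Set.InjOn (branch G σ v) R ∧
      R.image (branch G σ v) = (colorNbrs G σ v e).image (branch G σ v) := by
  obtain ⟨R, hR, hinj, him⟩ := Finset.exists_subset_injOn_image_eq_of_surjOn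
    (f := branch G σ v) (colorNbrs G σ v e) ((colorNbrs G σ v e).image (branch G σ v))
    (by rw [coe_image]; exact Set.surjOn_image _ _)
  exact ⟨R, by exact_mod_cast hR, hinj, him⟩

variable (G) in
/-- One representative of each branch hanging off `v`. -/
noncomputable def branchReps (σ : V → Fin q) (v : V) (e : Fin q) : Finset V :=
  (exists_branchReps (G := G) σ v e).choose

variable (G) in
/-- The size of the branch of `u`, counted only at its representative. -/
noncomputable def branchSize (σ : V → Fin q) (v : V) (e : Fin q) (u : V) : ℕ :=
  if u ∈ branchReps G σ v e then (branch G σ v u).card else 0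

lemma branchReps_subset (σ : V → Fin q) (v : V) (e : Fin q) :
    branchReps G σ v e ⊆ colorNbrs G σ v e := (exists_branchReps σ v e).choose_spec.1

lemma exists_rep {σ : V → Fin q} {v u : V} {e : Fin q} (hu : u ∈ colorNbrs G σ v e) :
    ∃ r ∈ branchReps G σ v e, branch G σ v r = branch G σ v u := by
  have h := (exists_branchReps (G := G) σ v e).choose_spec.2.2
  have hm : branch G σ v u ∈ (colorNbrs G σ v e).image (branch G σ v) := mem_image_of_mem _ hu
  rw [← h, mem_image] at hm
  exact hm

lemma branchReps_pairwiseDisjoint (σ : V → Fin q) (v : V) (e : Fin q) :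
    (branchReps G σ v e : Set V).PairwiseDisjoint (branch G σ v) := by
  intro r hr r' hr' hne
  refine disjoint_left.2 fun x hx hx' => hne ?_
  refine (exists_branchReps (G := G) σ v e).choose_spec.2.1 hr hr' (branch_eq_of_mem ?_ hx hx')
  rw [(mem_colorNbrs.1 (branchReps_subset σ v e hr)).2,
    (mem_colorNbrs.1 (branchReps_subset σ v e hr')).2]

lemma biUnion_branchReps (σ : V → Fin q) (v : V) (e : Fin q) :
    (colorNbrs G σ v e).biUnion (branch G σ v) = (branchReps G σ v e).biUnion (branch G σ v) := by
  refine subset_antisymm (fun x hx => ?_)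
    (biUnion_subset_biUnion_of_subset_left _ (branchReps_subset σ v e))
  obtain ⟨u, hu, hx⟩ := mem_biUnion.1 hx
  obtain ⟨r, hr, h⟩ := exists_rep hu
  exact mem_biUnion.2 ⟨r, hr, by rwa [h]⟩

lemma notMem_biUnion_branch (σ : V → Fin q) (v : V) (e : Fin q) :
    v ∉ (colorNbrs G σ v e).biUnion (branch G σ v) := by
  intro h
  obtain ⟨u, hu, hx⟩ := mem_biUnion.1 h
  exact ne_of_mem_branch (mem_colorNbrs.1 hu).1.ne' hx rfl

/-- Sums over the Kempe component of `v` split into `v` and the branches. -/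
lemma sum_kempeComp_eq {σ : V → Fin q} {v : V} {e : Fin q} (he : e ≠ σ v) {M : Type*}
    [AddCommMonoid M] (h : V → M) :
    ∑ z ∈ kempeComp G univ σ v e, h z =
      h v + ∑ u ∈ colorNbrs G σ v e,
        if u ∈ branchReps G σ v e then ∑ z ∈ branch G σ v u, h z else 0 := by
  rw [kempeComp_eq_insert_biUnion he, sum_insert (notMem_biUnion_branch σ v e),
    biUnion_branchReps, sum_biUnion (branchReps_pairwiseDisjoint σ v e), ← sum_filter,
    filter_mem_eq_inter, inter_eq_right.2 (branchReps_subset σ v e)]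

lemma card_kempeComp_eq {σ : V → Fin q} {v : V} {e : Fin q} (he : e ≠ σ v) :
    (kempeComp G univ σ v e).card = 1 + ∑ u ∈ colorNbrs G σ v e, branchSize G σ v e u := by
  simp only [card_eq_sum_ones, sum_kempeComp_eq he, branchSize]

section Pair

variable {σ τ : V → Fin q} {v : V} (hag : ∀ u, u ≠ v → σ u = τ u)
include hag

lemma branch_subset_kempeComp {u : V} (hu : u ≠ v) :
    branch G σ v u ⊆ kempeComp G univ τ u (σ v) := by
  intro x hx
  rw [mem_branch] at hx
  rw [mem_kempeComp]
  refine Relation.ReflTransGen.mono (fun w w' h => ?_) _ _ hx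
  obtain ⟨h1, h2, h3, h4, h5, h6⟩ := h
  rw [hag w (ne_of_mem_erase h1), hag u hu] at h4
  rw [hag w' (ne_of_mem_erase h2), hag u hu] at h5
  rw [hag w (ne_of_mem_erase h1), hag w' (ne_of_mem_erase h2)] at h6
  exact ⟨mem_univ _, mem_univ _, h3, h4, h5, h6⟩

lemma kempeComp_eq_branch {u : V} (hu : u ≠ v) (hv : v ∉ kempeComp G univ τ u (σ v)) :
    kempeComp G univ τ u (σ v) = branch G σ v u := by
  refine subset_antisymm (fun x hx => ?_) (branch_subset_kempeComp hag hu)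
  rw [mem_kempeComp] at hx
  induction hx with
  | refl => exact self_mem_branch _ _ _
  | @tail w w' hw h ih =>
    have hwv : w ≠ v := by rintro rfl; exact hv (mem_kempeComp.2 hw)
    have hwv' : w' ≠ v := by rintro rfl; exact hv (mem_kempeComp.2 (hw.tail h))
    obtain ⟨-, -, h3, h4, h5, h6⟩ := h
    rw [← hag w hwv, ← hag u hu] at h4
    rw [← hag w' hwv', ← hag u hu] at h5
    rw [← hag w hwv, ← hag w' hwv'] at h6
    exact mem_branch.2 ((mem_branch.1 ih).tail ⟨mem_erase.2 ⟨hwv, mem_univ _⟩,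
      mem_erase.2 ⟨hwv', mem_univ _⟩, h3, h4, h5, h6⟩)

/-- The moves of `τ` at vertices of a branch are all the same. -/
lemma move_eq_of_mem_branch {L : V → Finset (Fin q)} {e : Fin q} (he : e ≠ σ v) {u z : V}
    (hu : u ∈ colorNbrs G σ v e) (hz : z ∈ branch G σ v u) :
    kempeComp G univ τ z (otherColor (σ v) e (σ z)) = kempeComp G univ τ u (σ v) ∧
    kempeFlip G τ z (otherColor (σ v) e (σ z)) = kempeFlip G τ u (σ v) ∧
    moveRate G L τ z (otherColor (σ v) e (σ z)) = moveRate G L τ u (σ v) := by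
  obtain ⟨hadj, hue⟩ := mem_colorNbrs.1 hu
  have huv := hadj.ne'
  have hzv := ne_of_mem_branch huv hz
  have hmem := branch_subset_kempeComp hag huv hz
  have hc : otherColor (σ v) e (σ z) = otherColor (τ u) (σ v) (τ z) := by
    rw [← hag u huv, ← hag z hzv, hue]
    rcases color_of_mem_branch hz with h | h
    · rw [hue] at h; simp [otherColor, h, he]
    · simp [otherColor, h, he.symm]
  rw [hc]
  exact ⟨kempeComp_eq_of_mem hmem, kempeFlip_eq_of_mem hmem, moveRate_eq_of_mem hmem⟩

end Pair

end Branches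

section Weights

variable {V : Type*} [Fintype V] [DecidableEq V] {q : ℕ} (G : SimpleGraph V)

/-- The branch of `u` can be flipped in `τ` as a component avoiding `v`. -/
def BranchMovable (L : V → Finset (Fin q)) (σ τ : V → Fin q) (v u : V) : Prop :=
  v ∉ kempeComp G univ τ u (σ v) ∧ ListRespecting L (kempeFlip G τ u (σ v))

/-- The average pick weight of a movable branch, counted only at its representative. -/
noncomputable def branchWeight (L : V → Finset (Fin q)) (ω : V → ℝ) (σ τ : V → Fin q) (v : V)
    (e : Fin q) (u : V) : ℝ :=
  if u ∈ branchReps G σ v e ∧ BranchMovable G L σ τ v u then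
    (∑ z ∈ branch G σ v u, ω z) / (branch G σ v u).card else 0

/-- The total weight of flipping the component of `v` with color `e`. -/
noncomputable def largeWeight (L : V → Finset (Fin q)) (ω : V → ℝ) (σ : V → Fin q) (v : V)
    (e : Fin q) : ℝ :=
  moveRate G L σ v e * ∑ z ∈ kempeComp G univ σ v e, ω z

/-- The excess distance caused by an unmatched flip of the component of `v`. -/
noncomputable def largeGain (L : V → Finset (Fin q)) (f : (V → Fin q) → ℝ) (σ τ : V → Fin q)
    (v : V) (e : Fin q) : ℝ :=
  if ListRespecting L (kempeFlip G σ v e) then f (kempeFlip G σ v e) - f τ - 1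
  else -1 - (∑ u ∈ colorNbrs G σ v e, branchSize G σ v e u : ℕ)

/-- The excess distance caused by an unmatched flip of a branch. -/
noncomputable def branchGain (L : V → Finset (Fin q)) (f : (V → Fin q) → ℝ) (σ τ : V → Fin q)
    (v : V) (e : Fin q) (u : V) : ℝ :=
  if u ∈ branchReps G σ v e ∧ BranchMovable G L σ τ v u then
    f σ - f (kempeFlip G τ u (σ v)) - 1
  else -1 - branchSize G σ v e u

variable {G} {L : V → Finset (Fin q)} {ω : V → ℝ}

lemma listRespecting_kempeFlip_iff {σ : V → Fin q} (hσ : ListRespecting L σ) {z : V}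
    {c : Fin q} : ListRespecting L (kempeFlip G σ z c) ↔
      ∀ x ∈ kempeComp G univ σ z c, otherColor (σ z) c (σ x) ∈ L x := by
  constructor
  · intro h x hx
    have := h x
    rwa [kempeFlip_of_mem hx] at this
  · intro h x
    by_cases hx : x ∈ kempeComp G univ σ z c
    · rw [kempeFlip_of_mem hx]; exact h x hx
    · rw [kempeFlip_of_notMem hx]; exact hσ x

lemma largeWeight_mem (hω : ∀ z, 0 ≤ ω z ∧ ω z ≤ 1) (σ : V → Fin q) (v : V) (e : Fin q) :
    0 ≤ largeWeight G L ω σ v e ∧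
      largeWeight G L ω σ v e ≤ flipParam (kempeComp G univ σ v e).card := by
  refine ⟨mul_nonneg (moveRate_nonneg _ _ _ _) (sum_nonneg fun z _ => (hω z).1), ?_⟩
  rw [largeWeight, mul_comm]
  exact sum_weight_mul_moveRate_le hω

lemma branchWeight_mem (hω : ∀ z, 0 ≤ ω z ∧ ω z ≤ 1) (σ τ : V → Fin q) (v : V) (e : Fin q)
    (u : V) : 0 ≤ branchWeight G L ω σ τ v e u ∧ branchWeight G L ω σ τ v e u ≤ 1 := by
  unfold branchWeight
  split_ifs
  · have h1 : ∑ z ∈ branch G σ v u, ω z ≤ (branch G σ v u).card := by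
      simpa using sum_le_card_mul (M := 1) fun z (_ : z ∈ branch G σ v u) => (hω z).2
    exact ⟨div_nonneg (sum_nonneg fun z _ => (hω z).1) (Nat.cast_nonneg _),
      div_le_one_of_le₀ h1 (Nat.cast_nonneg _)⟩
  · simp

lemma branchSize_mul_branchWeight_le (hω : ∀ z, 0 ≤ ω z ∧ ω z ≤ 1) (σ τ : V → Fin q) (v : V)
    (e : Fin q) (u : V) : branchSize G σ v e u * branchWeight G L ω σ τ v e u ≤
      if u ∈ branchReps G σ v e then ∑ z ∈ branch G σ v u, ω z else 0 := by
  have hpos : (0 : ℝ) < (branch G σ v u).card := by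
    exact_mod_cast card_pos.2 ⟨u, self_mem_branch σ v u⟩
  unfold branchSize branchWeight
  by_cases hu : u ∈ branchReps G σ v e
  · simp only [hu, true_and, if_true]
    split_ifs
    · rw [mul_div_cancel₀ _ hpos.ne']
    · rw [mul_zero]; exact sum_nonneg fun z _ => (hω z).1
  · simp [hu]

lemma hammCol_le_card {σ τ : V → Fin q} {S : Finset V} (h : ∀ x, x ∉ S → σ x = τ x) :
    hammCol σ τ ≤ S.card :=
  card_le_card fun x hx => by
    by_contra hxS
    exact (mem_filter.1 hx).2 (h x hxS)

section Pair

variable {σ τ : V → Fin q} {v : V} (hag : ∀ u, u ≠ v → σ u = τ u) {e : Fin q} (he : e ≠ σ v)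
include hag

lemma colorNbrs_congr : colorNbrs G σ v e = colorNbrs G τ v e := by
  ext u
  rw [mem_colorNbrs, mem_colorNbrs]
  refine and_congr_right fun h => ?_
  rw [hag u h.ne']

include he

lemma otherColor_eq_of_mem_branch {u z : V}
    (hu : u ∈ colorNbrs G σ v e) (hz : z ∈ branch G σ v u) :
    otherColor (τ u) (σ v) (τ z) = otherColor (σ v) e (σ z) := by
  obtain ⟨hadj, hue⟩ := mem_colorNbrs.1 hu
  rw [← hag u hadj.ne', ← hag z (ne_of_mem_branch hadj.ne' hz), hue]
  rcases color_of_mem_branch hz with h | h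
  · rw [hue] at h; simp [otherColor, h, he]
  · simp [otherColor, h, he.symm]

/-- The total payoff of the moves that are affected through a component of `v`. -/
lemma sum_component_eq (h₁ h₂ : (V → Fin q) → ℝ) :
    ∑ z ∈ kempeComp G univ σ v e,
      (ω z * moveRate G L σ z (otherColor (σ v) e (σ z)) *
          h₁ (kempeFlip G σ z (otherColor (σ v) e (σ z))) +
        if v ∈ kempeComp G univ τ z (otherColor (σ v) e (σ z)) then 0 else
          ω z * moveRate G L τ z (otherColor (σ v) e (σ z)) *
            h₂ (kempeFlip G τ z (otherColor (σ v) e (σ z)))) =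
    largeWeight G L ω σ v e * h₁ (kempeFlip G σ v e) +
      ∑ u ∈ colorNbrs G σ v e, flipParam (branchSize G σ v e u) *
        branchWeight G L ω σ τ v e u * h₂ (kempeFlip G τ u (σ v)) := by
  rw [sum_add_distrib]
  congr 1
  · rw [largeWeight, mul_sum, sum_mul]
    refine sum_congr rfl fun z hz => ?_
    rw [kempeFlip_eq_of_mem hz, moveRate_eq_of_mem hz]; ring
  · rw [sum_kempeComp_eq he, if_pos (self_mem_kempeComp _ _ _), zero_add]
    refine sum_congr rfl fun u hu => ?_
    have huv : u ≠ v := (mem_colorNbrs.1 hu).1.ne'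
    unfold branchSize branchWeight BranchMovable
    by_cases hr : u ∈ branchReps G σ v e
    swap
    · simp [hr]
    simp only [hr, true_and, if_true]
    have hstep : ∀ z ∈ branch G σ v u,
        (if v ∈ kempeComp G univ τ z (otherColor (σ v) e (σ z)) then 0 else
          ω z * moveRate G L τ z (otherColor (σ v) e (σ z)) *
            h₂ (kempeFlip G τ z (otherColor (σ v) e (σ z)))) =
        ω z * (if v ∈ kempeComp G univ τ u (σ v) then 0 else
          moveRate G L τ u (σ v) * h₂ (kempeFlip G τ u (σ v))) := by
      intro z hz
      obtain ⟨h1, h2, h3⟩ := move_eq_of_mem_branch (G := G) (L := L) hag he hu hz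
      simp only [h1, h2, h3]
      split_ifs <;> ring
    rw [sum_congr rfl hstep, ← sum_mul]
    by_cases hv : v ∈ kempeComp G univ τ u (σ v)
    · simp [hv]
    · have hcol : σ v ≠ τ u := by
        rw [← hag u huv, (mem_colorNbrs.1 hu).2]; exact he.symm
      have hv' : v ∉ branch G σ v u := kempeComp_eq_branch hag huv hv ▸ hv
      simp only [hv', if_false, not_false_eq_true, true_and, moveRate, hcol, ne_eq,
        kempeComp_eq_branch hag huv hv]
      by_cases hL : ListRespecting L (kempeFlip G τ u (σ v))
      · simp only [hL, if_true]; ring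
      · simp [hL]

lemma listRespecting_large_iff (hσ : ListRespecting L σ) :
    ListRespecting L (kempeFlip G σ v e) ↔ e ∈ L v ∧
      ∀ u ∈ branchReps G σ v e, ∀ x ∈ branch G σ v u, otherColor (σ v) e (σ x) ∈ L x := by
  rw [listRespecting_kempeFlip_iff hσ, kempeComp_eq_insert_biUnion he, biUnion_branchReps]
  simp only [mem_insert, mem_biUnion, forall_eq_or_imp]
  refine and_congr (by simp [otherColor]) ?_
  exact ⟨fun h u hu x hx => h x ⟨u, hu, hx⟩, fun h x ⟨u, hu, hx⟩ => h u hu x hx⟩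

lemma branchMovable_iff (hτ : ListRespecting L τ) {u : V} (hu : u ∈ colorNbrs G σ v e)
    (hv : v ∉ kempeComp G univ τ u (σ v)) :
    BranchMovable G L σ τ v u ↔ ∀ x ∈ branch G σ v u, otherColor (σ v) e (σ x) ∈ L x := by
  rw [BranchMovable, and_iff_right hv, listRespecting_kempeFlip_iff hτ,
    kempeComp_eq_branch hag (mem_colorNbrs.1 hu).1.ne' hv]
  exact forall₂_congr fun x hx => by rw [otherColor_eq_of_mem_branch hag he hu hx]

/-- If the component of `v` cannot be flipped although `e` is available at `v`, then some branch
cannot be flipped either. -/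
lemma exists_branch_not_movable (hσ : ListRespecting L σ) (hτ : ListRespecting L τ)
    (hev : e ∈ L v) (hF : ¬ ListRespecting L (kempeFlip G σ v e)) :
    ∃ u ∈ colorNbrs G σ v e, branchWeight G L ω σ τ v e u = 0 ∧ 1 ≤ branchSize G σ v e u := by
  rw [listRespecting_large_iff hag he hσ] at hF
  push Not at hF
  obtain ⟨u, hu, x, hx, hxL⟩ := hF hev
  have huN := branchReps_subset σ v e hu
  refine ⟨u, huN, ?_, ?_⟩
  · rw [branchWeight, if_neg]
    rintro ⟨-, h⟩
    exact hxL ((branchMovable_iff hag he hτ huN h.1).1 h x hx)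
  · rw [branchSize, if_pos hu]
    exact card_pos.2 ⟨u, self_mem_branch σ v u⟩

lemma largeWeight_eq (hF : ListRespecting L (kempeFlip G σ v e)) :
    largeWeight G L ω σ v e = flipParam (1 + ∑ u ∈ colorNbrs G σ v e, branchSize G σ v e u) /
      (1 + ∑ u ∈ colorNbrs G σ v e, branchSize G σ v e u : ℕ) *
        (ω v + ∑ u ∈ colorNbrs G σ v e,
          if u ∈ branchReps G σ v e then ∑ z ∈ branch G σ v u, ω z else 0) := by
  rw [largeWeight, moveRate, if_pos ⟨he, hF⟩, sum_kempeComp_eq he, card_kempeComp_eq he]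

lemma largeWeight_of_not (hF : ¬ ListRespecting L (kempeFlip G σ v e)) :
    largeWeight G L ω σ v e = 0 := by
  rw [largeWeight, moveRate, if_neg fun h => hF h.2, zero_mul]

end Pair

end Weights

section Gains

variable {V : Type*} [Fintype V] [DecidableEq V] {q : ℕ} {G : SimpleGraph V}
  {L : V → Finset (Fin q)} {ω : V → ℝ} {f : (V → Fin q) → ℝ} {σ τ : V → Fin q} {v : V}
  {e : Fin q}

lemma branchSize_of_rep {u : V} (hu : u ∈ branchReps G σ v e) :
    branchSize G σ v e u = (branch G σ v u).card := if_pos hu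

lemma kempeFlip_branch_of_mem (hag : ∀ u, u ≠ v → σ u = τ u) (he : e ≠ σ v) {u x : V}
    (hu : u ∈ colorNbrs G σ v e) (hx : x ∈ branch G σ v u) :
    kempeFlip G τ u (σ v) x = otherColor (σ v) e (σ x) := by
  rw [kempeFlip_of_mem (branch_subset_kempeComp hag (mem_colorNbrs.1 hu).1.ne' hx),
    otherColor_eq_of_mem_branch hag he hu hx]

lemma kempeFlip_branch_of_notMem (hag : ∀ u, u ≠ v → σ u = τ u) {u x : V}
    (hu : u ∈ colorNbrs G σ v e) (hm : BranchMovable G L σ τ v u) (hx : x ∉ branch G σ v u) :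
    kempeFlip G τ u (σ v) x = τ x :=
  kempeFlip_of_notMem (by rwa [kempeComp_eq_branch hag (mem_colorNbrs.1 hu).1.ne' hm.1])

variable (hag : ∀ u, u ≠ v → σ u = τ u) (he : e ≠ σ v)
  (hσ : ListRespecting L σ) (hτ : ListRespecting L τ)
  (hf : ∀ x y, ListRespecting L x → ListRespecting L y → f x - f y ≤ hammCol x y)
include hag he hσ hτ hf

lemma exists_large_support : ∃ S : Finset V,
    (S.card : ℝ) = 1 + (∑ u ∈ colorNbrs G σ v e, branchSize G σ v e u : ℕ) -
      (if e = τ v then 1 else 0) ∧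
    (∀ x, x ∉ S → kempeFlip G σ v e x = τ x) ∧
    ∀ u ∈ colorNbrs G σ v e, branch G σ v u ⊆ S := by
  have hB := self_mem_kempeComp (G := G) σ v e
  have hsub : ∀ u ∈ colorNbrs G σ v e, branch G σ v u ⊆ kempeComp G univ σ v e := by
    intro u hu x hx
    rw [kempeComp_eq_insert_biUnion he]
    exact mem_insert_of_mem (mem_biUnion.2 ⟨u, hu, hx⟩)
  have hcard := card_kempeComp_eq (G := G) (σ := σ) (v := v) he
  have hout : ∀ x, x ∉ kempeComp G univ σ v e → kempeFlip G σ v e x = τ x := fun x hx => by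
    rw [kempeFlip_of_notMem hx]
    exact hag x fun h => hx (h ▸ hB)
  by_cases h : e = τ v
  · refine ⟨(kempeComp G univ σ v e).erase v, ?_, ?_, fun u hu x hx => mem_erase.2
      ⟨ne_of_mem_branch (mem_colorNbrs.1 hu).1.ne' hx, hsub u hu hx⟩⟩
    · rw [card_erase_of_mem hB, hcard, if_pos h]; simp
    · intro x hx
      by_cases hxv : x = v
      · rw [hxv, kempeFlip_self, h]
      · exact hout x fun h' => hx (mem_erase.2 ⟨hxv, h'⟩)
  · exact ⟨_, by rw [hcard, if_neg h]; push_cast; ring, hout, hsub⟩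

lemma largeGain_le : largeGain G L f σ τ v e ≤
    (∑ u ∈ colorNbrs G σ v e, branchSize G σ v e u : ℕ) - (if e = τ v then 1 else 0) := by
  unfold largeGain
  split_ifs with h1 h2
  all_goals try (have : (0 : ℝ) ≤ (∑ u ∈ colorNbrs G σ v e, branchSize G σ v e u : ℕ) :=
    Nat.cast_nonneg _; linarith)
  all_goals
    obtain ⟨S, hS, hS', -⟩ := exists_large_support (G := G) (L := L) hag he hσ hτ hf
    have h3 : (hammCol (kempeFlip G σ v e) τ : ℝ) ≤ S.card := by exact_mod_cast hammCol_le_card hS'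
    have h4 := hf _ _ h1 hτ
    first | rw [if_pos h2] at hS | rw [if_neg h2] at hS
    linarith

lemma branchGain_le {u : V} (hu : u ∈ colorNbrs G σ v e) :
    branchGain G L f σ τ v e u ≤ branchSize G σ v e u := by
  unfold branchGain
  split_ifs with h
  · rw [branchSize_of_rep h.1]
    have h3 : (hammCol σ (kempeFlip G τ u (σ v)) : ℝ) ≤ (insert v (branch G σ v u)).card := by
      refine Nat.cast_le.2 (hammCol_le_card fun x hx => ?_)
      rw [mem_insert, not_or] at hx
      rw [kempeFlip_branch_of_notMem hag hu h.2 hx.2, hag x hx.1]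
    have h4 : ((insert v (branch G σ v u)).card : ℝ) ≤ (branch G σ v u).card + 1 := by
      exact_mod_cast card_insert_le _ _
    have := hf _ _ hσ h.2.2
    linarith
  · have : (0 : ℝ) ≤ branchSize G σ v e u := Nat.cast_nonneg _
    linarith

lemma largeGain_add_branchGain_le {u : V} (hu : u ∈ colorNbrs G σ v e) :
    largeGain G L f σ τ v e + branchGain G L f σ τ v e u ≤
      (∑ u ∈ colorNbrs G σ v e, branchSize G σ v e u : ℕ) - (if e = τ v then 1 else 0) -
        branchSize G σ v e u := by
  have hs : (branchSize G σ v e u : ℝ) ≤ (∑ u ∈ colorNbrs G σ v e, branchSize G σ v e u : ℕ) := by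
    exact_mod_cast single_le_sum (f := branchSize G σ v e) (fun _ _ => Nat.zero_le _) hu
  have hα := largeGain_le (G := G) hag he hσ hτ hf
  by_cases hB : ListRespecting L (kempeFlip G σ v e)
  swap
  · have := branchGain_le (G := G) hag he hσ hτ hf hu
    rw [largeGain, if_neg hB]
    split_ifs <;> linarith
  by_cases hm : u ∈ branchReps G σ v e ∧ BranchMovable G L σ τ v u
  swap
  · rw [branchGain, if_neg hm]; linarith
  obtain ⟨S, hS, hS', hsub⟩ := exists_large_support (G := G) (L := L) hag he hσ hτ hf
  have h3 : (hammCol (kempeFlip G σ v e) (kempeFlip G τ u (σ v)) : ℝ) ≤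
      (S \ branch G σ v u).card := by
    refine Nat.cast_le.2 (hammCol_le_card fun x hx => ?_)
    rw [mem_sdiff, not_and, not_not] at hx
    by_cases hxu : x ∈ branch G σ v u
    · rw [kempeFlip_branch_of_mem hag he hu hxu, kempeFlip_of_mem]
      rw [kempeComp_eq_insert_biUnion he]
      exact mem_insert_of_mem (mem_biUnion.2 ⟨u, hu, hxu⟩)
    · rw [kempeFlip_branch_of_notMem hag hu hm.2 hxu, hS' x fun h => hxu (hx h)]
  rw [card_sdiff_of_subset (hsub u hu), Nat.cast_sub (card_le_card (hsub u hu)), hS,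
    ← branchSize_of_rep hm.1] at h3
  have h4 := hf _ _ hB hm.2.2
  have h5 := hf _ _ hσ hτ
  have h6 : (hammCol σ τ : ℝ) ≤ 1 := by
    have : hammCol σ τ ≤ ({v} : Finset V).card :=
      hammCol_le_card fun x hx => hag x (by simpa using hx)
    exact_mod_cast this
  rw [largeGain, if_pos hB, branchGain, if_pos hm]
  linarith

lemma branchGain_add_branchGain_le (he' : e ≠ τ v) {u : V} (hu : u ∈ colorNbrs G σ v e) :
    branchGain G L f σ τ v e u + branchGain G L (-f) τ σ v e u ≤
      branchSize G σ v e u + branchSize G τ v e u - 1 := by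
  have hag' : ∀ u, u ≠ v → τ u = σ u := fun u h => (hag u h).symm
  have hu' : u ∈ colorNbrs G τ v e := by rwa [← colorNbrs_congr hag]
  have hf' : ∀ x y, ListRespecting L x → ListRespecting L y → (-f) x - (-f) y ≤ hammCol x y := by
    intro x y hx hy
    have := hf y x hy hx
    rw [show hammCol y x = hammCol x y by simp only [hammCol, ne_comm]] at this
    simp only [Pi.neg_apply]; linarith
  by_cases hm : u ∈ branchReps G σ v e ∧ BranchMovable G L σ τ v u
  swap
  · have := branchGain_le (G := G) hag' he' hτ hσ hf' hu'
    rw [branchGain, if_neg hm]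
    have : (0 : ℝ) ≤ branchSize G σ v e u := Nat.cast_nonneg _
    linarith
  by_cases hm' : u ∈ branchReps G τ v e ∧ BranchMovable G L τ σ v u
  swap
  · have := branchGain_le (G := G) hag he hσ hτ hf hu
    rw [branchGain.eq_def G L (-f), if_neg hm']
    have : (0 : ℝ) ≤ branchSize G τ v e u := Nat.cast_nonneg _
    linarith
  rw [branchGain, branchGain, if_pos hm, if_pos hm', branchSize_of_rep hm.1,
    branchSize_of_rep hm'.1]
  have h3 : (hammCol (kempeFlip G σ u (τ v)) (kempeFlip G τ u (σ v)) : ℝ) ≤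
      (insert v (branch G σ v u ∪ branch G τ v u)).card := by
    refine Nat.cast_le.2 (hammCol_le_card fun x hx => ?_)
    rw [mem_insert, mem_union, not_or, not_or] at hx
    rw [kempeFlip_branch_of_notMem hag hu hm.2 hx.2.1,
      kempeFlip_branch_of_notMem hag' hu' hm'.2 hx.2.2, hag x hx.1]
  have h4 : ((insert v (branch G σ v u ∪ branch G τ v u)).card : ℝ) + 1 ≤
      (branch G σ v u).card + (branch G τ v u).card + 1 := by
    have h5 := card_insert_le v (branch G σ v u ∪ branch G τ v u)
    have h6 := card_union_add_card_inter (branch G σ v u) (branch G τ v u)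
    have h7 : 0 < (branch G σ v u ∩ branch G τ v u).card :=
      card_pos.2 ⟨u, mem_inter.2 ⟨self_mem_branch _ _ _, self_mem_branch _ _ _⟩⟩
    exact_mod_cast (by omega : (insert v (branch G σ v u ∪ branch G τ v u)).card + 1 ≤
      (branch G σ v u).card + (branch G τ v u).card + 1)
  have h8 := hf _ _ hm'.2.2 hm.2.2
  have h9 := hf _ _ hσ hτ
  have h10 : (hammCol σ τ : ℝ) ≤ 1 := by
    have : hammCol σ τ ≤ ({v} : Finset V).card :=
      hammCol_le_card fun x hx => hag x (by simpa using hx)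
    exact_mod_cast this
  simp only [Pi.neg_apply]
  linarith

omit hσ hτ hf in
lemma branchMovable_of_large (hσ : ListRespecting L σ) (hτ : ListRespecting L τ)
    (he' : e ≠ τ v) (hab : σ v ≠ τ v) (hF : ListRespecting L (kempeFlip G σ v e)) {u : V}
    (hu : u ∈ branchReps G σ v e) :
    BranchMovable G L σ τ v u := by
  have huN := branchReps_subset σ v e hu
  have huv : u ≠ v := (mem_colorNbrs.1 huN).1.ne'
  have hv : v ∉ kempeComp G univ τ u (σ v) := by
    intro h
    rcases color_of_mem_kempeComp h with h | h
    · rw [← hag u huv, (mem_colorNbrs.1 huN).2] at h; exact he' h.symm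
    · exact hab h.symm
  rw [branchMovable_iff hag he hτ huN hv]
  exact ((listRespecting_large_iff hag he hσ).1 hF).2 u hu

end Gains

section Groups

variable {V : Type*} [Fintype V] [DecidableEq V] {q : ℕ} (G : SimpleGraph V)

/-- The total excess distance caused by the unmatched flips around `v` that involve the color
`e`. -/
noncomputable def groupGain (L : V → Finset (Fin q)) (ω : V → ℝ) (f : (V → Fin q) → ℝ)
    (σ τ : V → Fin q) (v : V) (e : Fin q) : ℝ :=
  largeWeight G L ω σ v e * largeGain G L f σ τ v e +
    ∑ u ∈ colorNbrs G σ v e, flipParam (branchSize G σ v e u) *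
      branchWeight G L ω σ τ v e u * branchGain G L f σ τ v e u

/-- The number of neighbors of `u`, other than `v`, that have one of the two colors of `v`. -/
noncomputable def spoilCount (σ τ : V → Fin q) (v u : V) : ℕ :=
  (univ.filter fun w => G.Adj u w ∧ w ≠ v ∧ (σ w = σ v ∨ σ w = τ v)).card

variable {G} {L : V → Finset (Fin q)} {ω : V → ℝ} {f : (V → Fin q) → ℝ} {σ τ : V → Fin q} {v : V}
  {e : Fin q}

lemma branch_subset_singleton {u : V}
    (h : ∀ w, G.Adj u w → w ≠ v → σ w ≠ σ v) : branch G σ v u ⊆ {u} := by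
  intro x hx
  rcases (mem_branch.1 hx).cases_head with h' | ⟨y, h', -⟩
  · simp [h']
  · obtain ⟨-, h2, h3, -, h5, h6⟩ := h'
    rcases h5 with h5 | h5
    · exact absurd h5.symm h6
    · exact absurd h5 (h y h3 (ne_of_mem_erase h2))

lemma branchSize_eq_one {u : V} (hu : u ∈ colorNbrs G σ v e)
    (h : ∀ w, G.Adj u w → w ≠ v → σ w ≠ σ v) : branchSize G σ v e u = 1 := by
  have hs := branch_subset_singleton h
  have hs' : branch G σ v u = {u} :=
    subset_antisymm hs (singleton_subset_iff.2 (self_mem_branch _ _ _))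
  obtain ⟨r, hr, hru⟩ := exists_rep hu
  have : r ∈ branch G σ v u := hru ▸ self_mem_branch σ v r
  rw [hs', mem_singleton] at this
  subst this
  rw [branchSize_of_rep hr, hs', card_singleton]

lemma exists_le_branchSize {u : V} (hu : u ∈ colorNbrs G σ v e) (he : e ≠ σ v) :
    ∃ r ∈ colorNbrs G σ v e,
      (univ.filter fun w => G.Adj u w ∧ w ≠ v ∧ σ w = σ v).card + 1 ≤ branchSize G σ v e r := by
  obtain ⟨r, hr, hru⟩ := exists_rep hu
  obtain ⟨hadj, hue⟩ := mem_colorNbrs.1 hu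
  refine ⟨r, branchReps_subset σ v e hr, ?_⟩
  rw [branchSize_of_rep hr, hru]
  set S := univ.filter fun w => G.Adj u w ∧ w ≠ v ∧ σ w = σ v
  have huS : u ∉ S := by simp [S]
  rw [← card_insert_of_notMem huS]
  refine card_le_card fun x hx => ?_
  rcases mem_insert.1 hx with rfl | hx
  · exact self_mem_branch _ _ _
  · obtain ⟨-, h1, h2, h3⟩ := mem_filter.1 hx
    refine mem_branch.2 (.single ⟨mem_erase.2 ⟨hadj.ne', mem_univ _⟩,
      mem_erase.2 ⟨h2, mem_univ _⟩, h1, .inl rfl, .inr h3, ?_⟩)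
    rw [hue, h3]; exact he

lemma flipSide_of_pair (hag : ∀ u, u ≠ v → σ u = τ u) (hab : σ v ≠ τ v) (he : e ≠ σ v)
    (he' : e ≠ τ v) (hσ : ListRespecting L σ) (hτ : ListRespecting L τ)
    (hf : ∀ x y, ListRespecting L x → ListRespecting L y → f x - f y ≤ hammCol x y)
    (hω : ∀ z, 0 ≤ ω z ∧ ω z ≤ 1) :
    FlipSide (colorNbrs G σ v e) (ω v) (e ∈ L v) (ListRespecting L (kempeFlip G σ v e))
      (branchSize G σ v e) (branchWeight G L ω σ τ v e) (largeWeight G L ω σ v e)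
      (largeGain G L f σ τ v e) (branchGain G L f σ τ v e) where
  weight_mem i _ := branchWeight_mem hω σ τ v e i
  large_le := by simpa [he'] using largeGain_le (G := G) hag he hσ hτ hf
  small_le i hi := branchGain_le hag he hσ hτ hf hi
  add_le i hi := by simpa [he'] using largeGain_add_branchGain_le (G := G) hag he hσ hτ hf hi
  weight_large hF := by
    refine ⟨((listRespecting_large_iff hag he hσ).1 hF).1, ?_⟩
    rw [largeWeight_eq hag he hF]
    congr 2
    refine sum_congr rfl fun u hu => ?_
    by_cases hr : u ∈ branchReps G σ v e
    · have hpos : (0 : ℝ) < (branch G σ v u).card := by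
        exact_mod_cast card_pos.2 ⟨u, self_mem_branch σ v u⟩
      rw [branchWeight, if_pos hr, branchSize_of_rep hr,
        if_pos ⟨hr, branchMovable_of_large hag he hσ hτ he' hab hF hr⟩, mul_div_cancel₀ _ hpos.ne']
    · simp [branchSize, hr]
  weight_large' hF := ⟨largeWeight_of_not hag he hF, fun hev =>
    exists_branch_not_movable hag he hσ hτ hev hF⟩

lemma neg_lipschitz (hf : ∀ x y, ListRespecting L x → ListRespecting L y →
    f x - f y ≤ hammCol x y) (x y : V → Fin q) (hx : ListRespecting L x)
    (hy : ListRespecting L y) : (-f) x - (-f) y ≤ hammCol x y := by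
  have := hf y x hy hx
  rw [show hammCol y x = hammCol x y by simp only [hammCol, ne_comm]] at this
  simp only [Pi.neg_apply]; linarith

/-- The bound for the moves involving a color that neither coloring uses at `v`. -/
lemma groupGain_pair_le (hag : ∀ u, u ≠ v → σ u = τ u) (hab : σ v ≠ τ v) (he : e ≠ σ v)
    (he' : e ≠ τ v) (hσ : ListRespecting L σ) (hτ : ListRespecting L τ)
    (hf : ∀ x y, ListRespecting L x → ListRespecting L y → f x - f y ≤ hammCol x y)
    (hω : ∀ z, 0 ≤ ω z ∧ ω z ≤ 1) (hN : (colorNbrs G σ v e).Nonempty) :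
    groupGain G L ω f σ τ v e + groupGain G L ω (-f) τ σ v e + (if e ∈ L v then ω v else 0) ≤
      11 / 6 * (colorNbrs G σ v e).card -
        (1 / 200) * ((colorNbrs G σ v e).filter
          fun u => spoilCount G σ τ v u = 0 ∨ 10 < spoilCount G σ τ v u).card := by
  have hag' : ∀ u, u ≠ v → τ u = σ u := fun u h => (hag u h).symm
  have hNN : colorNbrs G τ v e = colorNbrs G σ v e := (colorNbrs_congr hag).symm
  have h := flipSide_of_pair (G := G) hag hab he he' hσ hτ hf hω
  have h' := flipSide_of_pair (G := G) hag' hab.symm he' he hτ hσ (neg_lipschitz hf) hω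
  rw [hNN] at h'
  have key := h.pair_total_le h' (hω v)
    (fun i hi => branchGain_add_branchGain_le hag he hσ hτ hf he' hi) ?_ ?_ hN
  · simp only [groupGain, hNN]
    refine (le_of_eq_of_le (by congr!) key).trans (sub_le_sub_left ?_ _)
    set T := (colorNbrs G σ v e).filter
      fun u => spoilCount G σ τ v u = 0 ∨ 10 < spoilCount G σ τ v u
    rcases T.eq_empty_or_nonempty with hT | ⟨u, hu⟩
    · rw [hT]; simp only [card_empty, Nat.cast_zero, mul_zero]
      split_ifs <;> positivity
    · rw [if_pos]
      · have : (T.card : ℝ) ≤ (colorNbrs G σ v e).card := by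
          exact_mod_cast card_le_card (filter_subset _ _)
        linarith
      · obtain ⟨huN, hu⟩ := mem_filter.1 hu
        rcases hu with hu | hu
        · rw [spoilCount, card_eq_zero, filter_eq_empty_iff] at hu
          have huτ : u ∈ colorNbrs G τ v e := hNN ▸ huN
          refine ⟨u, huN, .inl ⟨branchSize_eq_one huN fun w h1 h2 h3 =>
            hu (mem_univ w) ⟨h1, h2, .inl h3⟩, branchSize_eq_one huτ fun w h1 h2 h3 =>
            hu (mem_univ w) ⟨h1, h2, .inr ?_⟩⟩⟩
          rw [hag w h2, h3]
        · obtain ⟨r, hr, hr'⟩ := exists_le_branchSize huN he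
          obtain ⟨r₂, hr₂, hr₂'⟩ := exists_le_branchSize (G := G) (hNN.symm ▸ huN) he'
          have hle : spoilCount G σ τ v u ≤
              (univ.filter fun w => G.Adj u w ∧ w ≠ v ∧ σ w = σ v).card +
              (univ.filter fun w => G.Adj u w ∧ w ≠ v ∧ τ w = τ v).card := by
            refine (card_le_card fun w hw => ?_).trans (card_union_le _ _)
            obtain ⟨-, h1, h2, h3⟩ := mem_filter.1 hw
            simp only [mem_union, mem_filter, mem_univ, true_and, h1, h2, ne_eq, not_false_eq_true]
            rwa [← hag w h2]
          rcases le_or_gt 7 (branchSize G σ v e r) with h7 | h7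
          · exact ⟨r, hr, .inr (.inl h7)⟩
          · exact ⟨r₂, hNN ▸ hr₂, .inr (.inr (by omega))⟩
  · intro hF hF' i hi h1 h2
    have hr : ∀ {ρ : V → Fin q}, branchSize G ρ v e i = 1 →
        i ∈ branchReps G ρ v e ∧ branch G ρ v i = {i} := by
      intro ρ h
      have hr : i ∈ branchReps G ρ v e := by
        by_contra hr
        simp [branchSize, hr] at h
      rw [branchSize_of_rep hr] at h
      obtain ⟨x, hx⟩ := card_eq_one.1 h
      have : i ∈ branch G ρ v i := self_mem_branch _ _ _
      rw [hx, mem_singleton] at this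
      exact ⟨hr, by rw [hx, this]⟩
    obtain ⟨hr1, hb1⟩ := hr h1
    obtain ⟨hr2, hb2⟩ := hr h2
    rw [branchWeight, branchWeight, hb1, hb2,
      if_pos ⟨hr1, branchMovable_of_large hag he hσ hτ he' hab hF hr1⟩,
      if_pos ⟨hr2, branchMovable_of_large hag' he' hτ hσ he hab.symm hF' hr2⟩]
  · intro h1 i hi
    have hone : ∀ {ρ : V → Fin q}, colorNbrs G ρ v e = colorNbrs G σ v e →
        1 ≤ branchSize G ρ v e i := by
      intro ρ hρ
      obtain ⟨r, hr, -⟩ := exists_rep (hρ ▸ hi)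
      have : r = i := by
        have hr' := branchReps_subset ρ v e hr
        rw [hρ] at hr'
        exact card_le_one.1 h1.le r hr' i hi
      subst this
      rw [branchSize_of_rep hr]
      exact card_pos.2 ⟨r, self_mem_branch _ _ _⟩
    exact ⟨hone rfl, hone hNN⟩

/-- The bound for the moves of `σ` involving the color of the other coloring at `v`. -/
lemma groupGain_opposite_le (hag : ∀ u, u ≠ v → σ u = τ u) (hab : σ v ≠ τ v)
    (hσ : ListRespecting L σ) (hτ : ListRespecting L τ)
    (hf : ∀ x y, ListRespecting L x → ListRespecting L y → f x - f y ≤ hammCol x y)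
    (hω : ∀ z, 0 ≤ ω z ∧ ω z ≤ 1) :
    groupGain G L ω f σ τ v (τ v) + ω v ≤ 11 / 6 * (colorNbrs G σ v (τ v)).card -
      (1 / 200) * (colorNbrs G σ v (τ v)).card := by
  have he : τ v ≠ σ v := hab.symm
  rcases (colorNbrs G σ v (τ v)).eq_empty_or_nonempty with hN | hN
  · have hK : kempeComp G univ σ v (τ v) = {v} := by
      rw [kempeComp_eq_insert_biUnion he, hN]; simp
    have hflip : kempeFlip G σ v (τ v) = τ := by
      ext x
      by_cases hx : x = v
      · rw [hx, kempeFlip_self]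
      · rw [kempeFlip_of_notMem (by rw [hK]; simpa using hx), hag x hx]
    simp [groupGain, hN, largeWeight, largeGain, moveRate, hflip, hτ, hK, he, flipParam]
  · have := opposite_color_le (I := colorNbrs G σ v (τ v)) (a := branchSize G σ v (τ v))
      (W := branchWeight G L ω σ τ v (τ v)) (w := ω v) (xA := largeWeight G L ω σ v (τ v))
      (α := largeGain G L f σ τ v (τ v)) (s := branchGain G L f σ τ v (τ v))
      (fun i _ => branchWeight_mem hω σ τ v (τ v) i) (hω v)
      (by simpa using largeGain_le (G := G) hag he hσ hτ hf)
      (fun i hi => branchGain_le hag he hσ hτ hf hi)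
      (fun i hi => by simpa using largeGain_add_branchGain_le (G := G) hag he hσ hτ hf hi) ?_ ?_ hN
    · unfold groupGain; linarith
    · rw [← card_kempeComp_eq he]
      exact largeWeight_mem hω σ v (τ v)
    · by_cases hF : ListRespecting L (kempeFlip G σ v (τ v))
      · left
        intro i hi
        rw [largeWeight_eq hag he hF]
        refine mul_le_mul_of_nonneg_left ?_ (flipParam_div_mem _).1
        refine (branchSize_mul_branchWeight_le hω σ τ v (τ v) i).trans ?_
        have := single_le_sum (f := fun u => if u ∈ branchReps G σ v (τ v) then
          ∑ z ∈ branch G σ v u, ω z else 0) (fun u _ => by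
            split_ifs
            · exact sum_nonneg fun z _ => (hω z).1
            · exact le_rfl) hi
        have := (hω v).1
        linarith
      · exact .inr (exists_branch_not_movable hag he hσ hτ (hτ v) hF)

end Groups

section Touched

variable {V : Type*} [Fintype V] [DecidableEq V] {q : ℕ} (G : SimpleGraph V)

/-- The move `(z, c)` concerns the vertex `v` in one of the two colorings. -/
def Touched (σ τ : V → Fin q) (v z : V) (c : Fin q) : Prop :=
  v ∈ kempeComp G univ σ z c ∨ v ∈ kempeComp G univ τ z c

variable {G} {L : V → Finset (Fin q)} {ω : V → ℝ} {f : (V → Fin q) → ℝ} {σ τ : V → Fin q} {v : V}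

lemma kempeComp_subset_of_notMem (hag : ∀ u, u ≠ v → σ u = τ u) {z : V} {c : Fin q}
    (hv : v ∉ kempeComp G univ σ z c) : kempeComp G univ σ z c ⊆ kempeComp G univ τ z c := by
  intro x hx
  rw [mem_kempeComp] at hx
  induction hx with
  | refl => exact self_mem_kempeComp _ _ _
  | @tail w w' hw h ih =>
    have hwv : w ≠ v := by rintro rfl; exact hv (mem_kempeComp.2 hw)
    have hwv' : w' ≠ v := by rintro rfl; exact hv (mem_kempeComp.2 (hw.tail h))
    have hzv : z ≠ v := by rintro rfl; exact hv (self_mem_kempeComp _ _ _)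
    unfold kempeStep at h
    rw [hag w hwv, hag w' hwv', hag z hzv] at h
    exact mem_kempeComp.2 ((mem_kempeComp.1 ih).tail h)

section Untouched

variable (hag : ∀ u, u ≠ v → σ u = τ u) {z : V} {c : Fin q} (h : ¬ Touched G σ τ v z c)
include hag h

lemma ne_of_not_touched : z ≠ v := by
  rintro rfl; exact h (.inl (self_mem_kempeComp _ _ _))

lemma kempeComp_eq_of_not_touched : kempeComp G univ σ z c = kempeComp G univ τ z c :=
  subset_antisymm (kempeComp_subset_of_notMem hag fun h' => h (.inl h'))
    (kempeComp_subset_of_notMem (fun u hu => (hag u hu).symm) fun h' => h (.inr h'))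

lemma kempeFlip_eq_of_not_touched {u : V} (hu : u ≠ v) :
    kempeFlip G σ z c u = kempeFlip G τ z c u := by
  unfold kempeFlip flipConf
  rw [kempeComp_eq_of_not_touched hag h, hag z (ne_of_not_touched hag h), hag u hu]

lemma kempeFlip_apply_of_not_touched :
    kempeFlip G σ z c v = σ v ∧ kempeFlip G τ z c v = τ v :=
  ⟨kempeFlip_of_notMem fun h' => h (.inl h'), kempeFlip_of_notMem fun h' => h (.inr h')⟩

lemma moveRate_eq_of_not_touched (hσ : ListRespecting L σ) (hτ : ListRespecting L τ) :
    moveRate G L σ z c = moveRate G L τ z c := by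
  have hiff : ListRespecting L (kempeFlip G σ z c) ↔ ListRespecting L (kempeFlip G τ z c) := by
    refine forall_congr' fun u => ?_
    by_cases hu : u = v
    · rw [hu, (kempeFlip_apply_of_not_touched hag h).1, (kempeFlip_apply_of_not_touched hag h).2]
      exact iff_of_true (hσ v) (hτ v)
    · rw [kempeFlip_eq_of_not_touched hag h hu]
  unfold moveRate
  rw [kempeComp_eq_of_not_touched hag h, hag z (ne_of_not_touched hag h)]
  simp only [hiff]

end Untouched

lemma moveRate_le_of_two_mem {z x y : V} {c : Fin q} (hx : x ∈ kempeComp G univ σ z c)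
    (hy : y ∈ kempeComp G univ σ z c) (hxy : x ≠ y) : moveRate G L σ z c ≤ 3 / 20 := by
  unfold moveRate; split_ifs
  · exact flipParam_div_le (one_lt_card.2 ⟨x, hx, y, hy, hxy⟩)
  · norm_num

/-- A component of `σ` that reaches `v` through another vertex is nontrivial in `τ` as well. -/
lemma exists_mem_kempeComp_ne (hag : ∀ u, u ≠ v → σ u = τ u) {z : V} {c : Fin q} (hz : z ≠ v)
    (hc : c ≠ σ v) (h : v ∈ kempeComp G univ σ z c) : ∃ y ∈ kempeComp G univ τ z c, y ≠ z := by
  have hzv : σ z = σ v := by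
    rcases color_of_mem_kempeComp h with h | h
    · exact h.symm
    · exact absurd h.symm hc
  rcases (mem_kempeComp.1 h).cases_head with h' | ⟨y, h', -⟩
  · exact absurd h' hz
  · obtain ⟨-, -, h3, -, h5, h6⟩ := h'
    have hyc : σ y = c := h5.resolve_left fun h => h6 h.symm
    have hyv : y ≠ v := by rintro rfl; exact hc hyc.symm
    refine ⟨y, mem_kempeComp.2 (.single ⟨mem_univ _, mem_univ _, h3, .inl rfl, ?_, ?_⟩), h3.ne'⟩
    · rw [← hag y hyv]; exact .inr hyc
    · rw [← hag y hyv, ← hag z hz]; exact h6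

variable (G) in
/-- The colors with which `v` can be recolored on its own. -/
noncomputable def freeColors (L : V → Finset (Fin q)) (σ τ : V → Fin q) (v : V) : Finset (Fin q) :=
  (L v).filter fun c => c ≠ σ v ∧ c ≠ τ v ∧ colorNbrs G σ v c = ∅

lemma sum_rates_at (hag : ∀ u, u ≠ v → σ u = τ u) :
    ∑ c, (if Touched G σ τ v v c then moveRate G L σ v c + moveRate G L τ v c
      else moveRate G L σ v c) ≤ (L v).card + (freeColors G L σ τ v).card := by
  have hN : ∀ c, colorNbrs G σ v c = colorNbrs G τ v c := fun c => colorNbrs_congr hag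
  have hpt : ∀ c, (if Touched G σ τ v v c then moveRate G L σ v c + moveRate G L τ v c
      else moveRate G L σ v c) ≤
      (if c ∈ L v then (1 : ℝ) else 0) + (if c ∈ freeColors G L σ τ v then (1 : ℝ) else 0) := by
    intro c
    rw [if_pos (.inl (self_mem_kempeComp _ _ _))]
    have h1 := moveRate_le_one (G := G) L σ v c
    have h2 := moveRate_le_one (G := G) L τ v c
    have hf : (0 : ℝ) ≤ if c ∈ freeColors G L σ τ v then (1 : ℝ) else 0 := by
      split_ifs <;> norm_num
    by_cases hL : c ∈ L v
    swap
    · rw [moveRate_of_notMem σ hL, moveRate_of_notMem τ hL, if_neg hL]; linarith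
    rw [if_pos hL]
    by_cases ha : c = σ v
    · rw [moveRate_own σ ha]; linarith
    by_cases hb : c = τ v
    · rw [moveRate_own τ hb]; linarith
    by_cases hE : colorNbrs G σ v c = ∅
    · rw [if_pos (show c ∈ freeColors G L σ τ v from mem_filter.2 ⟨hL, ha, hb, hE⟩)]; linarith
    · obtain ⟨u, hu⟩ := nonempty_iff_ne_empty.2 hE
      have huv : u ≠ v := (mem_colorNbrs.1 hu).1.ne'
      have hmem : ∀ {ρ : V → Fin q}, c ≠ ρ v → u ∈ colorNbrs G ρ v c →
          moveRate G L ρ v c ≤ 3 / 20 := by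
        intro ρ hc hu
        refine moveRate_le_of_two_mem (self_mem_kempeComp ρ v c) (y := u) ?_ huv.symm
        rw [kempeComp_eq_insert_biUnion hc]
        exact mem_insert_of_mem (mem_biUnion.2 ⟨u, hu, self_mem_branch _ _ _⟩)
      have := hmem ha hu
      have := hmem hb (hN c ▸ hu)
      linarith
  refine (sum_le_sum fun c _ => hpt c).trans_eq ?_
  rw [sum_add_distrib]; simp

lemma sum_rates_off (hag : ∀ u, u ≠ v → σ u = τ u) (hσ : ListRespecting L σ) {z : V}
    (hz : z ≠ v) :
    ∑ c, (if Touched G σ τ v z c then moveRate G L σ z c + moveRate G L τ z c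
      else moveRate G L σ z c) ≤ (L z).card := by
  have hag' : ∀ u, u ≠ v → τ u = σ u := fun u h => (hag u h).symm
  have hpt : ∀ c, (if Touched G σ τ v z c then moveRate G L σ z c + moveRate G L τ z c
      else moveRate G L σ z c) ≤
      (if c ∈ (L z).erase (σ z) then (1 : ℝ) else 0) + ((if c = σ v then 3 / 20 else 0) +
        (if c = τ v then 3 / 20 else 0)) := by
    intro c
    have hx1 : (0 : ℝ) ≤ if c = σ v then 3 / 20 else 0 := by split_ifs <;> norm_num
    have hx2 : (0 : ℝ) ≤ if c = τ v then 3 / 20 else 0 := by split_ifs <;> norm_num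
    by_cases hL : c ∈ (L z).erase (σ z)
    swap
    · have h0 : moveRate G L σ z c = 0 ∧ moveRate G L τ z c = 0 := by
        rw [mem_erase, not_and_or, not_not] at hL
        rcases hL with hL | hL
        · exact ⟨moveRate_own σ hL, moveRate_own τ (by rw [hL, hag z hz])⟩
        · exact ⟨moveRate_of_notMem σ hL, moveRate_of_notMem τ hL⟩
      rw [h0.1, h0.2, if_neg hL]
      split_ifs <;> norm_num
    rw [if_pos hL]
    have h1 := moveRate_le_one (G := G) L σ z c
    have h2 := moveRate_le_one (G := G) L τ z c
    by_cases hT : Touched G σ τ v z c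
    swap
    · rw [if_neg hT]; linarith
    rw [if_pos hT]
    by_cases hP : v ∈ kempeComp G univ σ z c
    · have h3 := moveRate_le_of_two_mem (L := L) hP (self_mem_kempeComp σ z c) hz.symm
      by_cases hc : c = σ v
      · simp only [hc, if_true] at *; linarith
      · obtain ⟨y, hy, hyz⟩ := exists_mem_kempeComp_ne hag hz hc hP
        have := moveRate_le_of_two_mem (L := L) hy (self_mem_kempeComp τ z c) hyz
        linarith
    · have hQ := hT.resolve_left hP
      have h3 := moveRate_le_of_two_mem (L := L) hQ (self_mem_kempeComp τ z c) hz.symm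
      by_cases hc : c = τ v
      · simp only [hc, if_true] at *; linarith
      · obtain ⟨y, hy, hyz⟩ := exists_mem_kempeComp_ne hag' hz hc hQ
        have := moveRate_le_of_two_mem (L := L) hy (self_mem_kempeComp σ z c) hyz
        linarith
  refine (sum_le_sum fun c _ => hpt c).trans ?_
  rw [sum_add_distrib, sum_add_distrib, sum_ite_eq', sum_ite_eq', if_pos (mem_univ _),
    if_pos (mem_univ _)]
  have hc := card_erase_add_one (hσ z)
  have : ((L z).card : ℝ) = ((L z).erase (σ z)).card + 1 := by exact_mod_cast hc.symm
  rw [this]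
  simp only [sum_ite_mem, univ_inter, sum_const, nsmul_eq_mul, mul_one]
  linarith

/-- The payoff of the moves touching `v` in `σ`, grouped by the color involved. -/
lemma sum_touched_eq (hag : ∀ u, u ≠ v → σ u = τ u) (h₁ h₂ : (V → Fin q) → ℝ) :
    ∑ z, ∑ c, (if v ∈ kempeComp G univ σ z c then
      (ω z * moveRate G L σ z c * h₁ (kempeFlip G σ z c) +
        if v ∈ kempeComp G univ τ z c then 0 else
          ω z * moveRate G L τ z c * h₂ (kempeFlip G τ z c)) else 0) =
    ∑ e ∈ univ.erase (σ v), (largeWeight G L ω σ v e * h₁ (kempeFlip G σ v e) +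
      ∑ u ∈ colorNbrs G σ v e, flipParam (branchSize G σ v e u) *
        branchWeight G L ω σ τ v e u * h₂ (kempeFlip G τ u (σ v))) := by
  rw [sum_mem_kempeComp σ v (fun z c => ω z * moveRate G L σ z c * h₁ (kempeFlip G σ z c) +
    if v ∈ kempeComp G univ τ z c then 0 else
      ω z * moveRate G L τ z c * h₂ (kempeFlip G τ z c)),
    ← add_sum_erase univ _ (mem_univ (σ v)), kempeComp_own, sum_singleton]
  simp only [self_mem_kempeComp, if_true]
  rw [moveRate_own σ (by simp [otherColor]), mul_zero, zero_mul, add_zero, zero_add]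
  exact sum_congr rfl fun e he => sum_component_eq hag (ne_of_mem_erase he) h₁ h₂

lemma groupGain_eq (hag : ∀ u, u ≠ v → σ u = τ u) {e : Fin q} (he : e ≠ σ v) :
    groupGain G L ω f σ τ v e =
      largeWeight G L ω σ v e * (f (kempeFlip G σ v e) - f τ - 1) +
      ∑ u ∈ colorNbrs G σ v e, flipParam (branchSize G σ v e u) *
        branchWeight G L ω σ τ v e u * (f σ - f (kempeFlip G τ u (σ v)) - 1) := by
  unfold groupGain
  congr 1
  · by_cases hF : ListRespecting L (kempeFlip G σ v e)
    · rw [largeGain, if_pos hF]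
    · rw [largeWeight_of_not hag he hF]; ring
  · refine sum_congr rfl fun u _ => ?_
    by_cases hm : u ∈ branchReps G σ v e ∧ BranchMovable G L σ τ v u
    · rw [branchGain, if_pos hm]
    · rw [branchWeight, if_neg hm]; ring

end Touched

section Total

variable {V : Type*} [Fintype V] [DecidableEq V] {q : ℕ} {G : SimpleGraph V}
  {L : V → Finset (Fin q)} {ω : V → ℝ} {f : (V → Fin q) → ℝ} {σ τ : V → Fin q} {v : V}

lemma sum_card_filter_colorNbrs (σ : V → Fin q) (v : V) (p : V → Prop) :
    ∑ e, (((colorNbrs G σ v e).filter p).card : ℝ) =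
      (univ.filter fun u => G.Adj v u ∧ p u).card := by
  rw [card_eq_sum_card_fiberwise (f := σ) (t := univ) (fun _ _ => by simp)]
  push_cast
  refine sum_congr rfl fun e _ => ?_
  congr 2
  ext u
  simp only [mem_filter, mem_colorNbrs, mem_univ, true_and]
  tauto

lemma sum_card_colorNbrs (σ : V → Fin q) (v : V) :
    ∑ e, ((colorNbrs G σ v e).card : ℝ) = (univ.filter fun u => G.Adj v u).card := by
  have := sum_card_filter_colorNbrs (G := G) σ v (fun _ => True)
  simpa using this

lemma kempeComp_eq_singleton {e : Fin q} (he : e ≠ σ v) (hN : colorNbrs G σ v e = ∅) :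
    kempeComp G univ σ v e = {v} := by
  rw [kempeComp_eq_insert_biUnion he, hN]; simp

lemma largeWeight_eq_of_empty (hσ : ListRespecting L σ) {e : Fin q} (he : e ≠ σ v)
    (hN : colorNbrs G σ v e = ∅) :
    largeWeight G L ω σ v e = if e ∈ L v then ω v else 0 := by
  have hF : ListRespecting L (kempeFlip G σ v e) ↔ e ∈ L v := by
    rw [listRespecting_kempeFlip_iff hσ, kempeComp_eq_singleton he hN]; simp [otherColor]
  unfold largeWeight moveRate
  rw [hF, kempeComp_eq_singleton he hN]
  by_cases h : e ∈ L v <;> simp [h, he, flipParam]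

/-- A neighbor of `v` near which the worst-case bound is not attained. -/
def Nontame (G : SimpleGraph V) (σ τ : V → Fin q) (v u : V) : Prop :=
  σ u = σ v ∨ σ u = τ v ∨ spoilCount G σ τ v u = 0 ∨ 10 < spoilCount G σ τ v u

section

variable (hag : ∀ u, u ≠ v → σ u = τ u) (hab : σ v ≠ τ v)
  (hσ : ListRespecting L σ) (hτ : ListRespecting L τ)
include hag hab hσ hτ

lemma groupGain_add_of_empty {e : Fin q} (he : e ≠ σ v) (he' : e ≠ τ v)
    (hN : colorNbrs G σ v e = ∅) :
    groupGain G L ω f σ τ v e + groupGain G L ω (-f) τ σ v e =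
      (if e ∈ L v then ω v else 0) * (f σ - f τ - 2) := by
  have hN' : colorNbrs G τ v e = ∅ := colorNbrs_congr hag ▸ hN
  have hflip : kempeFlip G σ v e = kempeFlip G τ v e := by
    ext x
    by_cases hx : x = v
    · rw [hx, kempeFlip_self, kempeFlip_self]
    · rw [kempeFlip_of_notMem (by simpa [kempeComp_eq_singleton he hN] using hx),
        kempeFlip_of_notMem (by simpa [kempeComp_eq_singleton he' hN'] using hx), hag x hx]
  rw [groupGain_eq hag he, groupGain_eq (fun u hu => (hag u hu).symm) he',
    largeWeight_eq_of_empty hσ he hN, largeWeight_eq_of_empty hτ he' hN', hN, hN', hflip]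
  simp only [sum_empty, Pi.neg_apply]
  ring

variable (hf : ∀ x y, ListRespecting L x → ListRespecting L y → f x - f y ≤ hammCol x y)
  (hω : ∀ z, 0 ≤ ω z ∧ ω z ≤ 1)
include hf hω

lemma sum_groupGain_le :
    ∑ e ∈ univ.erase (σ v), groupGain G L ω f σ τ v e +
      ∑ e ∈ univ.erase (τ v), groupGain G L ω (-f) τ σ v e ≤
    11 / 6 * (univ.filter fun u => G.Adj v u).card -
      (1 / 200) * (univ.filter fun u => G.Adj v u ∧ Nontame G σ τ v u).card -
      ω v * (L v).card - (1 - (f σ - f τ)) * (ω v * (freeColors G L σ τ v).card) := by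
  have hag' : ∀ u, u ≠ v → τ u = σ u := fun u h => (hag u h).symm
  have hcard : ∀ e, (((colorNbrs G σ v e).filter (Nontame G σ τ v)).card : ℝ) ≤
      (colorNbrs G σ v e).card := fun e => by exact_mod_cast card_le_card (filter_subset _ _)
  have hpt : ∀ e, (if e ∈ univ.erase (σ v) then groupGain G L ω f σ τ v e else 0) +
      (if e ∈ univ.erase (τ v) then groupGain G L ω (-f) τ σ v e else 0) ≤
      11 / 6 * (colorNbrs G σ v e).card -
        (1 / 200) * ((colorNbrs G σ v e).filter (Nontame G σ τ v)).card -
        ω v * (if e ∈ L v then 1 else 0) -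
        (1 - (f σ - f τ)) * (ω v * if e ∈ freeColors G L σ τ v then 1 else 0) := by
    intro e
    have hc := hcard e
    by_cases ha : e = σ v
    · have := groupGain_opposite_le (G := G) hag' hab.symm hτ hσ (neg_lipschitz hf) hω
      rw [← ha, ← colorNbrs_congr hag] at this
      have hfree : e ∉ freeColors G L σ τ v := fun h => (mem_filter.1 h).2.1 ha
      rw [if_neg hfree, if_neg (by simp [ha]), if_pos (by simp [ha, hab]),
        if_pos (ha ▸ hσ v)]
      linarith
    by_cases hb : e = τ v
    · have := groupGain_opposite_le (G := G) hag hab hσ hτ hf hω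
      rw [← hb] at this
      have hfree : e ∉ freeColors G L σ τ v := fun h => (mem_filter.1 h).2.2.1 hb
      rw [if_neg hfree, if_pos (by simp [ha]), if_neg (by simp [hb]),
        if_pos (hb ▸ hτ v)]
      linarith
    rw [if_pos (by simp [ha]), if_pos (by simp [hb])]
    rcases (colorNbrs G σ v e).eq_empty_or_nonempty with hN | hN
    · rw [groupGain_add_of_empty hag hab hσ hτ ha hb hN]
      have hfree : e ∈ freeColors G L σ τ v ↔ e ∈ L v := by
        simp [freeColors, ha, hb, hN]
      simp only [hfree, hN]
      by_cases hL : e ∈ L v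
      · simp only [hL, if_true, card_empty, filter_empty]; push_cast; linarith
      · simp [hL]
    · have key := groupGain_pair_le (G := G) hag hab ha hb hσ hτ hf hω hN
      have hfree : e ∉ freeColors G L σ τ v := fun h =>
        hN.ne_empty (mem_filter.1 h).2.2.2
      have hfil : (colorNbrs G σ v e).filter (Nontame G σ τ v) = (colorNbrs G σ v e).filter
          fun u => spoilCount G σ τ v u = 0 ∨ 10 < spoilCount G σ τ v u := by
        refine filter_congr fun u hu => ?_
        rw [Nontame, (mem_colorNbrs.1 hu).2]
        tauto
      rw [if_neg hfree, hfil]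
      by_cases hL : e ∈ L v
      · simp only [hL, if_true] at key ⊢; linarith
      · simp only [hL, if_false] at key ⊢; linarith
  have hsum := sum_le_sum fun e (_ : e ∈ univ) => hpt e
  rw [sum_add_distrib, sum_ite_mem, sum_ite_mem, univ_inter, univ_inter] at hsum
  refine hsum.trans_eq ?_
  rw [sum_sub_distrib, sum_sub_distrib, sum_sub_distrib, ← mul_sum, ← mul_sum, ← mul_sum,
    ← mul_sum, ← mul_sum, sum_card_colorNbrs, sum_card_filter_colorNbrs]
  simp

end

lemma sum_group_rates_le (hσ : ListRespecting L σ) (hω : ∀ z, 0 ≤ ω z ∧ ω z ≤ 1) :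
    ∑ e ∈ univ.erase (σ v), (largeWeight G L ω σ v e * 1 +
      ∑ u ∈ colorNbrs G σ v e, flipParam (branchSize G σ v e u) *
        branchWeight G L ω σ τ v e u * 1) ≤
    2 * (univ.filter fun u => G.Adj v u).card + ω v * (L v).card := by
  have hw : ∀ e, 0 ≤ ω v * (if e ∈ L v then (1 : ℝ) else 0) := fun e => by
    have := (hω v).1
    split_ifs <;> simp [this]
  have hpt : ∀ e ∈ univ.erase (σ v), (largeWeight G L ω σ v e * 1 +
      ∑ u ∈ colorNbrs G σ v e, flipParam (branchSize G σ v e u) *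
        branchWeight G L ω σ τ v e u * 1) ≤
      2 * ((colorNbrs G σ v e).card : ℝ) + ω v * (if e ∈ L v then 1 else 0) := by
    intro e he
    have h1 : ∑ u ∈ colorNbrs G σ v e, flipParam (branchSize G σ v e u) *
        branchWeight G L ω σ τ v e u * 1 ≤ (colorNbrs G σ v e).card * 1 := by
      refine sum_le_card_mul fun u _ => ?_
      have := branchWeight_mem (G := G) (L := L) hω σ τ v e u
      rw [mul_one]
      exact mul_le_one₀ (flipParam_le_one _) this.1 this.2
    have h2 : largeWeight G L ω σ v e ≤ (colorNbrs G σ v e).card +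
        ω v * (if e ∈ L v then 1 else 0) := by
      rcases (colorNbrs G σ v e).eq_empty_or_nonempty with hN | hN
      · rw [largeWeight_eq_of_empty hσ (ne_of_mem_erase he) hN, hN]; simp
      · have h3 := (largeWeight_mem (G := G) (L := L) hω σ v e).2.trans (flipParam_le_one _)
        have h4 : (1 : ℝ) ≤ (colorNbrs G σ v e).card := by exact_mod_cast card_pos.2 hN
        linarith [hw e]
    linarith
  refine (sum_le_sum hpt).trans ((sum_le_sum_of_subset_of_nonneg (erase_subset _ univ)
    fun e _ _ => add_nonneg (by positivity) (hw e)).trans_eq ?_)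
  rw [sum_add_distrib, ← mul_sum, ← mul_sum, sum_card_colorNbrs]
  simp

end Total

section Master

variable {V : Type*} [Fintype V] [DecidableEq V] {q : ℕ} {G : SimpleGraph V}
  {L : V → Finset (Fin q)} {ω : V → ℝ} {f : (V → Fin q) → ℝ} {σ τ : V → Fin q} {v : V}

/-- The payoff of all moves touching `v`, grouped by the color involved. -/
lemma sum_touched_both_eq (hag : ∀ u, u ≠ v → σ u = τ u) (h₁ h₂ : (V → Fin q) → ℝ) :
    ∑ z, ∑ c, (if Touched G σ τ v z c then
      ω z * moveRate G L σ z c * h₁ (kempeFlip G σ z c) +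
        ω z * moveRate G L τ z c * h₂ (kempeFlip G τ z c) else 0) =
    ∑ e ∈ univ.erase (σ v), (largeWeight G L ω σ v e * h₁ (kempeFlip G σ v e) +
      ∑ u ∈ colorNbrs G σ v e, flipParam (branchSize G σ v e u) *
        branchWeight G L ω σ τ v e u * h₂ (kempeFlip G τ u (σ v))) +
    ∑ e ∈ univ.erase (τ v), (largeWeight G L ω τ v e * h₂ (kempeFlip G τ v e) +
      ∑ u ∈ colorNbrs G τ v e, flipParam (branchSize G τ v e u) *
        branchWeight G L ω τ σ v e u * h₁ (kempeFlip G σ u (τ v))) := by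
  rw [← sum_touched_eq hag, ← sum_touched_eq fun u hu => (hag u hu).symm, ← sum_add_distrib]
  refine sum_congr rfl fun z _ => ?_
  rw [← sum_add_distrib]
  refine sum_congr rfl fun c _ => ?_
  unfold Touched
  by_cases h1 : v ∈ kempeComp G univ σ z c <;> by_cases h2 : v ∈ kempeComp G univ τ z c <;>
    simp only [h1, h2, or_true, true_or, or_self, if_true, if_false] <;> ring

/-- The change of `κ n (f σ - f τ)` in one step, compared with the change of a bound `P` for
`f σ - f τ` under the moves that do not touch `v`. -/
lemma flipOp_sub_le (hag : ∀ u, u ≠ v → σ u = τ u) (hab : σ v ≠ τ v)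
    (hσ : ListRespecting L σ) (hτ : ListRespecting L τ)
    (hf : ∀ x y, ListRespecting L x → ListRespecting L y → f x - f y ≤ hammCol x y)
    (hω : ∀ z, 0 ≤ ω z ∧ ω z ≤ 1) {κ P : ℝ} (hκ : ∀ z, ω z * (L z).card = κ)
    (hP : f σ - f τ ≤ P) (hP1 : P ≤ 1) {Q : V → Fin q → ℝ}
    (hQ : ∀ z c, ¬ Touched G σ τ v z c → ListRespecting L (kempeFlip G σ z c) →
      ListRespecting L (kempeFlip G τ z c) →
      f (kempeFlip G σ z c) - f (kempeFlip G τ z c) ≤ Q z c) :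
    κ * Fintype.card V * (flipOp G L f σ - flipOp G L f τ) ≤
      κ * Fintype.card V * P - κ + 11 / 6 * (univ.filter fun u => G.Adj v u).card -
        (1 / 200) * (univ.filter fun u => G.Adj v u ∧ Nontame G σ τ v u).card +
        ∑ z, ∑ c, (if Touched G σ τ v z c then 0 else
          ω z * moveRate G L σ z c * (Q z c - P)) +
        (1 - P) * (4 * (univ.filter fun u => G.Adj v u).card + 2 * κ) := by
  have hag' : ∀ u, u ≠ v → τ u = σ u := fun u h => (hag u h).symm
  have hn : (Fintype.card V : ℝ) ≠ 0 := by
    exact_mod_cast (Fintype.card_pos_iff.2 ⟨v⟩).ne'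
  have hL : ∀ z, ((L z).card : ℝ) ≠ 0 := fun z => by
    exact_mod_cast (card_pos.2 ⟨σ z, hσ z⟩).ne'
  set g := f σ - f τ with hg
  set U := ∑ z, ∑ c, (if Touched G σ τ v z c then 0 else ω z * moveRate G L σ z c) with hU
  set R := ∑ z, ∑ c, (if Touched G σ τ v z c then
    ω z * moveRate G L σ z c + ω z * moveRate G L τ z c else 0) with hR
  set D := ((univ.filter fun u => G.Adj v u).card : ℝ) with hD
  set F := ω v * ((freeColors G L σ τ v).card : ℝ) with hF
  have hF0 : 0 ≤ F := mul_nonneg (hω v).1 (Nat.cast_nonneg _)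
  have hexp : κ * Fintype.card V * (flipOp G L f σ - flipOp G L f τ) =
      κ * Fintype.card V * g + ∑ z, ∑ c, ω z *
        (moveRate G L σ z c * (f (kempeFlip G σ z c) - f σ) -
          moveRate G L τ z c * (f (kempeFlip G τ z c) - f τ)) := by
    have hS : ∀ ρ, κ * ∑ z, ((L z).card : ℝ)⁻¹ *
          ∑ c, moveRate G L ρ z c * (f (kempeFlip G ρ z c) - f ρ) =
        ∑ z, ∑ c, ω z * (moveRate G L ρ z c * (f (kempeFlip G ρ z c) - f ρ)) := by
      intro ρ
      rw [mul_sum]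
      refine sum_congr rfl fun z _ => ?_
      rw [← mul_assoc, ← hκ z, mul_inv_cancel_right₀ (hL z), mul_sum]
    have hρ : ∀ ρ, κ * Fintype.card V * flipOp G L f ρ = κ * Fintype.card V * f ρ +
        ∑ z, ∑ c, ω z * (moveRate G L ρ z c * (f (kempeFlip G ρ z c) - f ρ)) := by
      intro ρ
      rw [← hS, flipOp]
      field_simp
    rw [mul_sub, hρ, hρ, hg]
    simp only [mul_sub, sum_sub_distrib]
    ring
  have hRle : R ≤ 4 * D + 2 * κ := by
    have h := sum_touched_both_eq (G := G) (ω := ω) (L := L) hag (fun _ => 1) (fun _ => 1)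
    simp only [mul_one] at h
    have h1 := sum_group_rates_le (G := G) (τ := τ) (v := v) hσ hω
    have h2 := sum_group_rates_le (G := G) (τ := σ) (v := v) hτ hω
    simp only [mul_one] at h1 h2
    rw [hκ v] at h1 h2
    rw [hR, h]
    linarith
  have hC : U + R ≤ κ * Fintype.card V + F := by
    have hz : ∀ z, ω z * ∑ c, (if Touched G σ τ v z c then moveRate G L σ z c + moveRate G L τ z c
        else moveRate G L σ z c) ≤ κ + if z = v then F else 0 := by
      intro z
      by_cases h : z = v
      · subst h
        rw [if_pos rfl, ← hκ z, hF, ← mul_add]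
        exact mul_le_mul_of_nonneg_left (sum_rates_at hag) (hω z).1
      · rw [if_neg h, ← hκ z, add_zero]
        exact mul_le_mul_of_nonneg_left (sum_rates_off hag hσ h) (hω z).1
    have hs := sum_le_sum fun z (_ : z ∈ univ) => hz z
    rw [sum_add_distrib, sum_ite_eq', if_pos (mem_univ _), sum_const, nsmul_eq_mul, card_univ,
      mul_comm (Fintype.card V : ℝ)] at hs
    refine le_of_eq_of_le ?_ hs
    rw [hU, hR, ← sum_add_distrib]
    refine sum_congr rfl fun z _ => ?_
    rw [← sum_add_distrib, mul_sum]
    refine sum_congr rfl fun c _ => ?_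
    split_ifs <;> ring
  have hT := sum_touched_both_eq (G := G) (ω := ω) (L := L) hag (fun x => f x - f τ - 1)
    (fun x => f σ - f x - 1)
  have hG1 := sum_congr (f := fun e => groupGain G L ω f σ τ v e) rfl
    fun e (he : e ∈ univ.erase (σ v)) => groupGain_eq (G := G) (L := L) (ω := ω) (f := f) hag
      (ne_of_mem_erase he)
  have hG2 := sum_congr (f := fun e => groupGain G L ω (-f) τ σ v e) rfl
    fun e (he : e ∈ univ.erase (τ v)) => groupGain_eq (G := G) (L := L) (ω := ω) (f := -f) hag'
      (ne_of_mem_erase he)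
  simp only [Pi.neg_apply, neg_sub_neg] at hG2
  rw [← hG1, ← hG2] at hT
  have hT0 := sum_groupGain_le (G := G) hag hab hσ hτ hf hω
  rw [← hT, hκ v] at hT0
  have hpt : ∀ z c, ω z * (moveRate G L σ z c * (f (kempeFlip G σ z c) - f σ) -
        moveRate G L τ z c * (f (kempeFlip G τ z c) - f τ)) ≤
      (if Touched G σ τ v z c then 0 else ω z * moveRate G L σ z c * (Q z c - P)) +
      (P - g) * (if Touched G σ τ v z c then 0 else ω z * moveRate G L σ z c) +
      ((if Touched G σ τ v z c then
        ω z * moveRate G L σ z c * (f (kempeFlip G σ z c) - f τ - 1) +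
          ω z * moveRate G L τ z c * (f σ - f (kempeFlip G τ z c) - 1) else 0) +
      (1 - g) * (if Touched G σ τ v z c then
        ω z * moveRate G L σ z c + ω z * moveRate G L τ z c else 0)) := by
    intro z c
    by_cases h : Touched G σ τ v z c
    · simp only [h, if_true, hg]
      exact le_of_eq (by ring)
    · simp only [h, if_false]
      rw [← moveRate_eq_of_not_touched hag h hσ hτ]
      rcases (moveRate_nonneg (G := G) L σ z c).eq_or_lt with h0 | h0
      · simp [← h0]
      have hFσ : ListRespecting L (kempeFlip G σ z c) := by
        by_contra hcon
        rw [moveRate, if_neg fun h => hcon h.2] at h0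
        exact h0.ne rfl
      have hFτ : ListRespecting L (kempeFlip G τ z c) := by
        by_contra hcon
        rw [moveRate_eq_of_not_touched hag h hσ hτ, moveRate, if_neg fun h => hcon h.2] at h0
        exact h0.ne rfl
      have := mul_le_mul_of_nonneg_left (hQ z c h hFσ hFτ) (mul_nonneg (hω z).1 h0.le)
      rw [hg]
      linarith
  have hsum := sum_le_sum fun z (_ : z ∈ univ) => sum_le_sum fun c (_ : c ∈ univ) => hpt z c
  have hU' : ∑ z, ∑ c, (P - g) * (if Touched G σ τ v z c then 0 else
      ω z * moveRate G L σ z c) = (P - g) * U := by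
    simp only [hU, mul_sum]
  have hR' : ∑ z, ∑ c, (1 - g) * (if Touched G σ τ v z c then
      ω z * moveRate G L σ z c + ω z * moveRate G L τ z c else 0) = (1 - g) * R := by
    simp only [hR, mul_sum]
  simp only [sum_add_distrib] at hsum
  rw [hU', hR'] at hsum
  rw [hexp]
  have h1 : (P - g) * (U + R - κ * Fintype.card V - F) ≤ 0 :=
    mul_nonpos_of_nonneg_of_nonpos (by linarith) (by linarith)
  have h2 : (1 - P) * R ≤ (1 - P) * (4 * D + 2 * κ) :=
    mul_le_mul_of_nonneg_left hRle (by linarith)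
  have h3 : 0 ≤ (1 - P) * F := mul_nonneg (by linarith) hF0
  linarith

end Master

section Potential

variable {V : Type*} [Fintype V] [DecidableEq V] {q : ℕ} {G : SimpleGraph V}
  {L : V → Finset (Fin q)} {ω : V → ℝ} {σ τ : V → Fin q} {v u : V}

/-- The bonus granted to a neighbor of the disagreement with `n` spoiling neighbors. -/
noncomputable def bonus (n : ℕ) : ℝ := (1 / 37) ^ n

lemma bonus_pos (n : ℕ) : 0 < bonus n := by unfold bonus; positivity

lemma bonus_le_one (n : ℕ) : bonus n ≤ 1 := pow_le_one₀ (by norm_num) (by norm_num)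

lemma bonus_anti {m n : ℕ} (h : m ≤ n) : bonus n ≤ bonus m :=
  pow_le_pow_of_le_one (by norm_num) (by norm_num) h

lemma bonus_eq_succ (n : ℕ) : bonus n = 37 * bonus (n + 1) := by
  unfold bonus; rw [pow_succ]; ring

/-- The neighbors of `u` other than `v`. -/
noncomputable def otherNbrs (G : SimpleGraph V) (v u : V) : Finset V :=
  univ.filter fun w => G.Adj u w ∧ w ≠ v

lemma spoilCount_eq (σ τ : V → Fin q) (v u : V) :
    spoilCount G σ τ v u = ((otherNbrs G v u).filter fun w => σ w = σ v ∨ σ w = τ v).card := by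
  unfold spoilCount otherNbrs
  rw [filter_filter]
  simp only [and_assoc]

lemma spoilCount_kempeFlip (hag : ∀ u, u ≠ v → σ u = τ u) {z : V} {c : Fin q}
    (h : ¬ Touched G σ τ v z c) (u : V) :
    spoilCount G (kempeFlip G σ z c) (kempeFlip G τ z c) v u =
      ((otherNbrs G v u).filter fun w => kempeFlip G σ z c w = σ v ∨
        kempeFlip G σ z c w = τ v).card := by
  rw [spoilCount_eq, (kempeFlip_apply_of_not_touched hag h).1,
    (kempeFlip_apply_of_not_touched hag h).2]

lemma bonus_sub_le (hag : ∀ u, u ≠ v → σ u = τ u) {z : V} {c : Fin q}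
    (h : ¬ Touched G σ τ v z c) :
    bonus (spoilCount G σ τ v u) -
        bonus (spoilCount G (kempeFlip G σ z c) (kempeFlip G τ z c) v u) ≤
      bonus (spoilCount G σ τ v u) * ∑ w ∈ otherNbrs G v u, ∑ e ∈ {σ v, τ v},
        (if w ∈ kempeComp G univ σ z c ∧ kempeFlip G σ z c w = e then 1 else 0) := by
  have hnn : ∀ w e, (0 : ℝ) ≤
      if w ∈ kempeComp G univ σ z c ∧ kempeFlip G σ z c w = e then 1 else 0 := fun w e => by
    split_ifs <;> norm_num
  have hb := bonus_pos (spoilCount G σ τ v u)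
  rw [spoilCount_kempeFlip hag h]
  rcases le_or_gt ((otherNbrs G v u).filter fun w => kempeFlip G σ z c w = σ v ∨
      kempeFlip G σ z c w = τ v).card (spoilCount G σ τ v u) with hle | hlt
  · have := bonus_anti hle
    have : 0 ≤ bonus (spoilCount G σ τ v u) * ∑ w ∈ otherNbrs G v u, ∑ e ∈ {σ v, τ v},
        (if w ∈ kempeComp G univ σ z c ∧ kempeFlip G σ z c w = e then (1 : ℝ) else 0) :=
      mul_nonneg hb.le (sum_nonneg fun w _ => sum_nonneg fun e _ => hnn w e)
    linarith
  · rw [spoilCount_eq] at hlt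
    obtain ⟨w, hw, hw'⟩ := exists_mem_notMem_of_card_lt_card hlt
    rw [mem_filter] at hw
    have hwK : w ∈ kempeComp G univ σ z c := by
      by_contra hK
      rw [kempeFlip_of_notMem hK] at hw
      exact hw' (mem_filter.2 hw)
    have h1 : (1 : ℝ) ≤ ∑ w ∈ otherNbrs G v u, ∑ e ∈ {σ v, τ v},
        (if w ∈ kempeComp G univ σ z c ∧ kempeFlip G σ z c w = e then 1 else 0) := by
      refine le_trans ?_ (single_le_sum (fun w _ => sum_nonneg fun e _ => hnn w e) hw.1)
      have hmem : kempeFlip G σ z c w ∈ ({σ v, τ v} : Finset (Fin q)) := by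
        simpa using hw.2
      refine le_trans ?_ (single_le_sum (fun e _ => hnn w e) hmem)
      rw [if_pos ⟨hwK, rfl⟩]
    have := bonus_pos ((otherNbrs G v u).filter fun w => kempeFlip G σ z c w = σ v ∨
      kempeFlip G σ z c w = τ v).card
    nlinarith

/-- The expected loss of bonus at `u` caused by moves not touching `v`, given a set `C` of
colors whose assignment to `w` improves the bonus. -/
lemma sum_bonus_le (hag : ∀ u, u ≠ v → σ u = τ u) (hω : ∀ z, 0 ≤ ω z ∧ ω z ≤ 1)
    {w : V} {C : Finset (Fin q)}
    (hC : ∀ c ∈ C, ¬ Touched G σ τ v w c ∧ moveRate G L σ w c = 1 ∧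
      spoilCount G (kempeFlip G σ w c) (kempeFlip G τ w c) v u + 1 = spoilCount G σ τ v u) :
    ∑ z, ∑ c, (if Touched G σ τ v z c then 0 else ω z * moveRate G L σ z c *
      (bonus (spoilCount G σ τ v u) -
        bonus (spoilCount G (kempeFlip G σ z c) (kempeFlip G τ z c) v u))) ≤
    bonus (spoilCount G σ τ v u) * (2 * (otherNbrs G v u).card - 36 * (ω w * C.card)) := by
  set b := bonus (spoilCount G σ τ v u) with hb
  have hb0 : 0 < b := bonus_pos _
  have hpt : ∀ z c, (if Touched G σ τ v z c then 0 else ω z * moveRate G L σ z c *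
      (b - bonus (spoilCount G (kempeFlip G σ z c) (kempeFlip G τ z c) v u))) ≤
      b * (∑ x ∈ otherNbrs G v u, ∑ e ∈ {σ v, τ v},
        (if x ∈ kempeComp G univ σ z c ∧ kempeFlip G σ z c x = e then
          ω z * moveRate G L σ z c else 0) -
        36 * (if z = w then (if c ∈ C then ω w else 0) else 0)) := by
    intro z c
    have hm := mul_nonneg (hω z).1 (moveRate_nonneg (G := G) L σ z c)
    have hnn : 0 ≤ ∑ x ∈ otherNbrs G v u, ∑ e ∈ {σ v, τ v},
        (if x ∈ kempeComp G univ σ z c ∧ kempeFlip G σ z c x = e then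
          ω z * moveRate G L σ z c else 0) :=
      sum_nonneg fun x _ => sum_nonneg fun e _ => by split_ifs <;> simp [hm]
    by_cases hzc : z = w ∧ c ∈ C
    · obtain ⟨rfl, hc⟩ := hzc
      obtain ⟨h1, h2, h3⟩ := hC c hc
      rw [if_neg h1, if_pos rfl, if_pos hc, hb, ← h3]
      rw [hb, ← h3] at hb0
      rw [bonus_eq_succ (spoilCount G (kempeFlip G σ z c) (kempeFlip G τ z c) v u)]
      rw [h2] at hnn ⊢
      nlinarith
    · have h0 : (if z = w then (if c ∈ C then ω w else 0) else 0) = 0 := by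
        by_cases h : z = w
        · rw [if_pos h, if_neg fun h' => hzc ⟨h, h'⟩]
        · rw [if_neg h]
      rw [h0, mul_zero, sub_zero]
      split_ifs with hT
      · exact mul_nonneg hb0.le hnn
      · refine (mul_le_mul_of_nonneg_left (bonus_sub_le hag hT) hm).trans_eq ?_
        rw [← hb, mul_left_comm, mul_sum]
        congr 1
        refine sum_congr rfl fun x _ => ?_
        rw [mul_sum]
        refine sum_congr rfl fun e _ => ?_
        split_ifs <;> simp
  refine (sum_le_sum fun z _ => sum_le_sum fun c _ => hpt z c).trans ?_
  simp only [← mul_sum]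
  refine mul_le_mul_of_nonneg_left ?_ hb0.le
  simp only [sum_sub_distrib]
  have h1 : ∑ z, ∑ c, 36 * (if z = w then (if c ∈ C then ω w else 0) else 0) =
      36 * (ω w * C.card) := by
    simp only [← mul_sum]
    have : ∀ z, ∑ c, (if z = w then (if c ∈ C then ω w else 0) else 0) =
        if z = w then ω w * C.card else 0 := by
      intro z
      by_cases h : z = w
      · simp [h, mul_comm]
      · simp [h]
    simp [this]
  rw [h1]
  have h2 : ∑ z, ∑ c, ∑ x ∈ otherNbrs G v u, ∑ e ∈ {σ v, τ v},
      (if x ∈ kempeComp G univ σ z c ∧ kempeFlip G σ z c x = e then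
        ω z * moveRate G L σ z c else 0) =
      ∑ x ∈ otherNbrs G v u, ∑ e ∈ {σ v, τ v}, ∑ z, ∑ c,
      (if x ∈ kempeComp G univ σ z c ∧ kempeFlip G σ z c x = e then
        ω z * moveRate G L σ z c else 0) := by
    rw [sum_congr rfl fun z _ => sum_comm.trans (sum_congr rfl fun x _ => sum_comm)]
    exact sum_comm.trans (sum_congr rfl fun x _ => sum_comm)
  have h3 : ∑ x ∈ otherNbrs G v u, ∑ e ∈ {σ v, τ v}, ∑ z, ∑ c,
      (if x ∈ kempeComp G univ σ z c ∧ kempeFlip G σ z c x = e then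
        ω z * moveRate G L σ z c else 0) ≤ (otherNbrs G v u).card * (2 : ℝ) := by
    refine sum_le_card_mul fun x _ => ?_
    refine (sum_le_card_mul fun e _ => sum_recolor_rate_le hω).trans ?_
    have : ((({σ v, τ v} : Finset (Fin q)).card : ℕ) : ℝ) ≤ 2 := by exact_mod_cast card_le_two
    linarith
  rw [h2]
  linarith

end Potential

section Contraction

variable {V : Type*} [Fintype V] [DecidableEq V] {q : ℕ} {G : SimpleGraph V}
  {L : V → Finset (Fin q)} {ω : V → ℝ} {f : (V → Fin q) → ℝ} {σ τ : V → Fin q} {v u : V} {d : ℕ}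

/-- Near a spoiled neighbor of `v`, many single-vertex moves improve the bonus. -/
lemma exists_improving_colors (hag : ∀ u, u ≠ v → σ u = τ u) (hσ : ListRespecting L σ)
    (hd : ∀ w, (univ.filter fun x => G.Adj w x).card ≤ d) (hu : spoilCount G σ τ v u ≠ 0) :
    ∃ w, ∃ C : Finset (Fin q), (L w).card ≤ C.card + d + 2 ∧
      ∀ c ∈ C, ¬ Touched G σ τ v w c ∧ moveRate G L σ w c = 1 ∧
        spoilCount G (kempeFlip G σ w c) (kempeFlip G τ w c) v u + 1 = spoilCount G σ τ v u := by
  rw [spoilCount_eq] at hu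
  obtain ⟨w, hw⟩ := card_ne_zero.1 hu
  have hw2 := (mem_filter.1 hw).2
  have hwv : w ≠ v := (mem_filter.1 (mem_filter.1 hw).1).2.2
  refine ⟨w, (L w).filter fun c => c ≠ σ v ∧ c ≠ τ v ∧ colorNbrs G σ w c = ∅, ?_, ?_⟩
  · have hsub : L w ⊆ ((L w).filter fun c => c ≠ σ v ∧ c ≠ τ v ∧ colorNbrs G σ w c = ∅) ∪
        (univ.filter fun x => G.Adj w x).image σ ∪ {σ v, τ v} := by
      intro c hc
      simp only [mem_union, mem_filter, mem_image, mem_univ, true_and, mem_insert, mem_singleton]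
      by_cases h : colorNbrs G σ w c = ∅
      · tauto
      · obtain ⟨x, hx⟩ := nonempty_iff_ne_empty.2 h
        exact .inl (.inr ⟨x, mem_colorNbrs.1 hx⟩)
    have h1 := (card_le_card hsub).trans (card_union_le _ _)
    have h2 := card_union_le ((L w).filter fun c => c ≠ σ v ∧ c ≠ τ v ∧ colorNbrs G σ w c = ∅)
      ((univ.filter fun x => G.Adj w x).image σ)
    have h3 := (card_image_le (s := univ.filter fun x => G.Adj w x) (f := σ)).trans (hd w)
    have h4 : ({σ v, τ v} : Finset (Fin q)).card ≤ 2 := card_le_two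
    omega
  · intro c hc
    obtain ⟨hcL, hca, hcb, hN⟩ := mem_filter.1 hc
    have hcw : c ≠ σ w := by rcases hw2 with h | h <;> rw [h] <;> assumption
    have hK := kempeComp_eq_singleton hcw hN
    have hN' : colorNbrs G τ w c = ∅ := by
      refine eq_empty_of_forall_notMem fun x hx => ?_
      rw [mem_colorNbrs] at hx
      by_cases hxv : x = v
      · exact hcb (hxv ▸ hx.2.symm)
      · exact notMem_empty x (hN ▸ mem_colorNbrs.2 ⟨hx.1, by rw [hag x hxv, hx.2]⟩)
    have hK' := kempeComp_eq_singleton (hag w hwv ▸ hcw) hN'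
    have hT : ¬ Touched G σ τ v w c := by
      rw [Touched, hK, hK', mem_singleton]; simpa using hwv.symm
    refine ⟨hT, ?_, ?_⟩
    · have hF : ListRespecting L (kempeFlip G σ w c) := by
        rw [listRespecting_kempeFlip_iff hσ, hK]; simp [otherColor, hcL]
      rw [moveRate, if_pos ⟨hcw, hF⟩, hK]
      simp [flipParam]
    · rw [spoilCount_kempeFlip hag hT, spoilCount_eq, ← card_erase_add_one hw]
      congr 2
      ext x
      simp only [mem_erase, mem_filter]
      by_cases hx : x = w
      · rw [hx, kempeFlip_self]
        simp [hca, hcb]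
      · rw [kempeFlip_of_notMem (by rw [hK]; simpa using hx)]
        simp [hx]

/-- The length of the edge between two adjacent colorings, extended to all pairs. -/
noncomputable def edgeLength (G : SimpleGraph V) (d : ℕ) (σ τ : V → Fin q) : ℝ :=
  1 - 1 / 10000 * min 1 (∑ v ∈ univ.filter (fun v => σ v ≠ τ v),
    (d : ℝ)⁻¹ * ∑ u ∈ univ.filter (fun u => G.Adj v u), bonus (spoilCount G σ τ v u))

lemma edgeLength_mem (G : SimpleGraph V) (d : ℕ) (σ τ : V → Fin q) :
    1 / 2 ≤ edgeLength G d σ τ ∧ edgeLength G d σ τ ≤ 1 := by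
  unfold edgeLength
  have h0 : 0 ≤ ∑ v ∈ univ.filter (fun v => σ v ≠ τ v),
      (d : ℝ)⁻¹ * ∑ u ∈ univ.filter (fun u => G.Adj v u), bonus (spoilCount G σ τ v u) :=
    sum_nonneg fun v _ => mul_nonneg (by positivity) (sum_nonneg fun u _ => (bonus_pos _).le)
  have h1 := min_le_left 1 (∑ v ∈ univ.filter (fun v => σ v ≠ τ v),
      (d : ℝ)⁻¹ * ∑ u ∈ univ.filter (fun u => G.Adj v u), bonus (spoilCount G σ τ v u))
  have h2 := le_min zero_le_one h0
  constructor <;> linarith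

lemma edgeLength_of_adjacent (hd1 : 1 ≤ d)
    (hd : ∀ w, (univ.filter fun x => G.Adj w x).card ≤ d)
    (hag : ∀ u, u ≠ v → σ u = τ u) (hab : σ v ≠ τ v) :
    edgeLength G d σ τ = 1 - 1 / 10000 * ((d : ℝ)⁻¹ *
      ∑ u ∈ univ.filter (fun u => G.Adj v u), bonus (spoilCount G σ τ v u)) := by
  have hs : (univ.filter fun w => σ w ≠ τ w) = {v} := by
    ext w
    simp only [mem_filter, mem_univ, true_and, mem_singleton]
    exact ⟨fun h => by_contra fun h' => h (hag w h'), fun h => h ▸ hab⟩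
  have hd0 : (0 : ℝ) < d := by exact_mod_cast hd1
  unfold edgeLength
  rw [hs, sum_singleton, min_eq_right]
  rw [inv_mul_le_iff₀ hd0, mul_one]
  refine (sum_le_card_mul fun u _ => bonus_le_one _).trans ?_
  rw [mul_one]
  exact_mod_cast hd v

variable {κ : ℝ}

/-- The expected loss of bonus at `u` caused by moves not touching `v`. -/
lemma sum_bonus_le_of_degree (hd : ∀ w, (univ.filter fun x => G.Adj w x).card ≤ d)
    (hω : ∀ z, 0 ≤ ω z ∧ ω z ≤ 1) (hκ : ∀ z, ω z * (L z).card = κ) {γ : ℝ}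
    (hγ : γ ≤ max 0 (κ - d - 2)) (hag : ∀ u, u ≠ v → σ u = τ u) (hσ : ListRespecting L σ)
    (u : V) :
    ∑ z, ∑ c, (if Touched G σ τ v z c then 0 else ω z * moveRate G L σ z c *
      (bonus (spoilCount G σ τ v u) -
        bonus (spoilCount G (kempeFlip G σ z c) (kempeFlip G τ z c) v u))) ≤
    bonus (spoilCount G σ τ v u) * (2 * d - if spoilCount G σ τ v u = 0 then 0 else 36 * γ) := by
  have hcard : ((otherNbrs G v u).card : ℝ) ≤ d := by
    refine Nat.cast_le.2 (le_trans (card_le_card fun w hw => ?_) (hd u))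
    rw [otherNbrs, mem_filter] at hw
    exact mem_filter.2 ⟨mem_univ _, hw.2.1⟩
  have hb := (bonus_pos (spoilCount G σ τ v u)).le
  split_ifs with hn
  · refine (sum_bonus_le (w := v) (C := ∅) hag hω (by simp)).trans
      (mul_le_mul_of_nonneg_left ?_ hb)
    simp only [card_empty, Nat.cast_zero, mul_zero, sub_zero]
    linarith
  · obtain ⟨w, C, hC, hgood⟩ := exists_improving_colors hag hσ hd hn
    refine (sum_bonus_le hag hω hgood).trans (mul_le_mul_of_nonneg_left ?_ hb)
    have h1 : γ ≤ ω w * C.card := by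
      refine hγ.trans (max_le (mul_nonneg (hω w).1 (Nat.cast_nonneg _)) ?_)
      have h2 : ((L w).card : ℝ) ≤ C.card + d + 2 := by exact_mod_cast hC
      have h3 := mul_le_mul_of_nonneg_left h2 (hω w).1
      have h4 := mul_le_mul_of_nonneg_right (hω w).2 (by positivity : (0 : ℝ) ≤ d + 2)
      rw [hκ w] at h3
      linarith
    linarith

/-- The change of `κ n (f σ - f τ)` in one step, for a function that is Lipschitz with respect
to the edge length. -/
lemma flipOp_sub_le_edgeLength (hd1 : 1 ≤ d)
    (hd : ∀ w, (univ.filter fun x => G.Adj w x).card ≤ d)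
    (hκ0 : 0 < κ) (hκ : ∀ z, κ ≤ (L z).card) (hκd : κ ≤ 2 * d) {γ : ℝ}
    (hγ : γ ≤ max 0 (κ - d - 2))
    (hf : ∀ σ τ, ListAdjacent L σ τ → f σ - f τ ≤ edgeLength G d σ τ)
    (hag : ∀ u, u ≠ v → σ u = τ u) (hab : σ v ≠ τ v)
    (hσ : ListRespecting L σ) (hτ : ListRespecting L τ) :
    κ * Fintype.card V * (flipOp G L f σ - flipOp G L f τ) ≤
      κ * Fintype.card V * edgeLength G d σ τ - κ +
        ∑ u ∈ univ.filter (fun u => G.Adj v u),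
          (11 / 6 - (if Nontame G σ τ v u then 1 / 200 else 0) +
            1 / 10000 * (bonus (spoilCount G σ τ v u) *
              (10 - if spoilCount G σ τ v u = 0 then 0 else 36 * (γ / d)))) := by
  have hd0 : (0 : ℝ) < d := by exact_mod_cast hd1
  have hL0 : ∀ z, (0 : ℝ) < (L z).card := fun z => hκ0.trans_le (hκ z)
  have hω : ∀ z, 0 ≤ κ / (L z).card ∧ κ / (L z).card ≤ 1 := fun z =>
    ⟨(div_pos hκ0 (hL0 z)).le, (div_le_one (hL0 z)).2 (hκ z)⟩
  have hωκ : ∀ z, κ / (L z).card * (L z).card = κ := fun z => div_mul_cancel₀ _ (hL0 z).ne'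
  have hf1 : ∀ x y, ListRespecting L x → ListRespecting L y → f x - f y ≤ hammCol x y := by
    intro x y hx hy
    have := sub_le_hammCol_of_adjacent (L := L) (f := f) (l := 1)
      (fun σ τ h => (hf σ τ h).trans (edgeLength_mem G d σ τ).2) hx hy
    linarith
  have key := flipOp_sub_le (G := G) (ω := fun z => κ / (L z).card) hag hab hσ hτ hf1 hω hωκ
    (hf σ τ ⟨hσ, hτ, v, hab, hag⟩) (edgeLength_mem G d σ τ).2
    (Q := fun z c => edgeLength G d (kempeFlip G σ z c) (kempeFlip G τ z c))
    (fun z c hT hFσ hFτ => hf _ _ ⟨hFσ, hFτ, v, by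
      rw [(kempeFlip_apply_of_not_touched hag hT).1, (kempeFlip_apply_of_not_touched hag hT).2]
      exact hab, fun u hu => kempeFlip_eq_of_not_touched hag hT hu⟩)
  refine key.trans ?_
  have hloss : ∑ z, ∑ c, (if Touched G σ τ v z c then 0 else
      κ / (L z).card * moveRate G L σ z c *
        (edgeLength G d (kempeFlip G σ z c) (kempeFlip G τ z c) - edgeLength G d σ τ)) =
      ∑ u ∈ univ.filter (fun u => G.Adj v u), 1 / 10000 * (d : ℝ)⁻¹ *
        ∑ z, ∑ c, (if Touched G σ τ v z c then 0 else κ / (L z).card * moveRate G L σ z c *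
          (bonus (spoilCount G σ τ v u) -
            bonus (spoilCount G (kempeFlip G σ z c) (kempeFlip G τ z c) v u))) := by
    rw [← mul_sum, sum_comm.trans (sum_congr rfl fun z _ => sum_comm), mul_sum]
    refine sum_congr rfl fun z _ => ?_
    rw [mul_sum]
    refine sum_congr rfl fun c _ => ?_
    by_cases hT : Touched G σ τ v z c
    · simp [hT]
    · simp only [hT, if_false]
      rw [edgeLength_of_adjacent hd1 hd hag hab, edgeLength_of_adjacent (v := v) hd1 hd
        (fun u hu => kempeFlip_eq_of_not_touched hag hT hu)
        (by rw [(kempeFlip_apply_of_not_touched hag hT).1,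
          (kempeFlip_apply_of_not_touched hag hT).2]; exact hab), ← mul_sum, sum_sub_distrib]
      ring
  have hone : 1 - edgeLength G d σ τ = 1 / 10000 * ((d : ℝ)⁻¹ *
      ∑ u ∈ univ.filter (fun u => G.Adj v u), bonus (spoilCount G σ τ v u)) := by
    rw [edgeLength_of_adjacent hd1 hd hag hab]; ring
  have hdeg : ((univ.filter fun u => G.Adj v u).card : ℝ) ≤ d := by exact_mod_cast hd v
  have hB : (1 - edgeLength G d σ τ) * (4 * (univ.filter fun u => G.Adj v u).card + 2 * κ) ≤
      ∑ u ∈ univ.filter (fun u => G.Adj v u), 1 / 10000 * (bonus (spoilCount G σ τ v u) * 8) := by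
    refine (mul_le_mul_of_nonneg_left (by linarith : _ ≤ 8 * (d : ℝ))
      (sub_nonneg.2 (edgeLength_mem G d σ τ).2)).trans_eq ?_
    rw [hone, ← mul_sum, ← sum_mul]
    field_simp
  have hA : ∑ u ∈ univ.filter (fun u => G.Adj v u), 1 / 10000 * (d : ℝ)⁻¹ *
        ∑ z, ∑ c, (if Touched G σ τ v z c then 0 else κ / (L z).card * moveRate G L σ z c *
          (bonus (spoilCount G σ τ v u) -
            bonus (spoilCount G (kempeFlip G σ z c) (kempeFlip G τ z c) v u))) ≤
      ∑ u ∈ univ.filter (fun u => G.Adj v u), 1 / 10000 * (bonus (spoilCount G σ τ v u) *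
        (2 - if spoilCount G σ τ v u = 0 then 0 else 36 * (γ / d))) := by
    refine sum_le_sum fun u _ => ?_
    refine (mul_le_mul_of_nonneg_left (sum_bonus_le_of_degree hd hω hωκ hγ hag hσ u)
      (by positivity)).trans_eq ?_
    split_ifs <;> field_simp
    ring
  have hcards : 11 / 6 * ((univ.filter fun u => G.Adj v u).card : ℝ) -
      (1 / 200) * (univ.filter fun u => G.Adj v u ∧ Nontame G σ τ v u).card =
      ∑ u ∈ univ.filter (fun u => G.Adj v u),
        (11 / 6 - (if Nontame G σ τ v u then (1 : ℝ) / 200 else 0)) := by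
    rw [sum_sub_distrib, sum_const, nsmul_eq_mul, ← filter_filter, ← sum_filter, sum_const,
      nsmul_eq_mul]
    ring
  rw [hloss]
  have hsplit : ∑ u ∈ univ.filter (fun u => G.Adj v u),
          (11 / 6 - (if Nontame G σ τ v u then 1 / 200 else 0) +
            1 / 10000 * (bonus (spoilCount G σ τ v u) *
              (10 - if spoilCount G σ τ v u = 0 then 0 else 36 * (γ / d)))) =
      ∑ u ∈ univ.filter (fun u => G.Adj v u),
        (11 / 6 - (if Nontame G σ τ v u then (1 : ℝ) / 200 else 0)) +
      (∑ u ∈ univ.filter (fun u => G.Adj v u), 1 / 10000 * (bonus (spoilCount G σ τ v u) *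
        (2 - if spoilCount G σ τ v u = 0 then 0 else 36 * (γ / d))) +
      ∑ u ∈ univ.filter (fun u => G.Adj v u), 1 / 10000 * (bonus (spoilCount G σ τ v u) * 8)) := by
    rw [← sum_add_distrib, ← sum_add_distrib]
    exact sum_congr rfl fun u _ => by ring
  rw [hsplit, ← hcards]
  linarith

end Contraction

section Threshold

variable {V : Type*} [Fintype V] [DecidableEq V] {q : ℕ} {G : SimpleGraph V}
  {L : V → Finset (Fin q)} {f : (V → Fin q) → ℝ} {σ τ : V → Fin q} {v : V} {d : ℕ} {κ γ : ℝ}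

/-- The amount by which the threshold `11 / 6` is lowered. -/
noncomputable def thresholdGap : ℝ := 7 / 20000 * (1 / 37) ^ 10

lemma thresholdGap_pos : 0 < thresholdGap := by unfold thresholdGap; positivity

lemma thresholdGap_lt : thresholdGap < 1 / 10000 := by unfold thresholdGap; norm_num

lemma flipOp_const_mul (a : ℝ) (σ : V → Fin q) :
    flipOp G L (fun x => a * f x) σ = a * flipOp G L f σ := by
  unfold flipOp
  simp only [mul_add, mul_sum]
  congr 1
  exact sum_congr rfl fun z _ => sum_congr rfl fun c _ => by ring

/-- The drift caused by a single neighbor of the disagreement. -/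
lemma neighbor_drift_le (hγ : 0 ≤ γ) (u : V) :
    (11 / 6 - (if Nontame G σ τ v u then 1 / 200 else 0) +
      1 / 10000 * (bonus (spoilCount G σ τ v u) *
        (10 - if spoilCount G σ τ v u = 0 then 0 else 36 * (γ / d))) : ℝ) ≤
    11 / 6 + 1 / 1000 - if Nontame G σ τ v u then 1 / 200 else 0 := by
  have h1 := bonus_pos (spoilCount G σ τ v u)
  have h2 := bonus_le_one (spoilCount G σ τ v u)
  have h3 : (0 : ℝ) ≤ if spoilCount G σ τ v u = 0 then 0 else 36 * (γ / d) := by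
    split_ifs <;> positivity
  have h4 := mul_nonneg h1.le h3
  linarith

lemma neighbor_drift_le_of_large (hγ : 17 / 36 ≤ γ / d) (hγ0 : 0 ≤ γ) (u : V) :
    (11 / 6 - (if Nontame G σ τ v u then 1 / 200 else 0) +
      1 / 10000 * (bonus (spoilCount G σ τ v u) *
        (10 - if spoilCount G σ τ v u = 0 then 0 else 36 * (γ / d))) : ℝ) ≤
    11 / 6 - 2 * thresholdGap := by
  have hgap := thresholdGap_lt
  by_cases h : Nontame G σ τ v u
  · have := neighbor_drift_le (G := G) (σ := σ) (τ := τ) (v := v) (d := d) hγ0 u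
    rw [if_pos h] at this ⊢
    linarith
  · rw [if_neg h]
    have h0 : spoilCount G σ τ v u ≠ 0 := fun h0 => h (.inr (.inr (.inl h0)))
    have h10 : spoilCount G σ τ v u ≤ 10 := not_lt.1 fun h10 => h (.inr (.inr (.inr h10)))
    have hb : (1 / 37 : ℝ) ^ 10 ≤ bonus (spoilCount G σ τ v u) := bonus_anti h10
    rw [if_neg h0, thresholdGap]
    nlinarith [bonus_pos (spoilCount G σ τ v u)]

/-- One step of the dynamics contracts the edge length, provided its drift is negative. -/
lemma adjLipschitz_flipOp [Nonempty V] (hd1 : 1 ≤ d)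
    (hd : ∀ w, (univ.filter fun x => G.Adj w x).card ≤ d)
    (hκ0 : 0 < κ) (hκ : (∀ z, (L z).Nonempty) → ∀ z, κ ≤ (L z).card) (hκd : κ ≤ 2 * d)
    (hγ : γ ≤ max 0 (κ - d - 2))
    (hdrift : ∀ (σ τ : V → Fin q) (v : V), ∑ u ∈ univ.filter (fun u => G.Adj v u),
      (11 / 6 - (if Nontame G σ τ v u then 1 / 200 else 0) +
        1 / 10000 * (bonus (spoilCount G σ τ v u) *
          (10 - if spoilCount G σ τ v u = 0 then 0 else 36 * (γ / d)))) ≤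
      κ - thresholdGap * d)
    {l : ℝ} (hl : 0 < l) (hf : AdjLipschitz L (edgeLength G d) l f) :
    AdjLipschitz L (edgeLength G d) (l * (1 - thresholdGap / 2 / Fintype.card V))
      (flipOp G L f) := by
  rintro σ τ ⟨hσ, hτ, v, hab, hag⟩
  have hn : (0 : ℝ) < Fintype.card V := by exact_mod_cast Fintype.card_pos
  have hf' : ∀ σ τ, ListAdjacent L σ τ → l⁻¹ * f σ - l⁻¹ * f τ ≤ edgeLength G d σ τ := by
    intro σ τ h
    rw [← mul_sub, inv_mul_le_iff₀ hl]
    exact hf σ τ h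
  have key := flipOp_sub_le_edgeLength (f := fun x => l⁻¹ * f x) hd1 hd hκ0
    (hκ fun z => ⟨_, hσ z⟩) hκd hγ hf' hag hab hσ hτ
  have hdr := hdrift σ τ v
  rw [flipOp_const_mul, flipOp_const_mul, ← mul_sub] at key
  have hgap := thresholdGap_pos
  have hΦ := (edgeLength_mem G d σ τ).2
  have h1 : κ * Fintype.card V * (l⁻¹ * (flipOp G L f σ - flipOp G L f τ)) ≤
      κ * Fintype.card V * ((1 - thresholdGap / 2 / Fintype.card V) * edgeLength G d σ τ) := by
    have h2 : κ * Fintype.card V * ((1 - thresholdGap / 2 / Fintype.card V) *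
        edgeLength G d σ τ) =
        κ * Fintype.card V * edgeLength G d σ τ - thresholdGap / 2 * (κ * edgeLength G d σ τ) := by
      field_simp
    have h3 : κ * edgeLength G d σ τ ≤ κ * 1 := mul_le_mul_of_nonneg_left hΦ hκ0.le
    have h4 := mul_le_mul_of_nonneg_left (h3.trans (by linarith : κ * 1 ≤ 2 * d))
      (by positivity : 0 ≤ thresholdGap / 2)
    rw [h2]
    linarith
  have h5 := le_of_mul_le_mul_left h1 (by positivity)
  rw [inv_mul_le_iff₀ hl] at h5
  linarith

/-- The parameters of the potential for which the drift is negative. -/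
def HasNegativeDrift (G : SimpleGraph V) (L : V → Finset (Fin q)) : Prop :=
  ∃ d : ℕ, ∃ κ γ : ℝ, 1 ≤ d ∧ (∀ w, (univ.filter fun x => G.Adj w x).card ≤ d) ∧ 0 < κ ∧
    ((∀ z, (L z).Nonempty) → ∀ z, κ ≤ (L z).card) ∧ κ ≤ 2 * d ∧ γ ≤ max 0 (κ - d - 2) ∧
    ∀ (σ τ : V → Fin q) (v : V), ∑ u ∈ univ.filter (fun u => G.Adj v u),
      (11 / 6 - (if Nontame G σ τ v u then 1 / 200 else 0) +
        1 / 10000 * (bonus (spoilCount G σ τ v u) *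
          (10 - if spoilCount G σ τ v u = 0 then 0 else 36 * (γ / d)))) ≤
      κ - thresholdGap * d

lemma hasNegativeDrift_of_six_le {Δ : ℕ} (hΔ : 6 ≤ Δ)
    (hdeg : ∀ v, (univ.filter fun w => G.Adj v w).card ≤ Δ)
    (hL : ∀ v, ((11 : ℝ) / 6 - thresholdGap) * Δ ≤ (L v).card) : HasNegativeDrift G L := by
  have hgap := thresholdGap_pos
  have hgap' := thresholdGap_lt
  have h6 : (6 : ℝ) ≤ Δ := by exact_mod_cast hΔ
  have hpos : 0 < (11 / 6 - thresholdGap) * (Δ : ℝ) := mul_pos (by linarith) (by linarith)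
  have hγ : 17 / 36 * (Δ : ℝ) ≤ (11 / 6 - thresholdGap) * Δ - Δ - 2 := by nlinarith
  refine ⟨Δ, (11 / 6 - thresholdGap) * Δ, (11 / 6 - thresholdGap) * Δ - Δ - 2, by omega, hdeg,
    hpos, fun _ => hL, by nlinarith, le_max_right _ _, fun σ τ v => ?_⟩
  refine (sum_le_card_mul fun u _ => neighbor_drift_le_of_large
    ((le_div_iff₀ (by linarith)).2 hγ) (by linarith) u).trans ?_
  have hv : ((univ.filter fun w => G.Adj v w).card : ℝ) ≤ Δ := by exact_mod_cast hdeg v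
  have := mul_le_mul_of_nonneg_right hv (by linarith : 0 ≤ 11 / 6 - 2 * thresholdGap)
  linarith

lemma hasNegativeDrift_of_lt_six {Δ : ℕ} (hΔ : Δ < 6)
    (hdeg : ∀ v, (univ.filter fun w => G.Adj v w).card ≤ Δ)
    (hL : ∀ v, ((11 : ℝ) / 6 - thresholdGap) * Δ ≤ (L v).card) : HasNegativeDrift G L := by
  have hgap := thresholdGap_pos
  have hgap' := thresholdGap_lt
  have hterm : ∀ (d : ℕ) (σ τ : V → Fin q) (v : V), ∑ u ∈ univ.filter (fun u => G.Adj v u),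
      (11 / 6 - (if Nontame G σ τ v u then 1 / 200 else 0) +
        1 / 10000 * (bonus (spoilCount G σ τ v u) *
          (10 - if spoilCount G σ τ v u = 0 then 0 else 36 * ((0 : ℝ) / d)))) ≤
      (Δ : ℝ) * (11 / 6 + 1 / 1000) := by
    intro d σ τ v
    refine (sum_le_card_mul (M := 11 / 6 + 1 / 1000) fun u _ => ?_).trans ?_
    · have h := neighbor_drift_le (G := G) (σ := σ) (τ := τ) (v := v) (d := d) le_rfl u
      have h' : (0 : ℝ) ≤ if Nontame G σ τ v u then 1 / 200 else 0 := by positivity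
      linarith
    exact mul_le_mul_of_nonneg_right (by exact_mod_cast hdeg v) (by norm_num)
  rcases Nat.eq_zero_or_pos Δ with rfl | hΔ0
  · refine ⟨1, 1, 0, le_rfl, fun w => (hdeg w).trans zero_le_one, one_pos,
      fun h z => by exact_mod_cast card_pos.2 (h z), by norm_num, le_max_left _ _,
      fun σ τ v => (hterm 1 σ τ v).trans ?_⟩
    rw [Nat.cast_zero, Nat.cast_one]
    linarith
  · have h0 : (1 : ℝ) ≤ Δ := by exact_mod_cast hΔ0
    refine ⟨Δ, 2 * Δ, 0, hΔ0, hdeg, by linarith, fun _ z => ?_, le_rfl, le_max_left _ _,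
      fun σ τ v => (hterm Δ σ τ v).trans (by nlinarith)⟩
    have hz := hL z
    by_contra hcon
    have h1 : (L z).card < 2 * Δ := by
      rw [not_le] at hcon
      exact_mod_cast hcon
    have h2 : ((L z).card : ℝ) + 1 ≤ 2 * Δ := by exact_mod_cast h1
    have h5 : (Δ : ℝ) ≤ 5 := by exact_mod_cast Nat.le_of_lt_succ hΔ
    nlinarith

end Threshold

/-- the flip dynamics admits an `O(n)`-amortized convergent coupling below
the `11/6` threshold.  There are a constant `ε > 0` and flip parameters `p 1 = 1`,
`p 2, …, p 6 ∈ (0,1)`, `p j = 0` for `j ≥ 7`, such that for all integers `q, Δ` there is a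
constant `K = K(q,Δ) > 0` with: for every list-coloring instance `(G, L)` on `n` vertices with
maximum degree at most `Δ`, lists `L v ⊆ Fin q` and `|L v| ≥ (11/6 − ε)·Δ` for all `v`, the
flip dynamics with these parameters admits a `C`-amortized convergent coupling w.r.t. Hamming
distance on (proper) colorings with `C ≤ K·n`. -/
theorem flip_dynamics_amortized_coupling :
    ∃ ε : ℝ, 0 < ε ∧
      ∃ p : ℕ → ℝ, p 1 = 1 ∧ (∀ j, 2 ≤ j → j ≤ 6 → 0 < p j ∧ p j < 1) ∧
        (∀ j, 7 ≤ j → p j = 0) ∧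
        ∀ q Δ : ℕ, ∃ K : ℝ, 0 < K ∧
          ∀ (V : Type) [Fintype V] [DecidableEq V],
            ∀ (G : SimpleGraph V) (L : V → Finset (Fin q)),
              (∀ v : V, (Finset.univ.filter fun w => G.Adj v w).card ≤ Δ) →
              (∀ v : V, ((11 : ℝ) / 6 - ε) * (Δ : ℝ) ≤ ((L v).card : ℝ)) →
              ∃ coup : (V → Fin q) → (V → Fin q) → ℕ → (V → Fin q) → (V → Fin q) → ℝ,
                IsCoupling (flipMatrix G Finset.univ L L p) coup ∧
                  ∀ σ τ : V → Fin q,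
                    IsProperListColoring G L σ → IsProperListColoring G L τ →
                      (∑' t : ℕ, ENNReal.ofReal (∑ a : V → Fin q, ∑ b : V → Fin q,
                          coup σ τ t a b * (hammCol a b : ℝ)))
                        ≤ ENNReal.ofReal (K * (Fintype.card V : ℝ) * (hammCol σ τ : ℝ)) := by
  refine ⟨thresholdGap, thresholdGap_pos, flipParam, rfl, fun j h2 h6 => ?_,
    fun j hj => flipParam_of_seven_le hj, fun q Δ => ⟨2 / (thresholdGap / 2),
      div_pos two_pos (half_pos thresholdGap_pos), fun V _ _ G L hdeg hL => ?_⟩⟩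
  · interval_cases j <;> norm_num [flipParam]
  have hdrift : HasNegativeDrift G L := (le_or_gt 6 Δ).elim
    (fun hΔ => hasNegativeDrift_of_six_le hΔ hdeg hL)
    fun hΔ => hasNegativeDrift_of_lt_six hΔ hdeg hL
  obtain ⟨d, κ, γ, hd1, hd, hκ0, hκ, hκd, hγ, hdr⟩ := hdrift
  exact exists_amortized_coupling_of_contraction (half_pos thresholdGap_pos)
    (by linarith [thresholdGap_lt]) (edgeLength G d) (edgeLength_mem G d) fun l f hl hf =>
      adjLipschitz_flipOp hd1 hd hκ0 hκ hκd hγ hdr hl hf
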